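/- Pointwise convex-combination comparison (the stronger claim proved inside Theorem A.1): Let α, β ≥ 0 with α + β = 1, let η₁, η₂ : (0,∞) → [0,1] satisfy η₁(ω) ≥ η₂(ω) for all ω > 0, and let φ be a bounded nonnegative incoming datum. Let g₁, g₂, and g be bounded solutions of the linearized phonon transport equation with zero initial data, the same incoming boundary condition φ at x = 0 for μ > 0, and reflective boundary conditions at x = 1 for μ < 0 with reflection coefficients η₁, η₂, and α η₁ + β η₂, respectively. Then α g₁(t,x,μ,ω) + β g₂(t,x,μ,ω) ≥ g(t,x,μ,ω) at every point (t,x,μ,ω) of the domain. -/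

import Mathlib

open MeasureTheory Set

/-- `g*(ω) = ω² eʷ/(eʷ−1)²`. -/
noncomputable def gstar (ω : ℝ) : ℝ := ω ^ 2 * Real.exp ω / (Real.exp ω - 1) ^ 2

/-- Bracket: `⟨f⟩ = ∫_{ω>0} ∫_{μ∈[−1,1]} f(μ,ω) dμ dω`. -/
noncomputable def bracket (f : ℝ → ℝ → ℝ) : ℝ :=
  ∫ ω in Ioi (0:ℝ), ∫ μ in Icc (-1:ℝ) 1, f μ ω

/-- `⟨ω g*⟩ = 2 ∫_0^∞ ω g*(ω) dω`. -/
noncomputable def wgstar : ℝ := 2 * ∫ ω in Ioi (0:ℝ), ω * gstar ω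

/-- Normalized Maxwellian `M(ω) = ω g*(ω)/⟨ω g*⟩`. -/
noncomputable def Mw (ω : ℝ) : ℝ := ω * gstar ω / wgstar

/-- Linearized BGK collision operator `(𝓛g)(μ,ω) = −ω g(μ,ω) + M(ω) ⟨ω g⟩`. -/
noncomputable def coll (g : ℝ → ℝ → ℝ) (μ ω : ℝ) : ℝ :=
  -(ω * g μ ω) + Mw ω * bracket (fun μ' ω' => ω' * g μ' ω')

/-- Integrability of `f(μ,ω)` sufficient for the iterated bracket to be finite. -/
def BracketIntegrable (f : ℝ → ℝ → ℝ) : Prop :=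
  (∀ ω ∈ Ioi (0:ℝ), IntegrableOn (fun μ => f μ ω) (Icc (-1:ℝ) 1)) ∧
  IntegrableOn (fun ω => ∫ μ in Icc (-1:ℝ) 1, f μ ω) (Ioi (0:ℝ))

/-- The forward linearized phonon transport equation
`∂_t g + μ ω ∂_x g = −ω g + M(ω)⟨ω g⟩(t,x)` on `[0,T]×[0,1]×[−1,1]×(0,∞)`,
together with differentiability of the solution in `t` and `x`. -/
def SatisfiesPTE (Tmax : ℝ) (g : ℝ → ℝ → ℝ → ℝ → ℝ) : Prop :=
  ∀ t ∈ Icc (0:ℝ) Tmax, ∀ x ∈ Icc (0:ℝ) 1, ∀ μ ∈ Icc (-1:ℝ) 1, ∀ ω ∈ Ioi (0:ℝ),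
    DifferentiableAt ℝ (fun s => g s x μ ω) t ∧
    DifferentiableAt ℝ (fun y => g t y μ ω) x ∧
    deriv (fun s => g s x μ ω) t + μ * ω * deriv (fun y => g t y μ ω) x
      = coll (fun μ' ω' => g t x μ' ω') μ ω

/-- The adjoint equation `∂_t h + μ ω ∂_x h = ω h − M(ω)⟨ω h⟩ = −𝓛h`. -/
def SatisfiesAdjointPTE (Tmax : ℝ) (h : ℝ → ℝ → ℝ → ℝ → ℝ) : Prop :=
  ∀ t ∈ Icc (0:ℝ) Tmax, ∀ x ∈ Icc (0:ℝ) 1, ∀ μ ∈ Icc (-1:ℝ) 1, ∀ ω ∈ Ioi (0:ℝ),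
    DifferentiableAt ℝ (fun s => h s x μ ω) t ∧
    DifferentiableAt ℝ (fun y => h t y μ ω) x ∧
    deriv (fun s => h s x μ ω) t + μ * ω * deriv (fun y => h t y μ ω) x
      = -(coll (fun μ' ω' => h t x μ' ω') μ ω)

/-- Boundedness of a function of `(t,x,μ,ω)`. -/
def BoundedFn (g : ℝ → ℝ → ℝ → ℝ → ℝ) : Prop := ∃ B, ∀ t x μ ω, |g t x μ ω| ≤ B

/-- `ω g(t,x,·,·)` is integrable in `(μ,ω)` at every point of the domain, so
that `⟨ω g⟩(t,x)` is finite. -/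
def BracketIntegrableSol (Tmax : ℝ) (g : ℝ → ℝ → ℝ → ℝ → ℝ) : Prop :=
  ∀ t ∈ Icc (0:ℝ) Tmax, ∀ x ∈ Icc (0:ℝ) 1,
    BracketIntegrable (fun μ ω => ω * g t x μ ω)

/-- `g` is a bounded-domain solution of the forward problem with reflection
coefficient `η` and incoming datum `φ`: the PDE, zero initial data, incoming
boundary condition at `x = 0` for `μ > 0`, and reflective boundary condition
at `x = 1` for `μ < 0`. -/
def IsForwardSolution (Tmax : ℝ) (η : ℝ → ℝ) (φ : ℝ → ℝ → ℝ → ℝ)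
    (g : ℝ → ℝ → ℝ → ℝ → ℝ) : Prop :=
  SatisfiesPTE Tmax g ∧
  (∀ x ∈ Icc (0:ℝ) 1, ∀ μ ∈ Icc (-1:ℝ) 1, ∀ ω ∈ Ioi (0:ℝ), g 0 x μ ω = 0) ∧
  (∀ t ∈ Icc (0:ℝ) Tmax, ∀ μ ∈ Ioc (0:ℝ) 1, ∀ ω ∈ Ioi (0:ℝ), g t 0 μ ω = φ t μ ω) ∧
  (∀ t ∈ Icc (0:ℝ) Tmax, ∀ μ ∈ Ico (-1:ℝ) 0, ∀ ω ∈ Ioi (0:ℝ), g t 1 μ ω = η ω * g t 1 (-μ) ω)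

/-- `h` is a bounded-domain solution of the adjoint problem with reflection
coefficient `η` and measurement profile `ψ`: the adjoint PDE, zero final data
at `t = Tmax`, boundary condition `h(t,0,μ,ω) = ψ(t) g*(ω)/μ` for `μ < 0`,
and reflective boundary condition at `x = 1` for `μ > 0`. -/
def IsAdjointSolution (Tmax : ℝ) (η : ℝ → ℝ) (ψ : ℝ → ℝ)
    (h : ℝ → ℝ → ℝ → ℝ → ℝ) : Prop :=
  SatisfiesAdjointPTE Tmax h ∧
  (∀ x ∈ Icc (0:ℝ) 1, ∀ μ ∈ Icc (-1:ℝ) 1, ∀ ω ∈ Ioi (0:ℝ), h Tmax x μ ω = 0) ∧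
  (∀ t ∈ Icc (0:ℝ) Tmax, ∀ μ ∈ Ico (-1:ℝ) 0, ∀ ω ∈ Ioi (0:ℝ), h t 0 μ ω = ψ t * gstar ω / μ) ∧
  (∀ t ∈ Icc (0:ℝ) Tmax, ∀ μ ∈ Ioc (0:ℝ) 1, ∀ ω ∈ Ioi (0:ℝ), h t 1 μ ω = η ω * h t 1 (-μ) ω)

section

open Filter Topology

/-- Bounded, separately continuous functions of two real variables. -/
structure SepCont (B : ℝ) (H : ℝ → ℝ → ℝ) : Prop where
  left : ∀ x, Continuous fun t => H t x
  right : ∀ t, Continuous (H t)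
  bound : ∀ t x, |H t x| ≤ B

/-- The flux of `(G, F)` out of the rectangle `[a,b] × [c,d]`. -/
noncomputable def circ (F G : ℝ → ℝ → ℝ) (a b c d : ℝ) : ℝ :=
  (∫ y in c..d, (G b y - G a y)) + ∫ s in a..b, (F s d - F s c)

theorem SepCont.swap {B : ℝ} {H : ℝ → ℝ → ℝ} (h : SepCont B H) :
    SepCont B (fun x t => H t x) :=
  ⟨h.right, h.left, fun t x => h.bound x t⟩

theorem circ_swap (F G : ℝ → ℝ → ℝ) (a b c d : ℝ) :
    circ (fun x t => G t x) (fun x t => F t x) c d a b = circ F G a b c d := by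
  unfold circ; exact add_comm _ _

section
variable {B : ℝ} {F G : ℝ → ℝ → ℝ}

theorem circ_glue_left (hF : SepCont B F) (hG : SepCont B G) (a b e c d : ℝ) :
    circ F G a b c d + circ F G b e c d = circ F G a e c d := by
  unfold circ
  have h1 : (∫ y in c..d, (G b y - G a y)) + (∫ y in c..d, (G e y - G b y))
      = ∫ y in c..d, (G e y - G a y) := by
    rw [← intervalIntegral.integral_add]
    · congr 1; ext y; ring
    · exact ((hG.right b).sub (hG.right a)).intervalIntegrable _ _
    · exact ((hG.right e).sub (hG.right b)).intervalIntegrable _ _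
  have h2 := intervalIntegral.integral_add_adjacent_intervals (μ := volume)
    (((hF.left d).sub (hF.left c)).intervalIntegrable a b)
    (((hF.left d).sub (hF.left c)).intervalIntegrable b e)
  simp only [Pi.sub_apply] at h2
  rw [← h1, ← h2]; ring

theorem circ_glue_right (hF : SepCont B F) (hG : SepCont B G) (a b c d e : ℝ) :
    circ F G a b c d + circ F G a b d e = circ F G a b c e := by
  have := circ_glue_left hG.swap hF.swap c d e a b
  rwa [circ_swap F G a b c d, circ_swap F G a b d e, circ_swap F G a b c e] at this

theorem circ_self_left (a c d : ℝ) : circ F G a a c d = 0 := by simp [circ]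

theorem circ_self_right (a b c : ℝ) : circ F G a b c c = 0 := by simp [circ]

theorem circ_continuous_left (hF : SepCont B F) (hG : SepCont B G) (c d : ℝ) {a b : ℝ → ℝ}
    (ha : Continuous a) (hb : Continuous b) :
    Continuous fun h => circ F G (a h) (b h) c d := by
  unfold circ
  refine Continuous.add ?_ ?_
  · refine intervalIntegral.continuous_of_dominated_interval (bound := fun _ => 2 * B) ?_ ?_ ?_ ?_
    · intro h; exact ((hG.right _).sub (hG.right _)).aestronglyMeasurable
    · intro h; filter_upwards with y _
      rw [Real.norm_eq_abs]
      have h1 := hG.bound (b h) y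
      have h2 := hG.bound (a h) y
      rw [abs_le] at *; constructor <;> linarith
    · exact intervalIntegrable_const
    · filter_upwards with y _
      exact ((hG.left y).comp hb).sub ((hG.left y).comp ha)
  · have hc : Continuous fun s => F s d - F s c := (hF.left d).sub (hF.left c)
    have : ∀ h, (∫ s in (a h)..(b h), (F s d - F s c))
        = (∫ s in (0:ℝ)..(b h), (F s d - F s c)) - ∫ s in (0:ℝ)..(a h), (F s d - F s c) := by
      intro h
      rw [intervalIntegral.integral_interval_sub_left] <;> exact hc.intervalIntegrable _ _
    simp_rw [this]
    have hp := intervalIntegral.continuous_primitive (μ := volume) (fun a b => hc.intervalIntegrable a b) 0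
    exact (hp.comp hb).sub (hp.comp ha)

end

/-- A property of rectangles stable under gluing holds as soon as it holds for all sufficiently
small rectangles of bounded eccentricity. -/
theorem rect_grid {Good : ℝ → ℝ → ℝ → ℝ → Prop}
    (hl : ∀ a b e c d, a ≤ b → b ≤ e → c ≤ d → Good a b c d → Good b e c d → Good a e c d)
    (hr : ∀ a b c d e, a ≤ b → c ≤ d → d ≤ e → Good a b c d → Good a b d e → Good a b c e)
    {a b c d δ : ℝ} (hab : a < b) (hcd : c < d) (hδ : 0 < δ)
    (h : ∀ a' b' c' d', a ≤ a' → a' < b' → b' ≤ b → c ≤ c' → c' < d' → d' ≤ d →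
      b' - a' < δ → d' - c' < δ → d' - c' ≤ 2 * (b' - a') → b' - a' ≤ 2 * (d' - c') →
      Good a' b' c' d') : Good a b c d := by
  have key : ∀ ε : ℝ, 0 < ε → ∀ L : ℝ, 0 < L → ε ≤ L → ∃ n : ℕ, 0 < n ∧ L / n ≤ ε ∧ ε ≤ 2 * (L / n) := by
    intro ε hε L hL hεL
    refine ⟨⌈L / ε⌉₊, Nat.ceil_pos.2 (by positivity), ?_, ?_⟩
    · have h1 := Nat.le_ceil (L / ε)
      have h0 : (0:ℝ) < ⌈L / ε⌉₊ := by exact_mod_cast Nat.ceil_pos.2 (by positivity)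
      rw [div_le_iff₀ hε] at h1
      rw [div_le_iff₀ h0]; linarith
    · have h1 := Nat.ceil_lt_add_one (a := L / ε) (by positivity)
      have h0 : (0:ℝ) < ⌈L / ε⌉₊ := by exact_mod_cast Nat.ceil_pos.2 (by positivity)
      have h2 : (1:ℝ) ≤ L / ε := by rwa [le_div_iff₀ hε, one_mul]
      have h3 : (⌈L / ε⌉₊ : ℝ) ≤ 2 * (L / ε) := by linarith
      rw [← mul_div_assoc, le_div_iff₀ h0]
      calc ε * ⌈L / ε⌉₊ ≤ ε * (2 * (L / ε)) := by gcongr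
        _ = 2 * L := by field_simp
  obtain ⟨ε, hε, hεδ, hε1, hε2⟩ : ∃ ε > 0, ε < δ ∧ ε ≤ b - a ∧ ε ≤ d - c := by
    refine ⟨min (δ / 2) (min (b - a) (d - c)), ?_, ?_, ?_, ?_⟩
    · have : 0 < b - a := by linarith
      have : 0 < d - c := by linarith
      positivity
    · exact lt_of_le_of_lt (min_le_left _ _) (by linarith)
    · exact (min_le_right _ _).trans (min_le_left _ _)
    · exact (min_le_right _ _).trans (min_le_right _ _)
  obtain ⟨m, hm, hm1, hm2⟩ := key ε hε (b - a) (by linarith) hε1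
  obtain ⟨n, hn, hn1, hn2⟩ := key ε hε (d - c) (by linarith) hε2
  set p := (b - a) / m with hp
  set q := (d - c) / n with hq
  have hm0 : (0:ℝ) < m := by exact_mod_cast hm
  have hn0 : (0:ℝ) < n := by exact_mod_cast hn
  have hp0 : 0 < p := div_pos (by linarith) hm0
  have hq0 : 0 < q := div_pos (by linarith) hn0
  have hpm : a + m * p = b := by rw [hp]; field_simp; ring
  have hqn : c + n * q = d := by rw [hq]; field_simp; ring
  have hcell : ∀ i < m, ∀ j < n, Good (a + i * p) (a + (i + 1 : ℕ) * p) (c + j * q) (c + (j + 1 : ℕ) * q) := by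
    intro i hi j hj
    have hi' : ((i + 1 : ℕ) : ℝ) ≤ m := by exact_mod_cast hi
    have hj' : ((j + 1 : ℕ) : ℝ) ≤ n := by exact_mod_cast hj
    have e1 : ((i + 1 : ℕ) : ℝ) * p ≤ m * p := by gcongr
    have e2 : ((j + 1 : ℕ) : ℝ) * q ≤ n * q := by gcongr
    have e3 : 0 ≤ (i : ℝ) * p := by positivity
    have e4 : 0 ≤ (j : ℝ) * q := by positivity
    push_cast at *
    apply h <;> nlinarith
  have hrow : ∀ i < m, ∀ j, 0 < j → j ≤ n → Good (a + i * p) (a + (i + 1 : ℕ) * p) c (c + j * q) := by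
    intro i hi j hj
    induction j, hj using Nat.le_induction with
    | base => intro _; have := hcell i hi 0 hn; simpa using this
    | succ j hj ih =>
      intro hjn
      refine hr _ _ _ _ _ ?_ ?_ ?_ (ih (by omega)) (hcell i hi j (by omega))
      · push_cast; nlinarith
      · have : 0 ≤ (j : ℝ) * q := by positivity
        linarith
      · push_cast; nlinarith
  have hall : ∀ i, 0 < i → i ≤ m → Good a (a + i * p) c d := by
    intro i hi
    induction i, hi using Nat.le_induction with
    | base => intro _; have := hrow 0 hm n hn le_rfl; rw [hqn] at this; simpa using this
    | succ i hi ih =>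
      intro him
      have := hrow i (by omega) n hn le_rfl
      rw [hqn] at this
      refine hl _ _ _ _ _ ?_ ?_ hcd.le (ih (by omega)) this
      · have : 0 ≤ (i : ℝ) * p := by positivity
        linarith
      · push_cast; nlinarith
  have := hall m hm le_rfl
  rwa [hpm] at this

section
variable {B : ℝ} {F G : ℝ → ℝ → ℝ}

theorem abs_circ_le_of_shrink (hF : SepCont B F) (hG : SepCont B G) {ε a b c d : ℝ} (hab : a ≤ b)
    (h : ∀ s, 0 < s → a + s ≤ b - s → |circ F G (a + s) (b - s) c d| ≤ ε * ((b - s) - (a + s)) * (d - c)) :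
    |circ F G a b c d| ≤ ε * (b - a) * (d - c) := by
  rcases hab.eq_or_lt with rfl | hab
  · simp [circ_self_left]
  have h1 : Tendsto (fun s => |circ F G (a + s) (b - s) c d|) (𝓝[>] 0) (𝓝 |circ F G a b c d|) := by
    have := (circ_continuous_left hF hG c d (a := fun s => a + s) (b := fun s => b - s)
      (by fun_prop) (by fun_prop)).abs.tendsto 0
    simp only [add_zero, sub_zero] at this
    exact this.mono_left nhdsWithin_le_nhds
  have h2 : Tendsto (fun s => ε * ((b - s) - (a + s)) * (d - c)) (𝓝[>] 0) (𝓝 (ε * (b - a) * (d - c))) := by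
    have : Continuous fun s => ε * ((b - s) - (a + s)) * (d - c) := by fun_prop
    have := this.tendsto 0
    simp only [add_zero, sub_zero] at this
    exact this.mono_left nhdsWithin_le_nhds
  refine le_of_tendsto_of_tendsto h1 h2 ?_
  have : Iio ((b - a) / 2) ∈ 𝓝 (0:ℝ) := Iio_mem_nhds (by linarith)
  filter_upwards [self_mem_nhdsWithin, mem_nhdsWithin_of_mem_nhds this] with s hs hs'
  simp only [mem_Ioi, mem_Iio] at hs hs'
  exact h s hs (by linarith)

theorem abs_circ_le_of_shrink_right (hF : SepCont B F) (hG : SepCont B G) {ε a b c d : ℝ} (hcd : c ≤ d)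
    (h : ∀ s, 0 < s → c + s ≤ d - s → |circ F G a b (c + s) (d - s)| ≤ ε * (b - a) * ((d - s) - (c + s))) :
    |circ F G a b c d| ≤ ε * (b - a) * (d - c) := by
  have := abs_circ_le_of_shrink hG.swap hF.swap (ε := ε) (c := a) (d := b) hcd (fun s hs hs' => by
    rw [circ_swap F G]; have := h s hs hs'; linarith)
  rw [circ_swap F G] at this; linarith

/-- An area bound for closed rectangles missing `P` extends to rectangles whose interior
misses `P`. -/
theorem abs_circ_le_of_disjoint_interior (hF : SepCont B F) (hG : SepCont B G) {ε A₁ A₂ C₁ C₂ : ℝ}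
    {P : Set (ℝ × ℝ)}
    (h : ∀ a b c d, A₁ ≤ a → a ≤ b → b ≤ A₂ → C₁ ≤ c → c ≤ d → d ≤ C₂ →
      Disjoint (Icc a b ×ˢ Icc c d) P → |circ F G a b c d| ≤ ε * (b - a) * (d - c))
    {a b c d : ℝ} (ha : A₁ ≤ a) (hab : a ≤ b) (hb : b ≤ A₂) (hc : C₁ ≤ c) (hcd : c ≤ d)
    (hd : d ≤ C₂) (hdisj : Disjoint (Ioo a b ×ˢ Ioo c d) P) :
    |circ F G a b c d| ≤ ε * (b - a) * (d - c) := by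
  refine abs_circ_le_of_shrink hF hG hab fun s hs hs' => ?_
  refine abs_circ_le_of_shrink_right hF hG hcd fun r hr hr' => ?_
  refine h _ _ _ _ (by linarith) hs' (by linarith) (by linarith) hr' (by linarith) ?_
  refine hdisj.mono_left (prod_mono ?_ ?_)
  · exact Icc_subset_Ioo (by linarith) (by linarith)
  · exact Icc_subset_Ioo (by linarith) (by linarith)

theorem abs_circ_le_of_locally (hF : SepCont B F) (hG : SepCont B G) {ε a b c d : ℝ}
    (hab : a ≤ b) (hcd : c ≤ d)
    (h : ∀ p ∈ Icc a b ×ˢ Icc c d, ∃ r > 0, ∀ a' b' c' d', a ≤ a' → a' ≤ b' → b' ≤ b →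
      c ≤ c' → c' ≤ d' → d' ≤ d → Icc a' b' ×ˢ Icc c' d' ⊆ Metric.ball p r →
      |circ F G a' b' c' d'| ≤ ε * (b' - a') * (d' - c')) :
    |circ F G a b c d| ≤ ε * (b - a) * (d - c) := by
  rcases hab.eq_or_lt with rfl | hab
  · simp [circ_self_left]
  rcases hcd.eq_or_lt with rfl | hcd
  · simp [circ_self_right]
  choose! r hr h using h
  obtain ⟨δ, hδ, hδ'⟩ := lebesgue_number_lemma_of_metric (isCompact_Icc.prod isCompact_Icc)
    (c := fun p : Icc a b ×ˢ Icc c d => Metric.ball p.1 (r p.1)) (fun _ => Metric.isOpen_ball)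
    (fun p hp => mem_iUnion.2 ⟨⟨p, hp⟩, Metric.mem_ball_self (hr p hp)⟩)
  have := rect_grid (Good := fun a b c d => |circ F G a b c d| ≤ ε * (b - a) * (d - c))
    ?_ ?_ hab hcd hδ ?_
  · exact this
  · intro a b e c d _ _ _ h1 h2
    rw [← circ_glue_left hF hG a b e]
    calc _ ≤ _ := abs_add_le _ _
      _ ≤ ε * (b - a) * (d - c) + ε * (e - b) * (d - c) := add_le_add h1 h2
      _ = _ := by ring
  · intro a b c d e _ _ _ h1 h2
    rw [← circ_glue_right hF hG a b c d e]
    calc _ ≤ _ := abs_add_le _ _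
      _ ≤ ε * (b - a) * (d - c) + ε * (b - a) * (e - d) := add_le_add h1 h2
      _ = _ := by ring
  · intro a' b' c' d' h1 h2 h3 h4 h5 h6 h7 h8 _ _
    obtain ⟨⟨p, hp⟩, hp'⟩ := hδ' (a', c') ⟨⟨h1, by linarith⟩, ⟨h4, by linarith⟩⟩
    refine h p hp a' b' c' d' h1 h2.le h3 h4 h5.le h6 (Subset.trans ?_ hp')
    rintro ⟨s, y⟩ ⟨⟨hs1, hs2⟩, ⟨hy1, hy2⟩⟩
    simp only at hs1 hs2 hy1 hy2
    rw [Metric.mem_ball, Prod.dist_eq, max_lt_iff]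
    simp only [Real.dist_eq]
    constructor <;> rw [abs_lt] <;> constructor <;> linarith

end

/-- Points where `H` has the approximate slope `a` in the first variable, at scale `δ` and with
relative error `e`. -/
def slopeSet (I : Set ℝ) (H : ℝ → ℝ → ℝ) (δ e a : ℝ) : Set (ℝ × ℝ) :=
  {p | ∀ s ∈ I, |s - p.1| < δ → |H s p.2 - H p.1 p.2 - a * (s - p.1)| ≤ e * |s - p.1|}

theorem isClosed_inter_slopeSet {I J : Set ℝ} (hI : IsClosed I) (hJ : IsClosed J) {H : ℝ → ℝ → ℝ}
    (hH : ∀ t, Continuous (H t)) {δ : ℝ} (hδ : 0 < δ) (e a : ℝ) :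
    IsClosed (I ×ˢ J ∩ slopeSet I H δ e a) := by
  refine IsSeqClosed.isClosed fun u p hu hup => ?_
  have hp : p ∈ I ×ˢ J := (hI.prod hJ).mem_of_tendsto hup (Eventually.of_forall fun n => (hu n).1)
  have h1 : Tendsto (fun n => (u n).1) atTop (𝓝 p.1) := (continuous_fst.tendsto p).comp hup
  have h2 : Tendsto (fun n => (u n).2) atTop (𝓝 p.2) := (continuous_snd.tendsto p).comp hup
  have hslice : ∀ t, Tendsto (fun n => H t (u n).2) atTop (𝓝 (H t p.2)) := fun t =>
    ((hH t).tendsto _).comp h2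
  have habs : ∀ s, Tendsto (fun n => |s - (u n).1|) atTop (𝓝 |s - p.1|) := fun s =>
    (tendsto_const_nhds.sub h1).abs
  have hnear : ∀ s, |s - p.1| < δ → ∀ᶠ n in atTop, |s - (u n).1| < δ := fun s hs =>
    (habs s).eventually (gt_mem_nhds hs)
  have hdiag : Tendsto (fun n => H (u n).1 (u n).2) atTop (𝓝 (H p.1 p.2)) := by
    have hz : Tendsto (fun n => H p.1 (u n).2 - H (u n).1 (u n).2 - a * (p.1 - (u n).1)) atTop (𝓝 0) := by
      refine squeeze_zero_norm' (a := fun n => e * |p.1 - (u n).1|) ?_ ?_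
      · filter_upwards [hnear p.1 (by simpa using hδ)] with n hn
        exact (hu n).2 p.1 hp.1 hn
      · simpa using (habs p.1).const_mul e
    have := ((hslice p.1).sub hz).sub ((tendsto_const_nhds (x := p.1)).sub h1 |>.const_mul a)
    simp only [sub_self, mul_zero, sub_zero] at this
    refine this.congr fun n => by ring
  refine ⟨hp, fun s hs hsδ => ?_⟩
  refine le_of_tendsto_of_tendsto (((hslice s).sub hdiag).sub ((tendsto_const_nhds.sub h1).const_mul a)).abs
    ((habs s).const_mul e) ?_
  filter_upwards [hnear s hsδ] with n hn
  exact (hu n).2 s hs hn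

theorem exists_mem_slopeSet {I : Set ℝ} {H : ℝ → ℝ → ℝ} {t x m e : ℝ} (he : 0 < e)
    (h : HasDerivWithinAt (fun s => H s x) m I t) :
    ∃ δ₀ > 0, ∀ δ ≤ δ₀, ∀ q, |q - m| ≤ e / 2 → (t, x) ∈ slopeSet I H δ e q := by
  have := (hasDerivWithinAt_iff_isLittleO.1 h).def (half_pos he)
  obtain ⟨δ₀, hδ₀, hb⟩ := Metric.mem_nhdsWithin_iff.1 this
  refine ⟨δ₀, hδ₀, fun δ hδ q hq s hs hsδ => ?_⟩
  simp only at hsδ ⊢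
  have h1 := hb (show s ∈ Metric.ball t δ₀ ∩ I from ⟨by
    rw [Metric.mem_ball, Real.dist_eq]; linarith, hs⟩)
  simp only [mem_ofPred_eq, Real.norm_eq_abs, smul_eq_mul] at h1
  have h2 : H s x - H t x - q * (s - t) = (H s x - H t x - (s - t) * m) - (q - m) * (s - t) := by ring
  rw [h2]
  calc _ ≤ _ := abs_sub _ _
    _ ≤ e / 2 * |s - t| + e / 2 * |s - t| := by
      rw [abs_mul]; gcongr
    _ = _ := by ring

theorem exists_portion {B : ℝ} {F G : ℝ → ℝ → ℝ} (hF : SepCont B F) (hG : SepCont B G) {I J : Set ℝ}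
    (hI : IsClosed I) (hJ : IsClosed J) {Ft Fx Gt Gx : ℝ → ℝ → ℝ}
    (hFt : ∀ t ∈ I, ∀ x ∈ J, HasDerivWithinAt (fun s => F s x) (Ft t x) I t)
    (hFx : ∀ t ∈ I, ∀ x ∈ J, HasDerivWithinAt (F t) (Fx t x) J x)
    (hGt : ∀ t ∈ I, ∀ x ∈ J, HasDerivWithinAt (fun s => G s x) (Gt t x) I t)
    (hGx : ∀ t ∈ I, ∀ x ∈ J, HasDerivWithinAt (G t) (Gx t x) J x)
    (hdiv : ∀ t ∈ I, ∀ x ∈ J, Gt t x + Fx t x = 0)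
    {P : Set (ℝ × ℝ)} (hP : IsClosed P) (hPR : P ⊆ I ×ˢ J) (hne : P.Nonempty) {e : ℝ} (he : 0 < e) :
    ∃ p₀ ∈ P, ∃ r > 0, ∃ δ > 0, ∃ aF bF aG bG : ℝ, |aG + bF| ≤ e ∧
      ∀ p ∈ P, p ∈ Metric.ball p₀ r →
        (p ∈ slopeSet I F δ e aF ∧ p.swap ∈ slopeSet J (fun x t => F t x) δ e bF) ∧
        (p ∈ slopeSet I G δ e aG ∧ p.swap ∈ slopeSet J (fun x t => G t x) δ e bG) := by
  have := hP.completeSpace_coe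
  have : Nonempty P := hne.to_subtype
  let ι := {i : ℕ × ℚ × ℚ × ℚ × ℚ // |((i.2.2.2.1 : ℚ) : ℝ) + (i.2.2.1 : ℚ)| ≤ e}
  let E : ι → Set (ℝ × ℝ) := fun i =>
    ((I ×ˢ J ∩ slopeSet I F (1 / (i.1.1 + 1)) e i.1.2.1) ∩
     Prod.swap ⁻¹' (J ×ˢ I ∩ slopeSet J (fun x t => F t x) (1 / (i.1.1 + 1)) e i.1.2.2.1)) ∩
    ((I ×ˢ J ∩ slopeSet I G (1 / (i.1.1 + 1)) e i.1.2.2.2.1) ∩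
     Prod.swap ⁻¹' (J ×ˢ I ∩ slopeSet J (fun x t => G t x) (1 / (i.1.1 + 1)) e i.1.2.2.2.2))
  have hE : ∀ i, IsClosed (E i) := fun i => by
    have hδ : (0:ℝ) < 1 / (i.1.1 + 1) := by positivity
    exact ((isClosed_inter_slopeSet hI hJ hF.right hδ _ _).inter
      ((isClosed_inter_slopeSet hJ hI hF.left hδ _ _).preimage continuous_swap)).inter
      ((isClosed_inter_slopeSet hI hJ hG.right hδ _ _).inter
      ((isClosed_inter_slopeSet hJ hI hG.left hδ _ _).preimage continuous_swap))
  have hrat : ∀ m : ℝ, ∃ q : ℚ, |(q:ℝ) - m| ≤ e / 2 := fun m => by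
    obtain ⟨q, hq1, hq2⟩ := exists_rat_btwn (show m < m + e / 2 by linarith)
    exact ⟨q, by rw [abs_le]; constructor <;> linarith⟩
  have hU : (⋃ i, (Subtype.val : P → ℝ × ℝ) ⁻¹' E i) = univ := by
    refine eq_univ_of_forall fun ⟨⟨t, x⟩, hp⟩ => ?_
    obtain ⟨ht, hx⟩ := hPR hp
    simp only at ht hx
    obtain ⟨d1, hd1, h1⟩ := exists_mem_slopeSet he (hFt t ht x hx)
    obtain ⟨d2, hd2, h2⟩ := exists_mem_slopeSet (H := fun x t => F t x) he (hFx t ht x hx)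
    obtain ⟨d3, hd3, h3⟩ := exists_mem_slopeSet he (hGt t ht x hx)
    obtain ⟨d4, hd4, h4⟩ := exists_mem_slopeSet (H := fun x t => G t x) he (hGx t ht x hx)
    obtain ⟨q1, hq1⟩ := hrat (Ft t x)
    obtain ⟨q2, hq2⟩ := hrat (Fx t x)
    obtain ⟨q3, hq3⟩ := hrat (Gt t x)
    obtain ⟨q4, hq4⟩ := hrat (Gx t x)
    obtain ⟨n, hn⟩ := exists_nat_one_div_lt (show 0 < min (min d1 d2) (min d3 d4) by positivity)
    have hn' := hn.le
    simp only [le_min_iff] at hn'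
    have hcond : |(q3:ℝ) + q2| ≤ e := by
      have := hdiv t ht x hx
      rw [abs_le] at *
      constructor <;> linarith
    refine mem_iUnion.2 ⟨⟨(n, q1, q2, q3, q4), hcond⟩, ?_⟩
    exact ⟨⟨⟨⟨ht, hx⟩, h1 _ hn'.1.1 _ hq1⟩, ⟨⟨hx, ht⟩, h2 _ hn'.1.2 _ hq2⟩⟩,
      ⟨⟨⟨ht, hx⟩, h3 _ hn'.2.1 _ hq3⟩, ⟨⟨hx, ht⟩, h4 _ hn'.2.2 _ hq4⟩⟩⟩
  obtain ⟨i, ⟨p₀, hp₀⟩⟩ := nonempty_interior_of_iUnion_of_closed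
    (fun i => (hE i).preimage continuous_subtype_val) hU
  obtain ⟨r, hr, hball⟩ := Metric.mem_nhds_iff.1 (mem_interior_iff_mem_nhds.1 hp₀)
  refine ⟨p₀, p₀.2, r, hr, 1 / (i.1.1 + 1), by positivity, i.1.2.1, i.1.2.2.1, i.1.2.2.2.1, i.1.2.2.2.2, i.2, fun p hp hpr => ?_⟩
  have := @hball ⟨p, hp⟩ hpr
  exact ⟨⟨this.1.1.2, this.1.2.2⟩, ⟨this.2.1.2, this.2.2.2⟩⟩

/-- If both vertical sides of a rectangle contain a point with prescribed approximate slopes, then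
the increment of `H` across the rectangle is nearly constant. -/
theorem increment_estimate {I J : Set ℝ} {H : ℝ → ℝ → ℝ} {δ e α β t₁ t₂ y₁ y₂ c d L : ℝ}
    (ht₂ : t₂ ∈ I) (hJ : Icc c d ⊆ J) (hLδ : L < δ) (he : 0 ≤ e)
    (ht : t₁ ≤ t₂) (htL : t₂ - t₁ ≤ L) (hcdL : d - c ≤ L) (hy₁ : y₁ ∈ Icc c d) (hy₂ : y₂ ∈ Icc c d)
    (h1 : (t₁, y₁) ∈ slopeSet I H δ e α) (h2 : (y₁, t₁) ∈ slopeSet J (fun x t => H t x) δ e β)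
    (h3 : (y₂, t₂) ∈ slopeSet J (fun x t => H t x) δ e β) {y : ℝ} (hy : y ∈ Icc c d) :
    |H t₂ y - H t₁ y - α * (t₂ - t₁)| ≤ 4 * e * L := by
  have hd : ∀ y z, y ∈ Icc c d → z ∈ Icc c d → |y - z| ≤ L := fun y z hy hz => by
    rw [abs_le]; constructor <;> linarith [hy.1, hy.2, hz.1, hz.2]
  have a1 := h1 t₂ ht₂ (by simp only; rw [abs_of_nonneg] <;> linarith)
  have a2 := h2 y (hJ hy) (lt_of_le_of_lt (hd _ _ hy hy₁) hLδ)
  have a3 := h3 y (hJ hy) (lt_of_le_of_lt (hd _ _ hy hy₂) hLδ)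
  have a4 := h3 y₁ (hJ hy₁) (lt_of_le_of_lt (hd _ _ hy₁ hy₂) hLδ)
  simp only at a1 a2 a3 a4
  have b1 : e * |t₂ - t₁| ≤ e * L := by
    gcongr; rw [abs_of_nonneg] <;> linarith
  have b2 := mul_le_mul_of_nonneg_left (hd _ _ hy hy₁) he
  have b3 := mul_le_mul_of_nonneg_left (hd _ _ hy hy₂) he
  have b4 := mul_le_mul_of_nonneg_left (hd _ _ hy₁ hy₂) he
  rw [abs_le] at *
  constructor <;> linarith [a1.1, a1.2, a2.1, a2.2, a3.1, a3.2, a4.1, a4.2]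

theorem integral_increment_estimate {H : ℝ → ℝ → ℝ} (hH : ∀ t, Continuous (H t)) {t₁ t₂ c d k K : ℝ}
    (hcd : c ≤ d) (h : ∀ y ∈ Icc c d, |H t₂ y - H t₁ y - k| ≤ K) :
    |(∫ y in c..d, (H t₂ y - H t₁ y)) - k * (d - c)| ≤ K * (d - c) := by
  have h1 : (∫ y in c..d, (H t₂ y - H t₁ y)) - k * (d - c) = ∫ y in c..d, (H t₂ y - H t₁ y - k) := by
    have := intervalIntegral.integral_sub (((hH t₂).sub (hH t₁)).intervalIntegrable (μ := volume) c d)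
      (intervalIntegrable_const (c := k))
    simp only [Pi.sub_apply] at this
    rw [this]
    simp [mul_comm]
  rw [h1]
  have := intervalIntegral.norm_integral_le_of_norm_le_const (a := c) (b := d) (C := K)
    (f := fun y => H t₂ y - H t₁ y - k) (fun y hy => by
      rw [uIoc_of_le hcd] at hy; exact h y (Ioc_subset_Icc_self hy))
  rwa [Real.norm_eq_abs, abs_of_nonneg (by linarith : 0 ≤ d - c)] at this

theorem cell_estimate {B : ℝ} {F G : ℝ → ℝ → ℝ} (hF : SepCont B F) (hG : SepCont B G) {I J : Set ℝ}
    {P : Set (ℝ × ℝ)} (hP : IsClosed P) {δ e ε aF bF aG bG : ℝ} (he : 0 ≤ e)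
    (hab' : |aG + bF| ≤ e) {a b c d : ℝ} (hab : a < b) (hcd : c < d) (hI : Icc a b ⊆ I) (hJ : Icc c d ⊆ J)
    (hslope : ∀ p ∈ P, p ∈ Icc a b ×ˢ Icc c d →
        (p ∈ slopeSet I F δ e aF ∧ p.swap ∈ slopeSet J (fun x t => F t x) δ e bF) ∧
        (p ∈ slopeSet I G δ e aG ∧ p.swap ∈ slopeSet J (fun x t => G t x) δ e bG))
    (hoff : ∀ a' b' c' d', a ≤ a' → a' ≤ b' → b' ≤ b → c ≤ c' → c' ≤ d' → d' ≤ d →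
      Disjoint (Ioo a' b' ×ˢ Ioo c' d') P → |circ F G a' b' c' d'| ≤ ε * (b' - a') * (d' - c'))
    (hne : (P ∩ Icc a b ×ˢ Icc c d).Nonempty) (hbδ : b - a < δ) (hdδ : d - c < δ)
    (has1 : d - c ≤ 2 * (b - a)) (has2 : b - a ≤ 2 * (d - c)) :
    ∃ a' b' c' d', a ≤ a' ∧ a' ≤ b' ∧ b' ≤ b ∧ c ≤ c' ∧ c' ≤ d' ∧ d' ≤ d ∧
      P ∩ Icc a b ×ˢ Icc c d ⊆ Icc a' b' ×ˢ Icc c' d' ∧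
      |circ F G a b c d| ≤ 18 * e * ((b - a) * (d - c)) +
        ε * ((b - a) * (d - c) - (b' - a') * (d' - c')) := by
  have hK : IsCompact (P ∩ Icc a b ×ˢ Icc c d) := (isCompact_Icc.prod isCompact_Icc).inter_left hP
  obtain ⟨p1, hp1, hm1⟩ := hK.exists_isMinOn hne continuous_fst.continuousOn
  obtain ⟨p2, hp2, hm2⟩ := hK.exists_isMaxOn hne continuous_fst.continuousOn
  obtain ⟨p3, hp3, hm3⟩ := hK.exists_isMinOn hne continuous_snd.continuousOn
  obtain ⟨p4, hp4, hm4⟩ := hK.exists_isMaxOn hne continuous_snd.continuousOn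
  rw [isMinOn_iff] at hm1 hm3
  rw [isMaxOn_iff] at hm2 hm4
  have hsub : P ∩ Icc a b ×ˢ Icc c d ⊆ Icc p1.1 p2.1 ×ˢ Icc p3.2 p4.2 := fun p hp =>
    ⟨⟨hm1 p hp, hm2 p hp⟩, ⟨hm3 p hp, hm4 p hp⟩⟩
  have h1 := hp1.2.1.1
  have h2 := hp2.2.1.2
  have h3 := hp3.2.2.1
  have h4 := hp4.2.2.2
  have h12 : p1.1 ≤ p2.1 := hm1 p2 hp2
  have h34 : p3.2 ≤ p4.2 := hm3 p4 hp4
  refine ⟨p1.1, p2.1, p3.2, p4.2, h1, h12, h2, h3, h34, h4, hsub, ?_⟩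
  set L := max (b - a) (d - c) with hL
  have hL1 : b - a ≤ L := le_max_left _ _
  have hL2 : d - c ≤ L := le_max_right _ _
  have hLδ : L < δ := max_lt hbδ hdδ
  have hLsq : L * L ≤ 2 * ((b - a) * (d - c)) := by
    rcases max_cases (b - a) (d - c) with ⟨h, _⟩ | ⟨h, _⟩ <;> rw [hL, h] <;> nlinarith
  have eG := integral_increment_estimate hG.right (t₁ := p1.1) (t₂ := p2.1) (k := aG * (p2.1 - p1.1)) h34 (fun y hy =>
    increment_estimate (I := I) (J := J) (H := G) (β := bG) (hI ⟨by linarith [hp2.2.1.1], h2⟩)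
      (Subset.trans (Icc_subset_Icc h3 h4) hJ) hLδ he h12 (by linarith) (by linarith)
      (hsub hp1).2 (hsub hp2).2 (hslope p1 hp1.1 hp1.2).2.1 (hslope p1 hp1.1 hp1.2).2.2
      (hslope p2 hp2.1 hp2.2).2.2 hy)
  have eF := integral_increment_estimate (H := fun x t => F t x) hF.left (t₁ := p3.2) (t₂ := p4.2)
    (k := bF * (p4.2 - p3.2)) h12 (fun y hy =>
    increment_estimate (I := J) (J := I) (H := fun x t => F t x) (β := aF) (hJ ⟨by linarith [hp4.2.2.1], h4⟩)
      (Subset.trans (Icc_subset_Icc h1 h2) hI) hLδ he h34 (by linarith) (by linarith)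
      (hsub hp3).1 (hsub hp4).1 (hslope p3 hp3.1 hp3.2).1.2 (hslope p3 hp3.1 hp3.2).1.1
      (hslope p4 hp4.1 hp4.2).1.1 hy)
  have ecore : |circ F G p1.1 p2.1 p3.2 p4.2| ≤ 18 * e * ((b - a) * (d - c)) := by
    have hx : 0 ≤ p2.1 - p1.1 := by linarith
    have hy : 0 ≤ p4.2 - p3.2 := by linarith
    have hxL : p2.1 - p1.1 ≤ L := by linarith
    have hyL : p4.2 - p3.2 ≤ L := by linarith
    have e1 : |(aG + bF) * ((p2.1 - p1.1) * (p4.2 - p3.2))| ≤ e * (L * L) := by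
      rw [abs_mul, abs_of_nonneg (mul_nonneg hx hy)]
      gcongr
    have e2 : 4 * e * L * (p4.2 - p3.2) ≤ 4 * e * L * L := by gcongr
    have e3 : 4 * e * L * (p2.1 - p1.1) ≤ 4 * e * L * L := by gcongr
    have e4 : e * (L * L) ≤ e * (2 * ((b - a) * (d - c))) := by gcongr
    unfold circ
    rw [abs_le] at *
    constructor <;> linarith [eG.1, eG.2, eF.1, eF.2, e1.1, e1.2]
  have o1 := hoff a p1.1 c d le_rfl h1 (by linarith) le_rfl hcd.le le_rfl (by
    rw [disjoint_left]; rintro p ⟨hpa, hpc⟩ hpP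
    exact absurd (hm1 p ⟨hpP, ⟨⟨hpa.1.le, by linarith [hpa.2, hp1.2.1.2]⟩, Ioo_subset_Icc_self hpc⟩⟩) (not_le.2 hpa.2))
  have o2 := hoff p2.1 b c d (by linarith) h2 le_rfl le_rfl hcd.le le_rfl (by
    rw [disjoint_left]; rintro p ⟨hpa, hpc⟩ hpP
    exact absurd (hm2 p ⟨hpP, ⟨⟨by linarith [hpa.1, hp2.2.1.1], hpa.2.le⟩, Ioo_subset_Icc_self hpc⟩⟩) (not_le.2 hpa.1))
  have o3 := hoff p1.1 p2.1 c p3.2 h1 h12 h2 le_rfl h3 (by linarith) (by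
    rw [disjoint_left]; rintro p ⟨hpa, hpc⟩ hpP
    exact absurd (hm3 p ⟨hpP, ⟨⟨by linarith [hpa.1], by linarith [hpa.2]⟩, ⟨hpc.1.le, by linarith [hpc.2, hp3.2.2.2]⟩⟩⟩) (not_le.2 hpc.2))
  have o4 := hoff p1.1 p2.1 p4.2 d h1 h12 h2 (by linarith) h4 le_rfl (by
    rw [disjoint_left]; rintro p ⟨hpa, hpc⟩ hpP
    exact absurd (hm4 p ⟨hpP, ⟨⟨by linarith [hpa.1], by linarith [hpa.2]⟩, ⟨by linarith [hpc.1, hp4.2.2.1], hpc.2.le⟩⟩⟩) (not_le.2 hpc.1))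
  have hsum : circ F G a b c d = circ F G a p1.1 c d + (circ F G p1.1 p2.1 c p3.2 +
      circ F G p1.1 p2.1 p3.2 p4.2 + circ F G p1.1 p2.1 p4.2 d) + circ F G p2.1 b c d := by
    rw [circ_glue_right hF hG, circ_glue_right hF hG, circ_glue_left hF hG, circ_glue_left hF hG]
  rw [hsum]
  rw [abs_le] at *
  constructor <;> linarith [o1.1, o1.2, o2.1, o2.2, o3.1, o3.2, o4.1, o4.2, ecore.1, ecore.2]

theorem volume_real_Ioc_prod_Ioc {a b c d : ℝ} (hab : a ≤ b) (hcd : c ≤ d) :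
    volume.real (Ioc a b ×ˢ Ioc c d) = (b - a) * (d - c) := by
  rw [Measure.volume_eq_prod, measureReal_prod_prod, Real.volume_real_Ioc_of_le hab,
    Real.volume_real_Ioc_of_le hcd]

theorem volume_real_Icc_prod_Icc {a b c d : ℝ} (hab : a ≤ b) (hcd : c ≤ d) :
    volume.real (Icc a b ×ˢ Icc c d) = (b - a) * (d - c) := by
  rw [Measure.volume_eq_prod, measureReal_prod_prod, Real.volume_real_Icc_of_le hab,
    Real.volume_real_Icc_of_le hcd]

theorem volume_Ioc_prod_Ioc_ne_top (a b c d : ℝ) (A : Set (ℝ × ℝ)) :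
    volume ((Ioc a b ×ˢ Ioc c d) ∩ A) ≠ ⊤ := by
  refine ((measure_mono (inter_subset_left.trans (Set.prod_mono Ioc_subset_Icc_self Ioc_subset_Icc_self))).trans_lt
    (isCompact_Icc.prod isCompact_Icc).measure_lt_top).ne

theorem volume_real_glue_left {A : Set (ℝ × ℝ)} (hA : MeasurableSet A) {a b e c d : ℝ} (hab : a ≤ b)
    (hbe : b ≤ e) : volume.real ((Ioc a b ×ˢ Ioc c d) ∩ A) + volume.real ((Ioc b e ×ˢ Ioc c d) ∩ A)
      = volume.real ((Ioc a e ×ˢ Ioc c d) ∩ A) := by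
  rw [← measureReal_union ?_ ?_ (volume_Ioc_prod_Ioc_ne_top _ _ _ _ _) (volume_Ioc_prod_Ioc_ne_top _ _ _ _ _),
    ← union_inter_distrib_right, ← union_prod, Ioc_union_Ioc_eq_Ioc hab hbe]
  · rw [disjoint_left]; rintro p ⟨⟨h1, _⟩, _⟩ ⟨⟨h2, _⟩, _⟩
    exact absurd h2.1 (not_lt.2 h1.2)
  · exact (measurableSet_Ioc.prod measurableSet_Ioc).inter hA

theorem volume_real_glue_right {A : Set (ℝ × ℝ)} (hA : MeasurableSet A) {a b c d e : ℝ} (hcd : c ≤ d)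
    (hde : d ≤ e) : volume.real ((Ioc a b ×ˢ Ioc c d) ∩ A) + volume.real ((Ioc a b ×ˢ Ioc d e) ∩ A)
      = volume.real ((Ioc a b ×ˢ Ioc c e) ∩ A) := by
  rw [← measureReal_union ?_ ?_ (volume_Ioc_prod_Ioc_ne_top _ _ _ _ _) (volume_Ioc_prod_Ioc_ne_top _ _ _ _ _),
    ← union_inter_distrib_right, ← prod_union, Ioc_union_Ioc_eq_Ioc hcd hde]
  · rw [disjoint_left]; rintro p ⟨⟨_, h1⟩, _⟩ ⟨⟨_, h2⟩, _⟩
    exact absurd h2.1 (not_lt.2 h1.2)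
  · exact (measurableSet_Ioc.prod measurableSet_Ioc).inter hA

theorem volume_real_inter_add_compl {A : Set (ℝ × ℝ)} (hA : MeasurableSet A) (a b c d : ℝ) :
    volume.real ((Ioc a b ×ˢ Ioc c d) ∩ A) + volume.real ((Ioc a b ×ˢ Ioc c d) ∩ Aᶜ)
      = volume.real (Ioc a b ×ˢ Ioc c d) := by
  have := measureReal_inter_add_sdiff (μ := volume) (s := Ioc a b ×ˢ Ioc c d) hA
    (by simpa using volume_Ioc_prod_Ioc_ne_top a b c d univ)
  rwa [sdiff_eq] at this

theorem portion_estimate {B : ℝ} {F G : ℝ → ℝ → ℝ} (hF : SepCont B F) (hG : SepCont B G) {I J : Set ℝ}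
    {P : Set (ℝ × ℝ)} (hP : IsClosed P) {δ e ε aF bF aG bG : ℝ} (he : 0 < e) (hε : ε = 18 * e) (hδ : 0 < δ)
    (hab' : |aG + bF| ≤ e) {a b c d : ℝ} (hab : a ≤ b) (hcd : c ≤ d) (hI : Icc a b ⊆ I) (hJ : Icc c d ⊆ J)
    (hslope : ∀ p ∈ P, p ∈ Icc a b ×ˢ Icc c d →
        (p ∈ slopeSet I F δ e aF ∧ p.swap ∈ slopeSet J (fun x t => F t x) δ e bF) ∧
        (p ∈ slopeSet I G δ e aG ∧ p.swap ∈ slopeSet J (fun x t => G t x) δ e bG))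
    (hoff : ∀ a' b' c' d', a ≤ a' → a' ≤ b' → b' ≤ b → c ≤ c' → c' ≤ d' → d' ≤ d →
      Disjoint (Ioo a' b' ×ˢ Ioo c' d') P → |circ F G a' b' c' d'| ≤ ε * (b' - a') * (d' - c')) :
    |circ F G a b c d| ≤ ε * (b - a) * (d - c) := by
  rcases hab.eq_or_lt with rfl | hab
  · simp [circ_self_left]
  rcases hcd.eq_or_lt with rfl | hcd
  · simp [circ_self_right]
  have hε0 : 0 < ε := by linarith
  have hmP : MeasurableSet Pᶜ := hP.measurableSet.compl
  have key : ∀ ρ > 0, |circ F G a b c d| ≤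
      ε * volume.real ((Ioc a b ×ˢ Ioc c d) ∩ Metric.cthickening ρ P) +
      ε * volume.real ((Ioc a b ×ˢ Ioc c d) ∩ Pᶜ) := by
    intro ρ hρ
    have hmC : MeasurableSet (Metric.cthickening ρ P) := Metric.isClosed_cthickening.measurableSet
    refine rect_grid (Good := fun a b c d => |circ F G a b c d| ≤
      ε * volume.real ((Ioc a b ×ˢ Ioc c d) ∩ Metric.cthickening ρ P) +
      ε * volume.real ((Ioc a b ×ˢ Ioc c d) ∩ Pᶜ)) ?_ ?_ hab hcd (lt_min hδ hρ) ?_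
    · intro a b e c d h1 h2 _ h3 h4
      rw [← circ_glue_left hF hG a b e, ← volume_real_glue_left hmC h1 h2, ← volume_real_glue_left hmP h1 h2]
      refine (abs_add_le _ _).trans ?_
      linarith
    · intro a b c d e _ h1 h2 h3 h4
      rw [← circ_glue_right hF hG a b c d e, ← volume_real_glue_right hmC h1 h2, ← volume_real_glue_right hmP h1 h2]
      refine (abs_add_le _ _).trans ?_
      linarith
    · intro a' b' c' d' h1 h2 h3 h4 h5 h6 h7 h8 h9 h10
      have hS := volume_real_Ioc_prod_Ioc h2.le h5.le
      by_cases hne : (P ∩ Icc a' b' ×ˢ Icc c' d').Nonempty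
      · have hCS : (Ioc a' b' ×ˢ Ioc c' d') ∩ Metric.cthickening ρ P = Ioc a' b' ×ˢ Ioc c' d' := by
          obtain ⟨⟨p1, p2⟩, hpP, hp1, hp2⟩ := hne
          refine inter_eq_left.2 ?_
          rintro ⟨s, y⟩ ⟨hs, hy⟩
          refine Metric.mem_cthickening_of_dist_le _ _ _ _ hpP ?_
          simp only at hs hy hp1 hp2
          rw [Prod.dist_eq, max_le_iff]
          have h7' := (lt_min_iff.1 h7).2
          have h8' := (lt_min_iff.1 h8).2
          simp only [Real.dist_eq, abs_le]
          refine ⟨⟨?_, ?_⟩, ?_, ?_⟩ <;> linarith [hs.1, hs.2, hy.1, hy.2, hp1.1, hp1.2, hp2.1, hp2.2]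
        rw [hCS, hS]
        have hII : Icc a' b' ⊆ Icc a b := Icc_subset_Icc h1 h3
        have hJJ : Icc c' d' ⊆ Icc c d := Icc_subset_Icc h4 h6
        obtain ⟨a'', b'', c'', d'', q1, q2, q3, q4, q5, q6, hsub, hest⟩ :=
          cell_estimate hF hG hP (ε := ε) he.le hab' h2 h5 (hII.trans hI) (hJJ.trans hJ)
            (fun p hp hp' => hslope p hp (Set.prod_mono hII hJJ hp'))
            (fun a'' b'' c'' d'' r1 r2 r3 r4 r5 r6 => hoff a'' b'' c'' d'' (by linarith) r2
              (by linarith) (by linarith) r5 (by linarith)) hne (h7.trans_le (min_le_left _ _))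
            (h8.trans_le (min_le_left _ _)) h9 h10
        have hdecomp : volume.real ((Ioc a' b' ×ˢ Ioc c' d') ∩ P) +
            volume.real ((Ioc a' b' ×ˢ Ioc c' d') ∩ Pᶜ) = (b' - a') * (d' - c') := by
          rw [← hS, volume_real_inter_add_compl hP.measurableSet]
        have hcore : volume.real ((Ioc a' b' ×ˢ Ioc c' d') ∩ P) ≤ (b'' - a'') * (d'' - c'') := by
          rw [← volume_real_Icc_prod_Icc q2 q5]
          refine measureReal_mono ?_ (isCompact_Icc.prod isCompact_Icc).measure_lt_top.ne
          exact fun p hp => hsub ⟨hp.2, Set.prod_mono Ioc_subset_Icc_self Ioc_subset_Icc_self hp.1⟩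
        refine hest.trans ?_
        rw [← hε]
        have : (b' - a') * (d' - c') - (b'' - a'') * (d'' - c'') ≤ volume.real ((Ioc a' b' ×ˢ Ioc c' d') ∩ Pᶜ) := by
          linarith
        have := mul_le_mul_of_nonneg_left this hε0.le
        linarith
      · have hd : Disjoint P (Icc a' b' ×ˢ Icc c' d') := by
          rw [disjoint_iff_inter_eq_empty]; exact not_nonempty_iff_eq_empty.1 hne
        have hPS : (Ioc a' b' ×ˢ Ioc c' d') ∩ Pᶜ = Ioc a' b' ×ˢ Ioc c' d' := by
          refine inter_eq_left.2 fun p hp hpP => disjoint_left.1 hd hpP ?_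
          exact Set.prod_mono Ioc_subset_Icc_self Ioc_subset_Icc_self hp
        rw [hPS, hS]
        have := hoff a' b' c' d' h1 h2.le h3 h4 h5.le h6
          (hd.symm.mono_left (Set.prod_mono Ioo_subset_Icc_self Ioo_subset_Icc_self))
        have h0 : 0 ≤ ε * volume.real ((Ioc a' b' ×ˢ Ioc c' d') ∩ Metric.cthickening ρ P) := by positivity
        linarith
  have hlim : Tendsto (fun ρ => volume.real ((Ioc a b ×ˢ Ioc c d) ∩ Metric.cthickening ρ P)) (𝓝[>] 0)
      (𝓝 (volume.real ((Ioc a b ×ˢ Ioc c d) ∩ P))) := by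
    have : IsFiniteMeasure ((volume : Measure (ℝ × ℝ)).restrict (Ioc a b ×ˢ Ioc c d)) :=
      ⟨by simpa using lt_top_iff_ne_top.2 (volume_Ioc_prod_Ioc_ne_top a b c d univ)⟩
    have h := tendsto_measure_cthickening_of_isClosed
      (μ := (volume : Measure (ℝ × ℝ)).restrict (Ioc a b ×ˢ Ioc c d)) (s := P) ⟨1, one_pos, measure_ne_top _ _⟩ hP
    have h' := (ENNReal.tendsto_toReal (measure_ne_top _ _)).comp (h.mono_left (nhdsWithin_le_nhds (s := Ioi 0)))
    have e1 : ∀ A : Set (ℝ × ℝ), MeasurableSet A →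
      ((volume : Measure (ℝ × ℝ)).restrict (Ioc a b ×ˢ Ioc c d) A).toReal
        = volume.real ((Ioc a b ×ˢ Ioc c d) ∩ A) := fun A hA => by
      rw [Measure.restrict_apply hA, inter_comm]; rfl
    rw [e1 P hP.measurableSet] at h'
    refine h'.congr fun ρ => ?_
    exact e1 _ Metric.isClosed_cthickening.measurableSet
  have hdecomp : volume.real ((Ioc a b ×ˢ Ioc c d) ∩ P) +
      volume.real ((Ioc a b ×ˢ Ioc c d) ∩ Pᶜ) = (b - a) * (d - c) := by
    rw [← volume_real_Ioc_prod_Ioc hab.le hcd.le, volume_real_inter_add_compl hP.measurableSet]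
  have hfin := ge_of_tendsto ((hlim.const_mul ε).add_const (ε * volume.real ((Ioc a b ×ˢ Ioc c d) ∩ Pᶜ)))
    (eventually_nhdsWithin_of_forall key)
  rwa [← mul_add, hdecomp, ← mul_assoc] at hfin

/-- Looman–Menchoff type theorem: a separately differentiable field with zero divergence has zero
flux through every rectangle. -/
theorem circ_eq_zero {B : ℝ} {F G : ℝ → ℝ → ℝ} (hF : SepCont B F) (hG : SepCont B G)
    {A₁ A₂ C₁ C₂ : ℝ} {Ft Fx Gt Gx : ℝ → ℝ → ℝ}
    (hFt : ∀ t ∈ Icc A₁ A₂, ∀ x ∈ Icc C₁ C₂, HasDerivWithinAt (fun s => F s x) (Ft t x) (Icc A₁ A₂) t)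
    (hFx : ∀ t ∈ Icc A₁ A₂, ∀ x ∈ Icc C₁ C₂, HasDerivWithinAt (F t) (Fx t x) (Icc C₁ C₂) x)
    (hGt : ∀ t ∈ Icc A₁ A₂, ∀ x ∈ Icc C₁ C₂, HasDerivWithinAt (fun s => G s x) (Gt t x) (Icc A₁ A₂) t)
    (hGx : ∀ t ∈ Icc A₁ A₂, ∀ x ∈ Icc C₁ C₂, HasDerivWithinAt (G t) (Gx t x) (Icc C₁ C₂) x)
    (hdiv : ∀ t ∈ Icc A₁ A₂, ∀ x ∈ Icc C₁ C₂, Gt t x + Fx t x = 0)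
    {a b c d : ℝ} (ha : A₁ ≤ a) (hab : a ≤ b) (hb : b ≤ A₂) (hc : C₁ ≤ c) (hcd : c ≤ d) (hd : d ≤ C₂) :
    circ F G a b c d = 0 := by
  set R := Icc A₁ A₂ ×ˢ Icc C₁ C₂ with hR
  have main : ∀ e : ℝ, 0 < e → |circ F G a b c d| ≤ 18 * e * (b - a) * (d - c) := by
    intro e he
    let Loc : ℝ × ℝ → Prop := fun p => ∃ r > 0, ∀ a b c d, A₁ ≤ a → a ≤ b → b ≤ A₂ → C₁ ≤ c → c ≤ d → d ≤ C₂ →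
      Icc a b ×ˢ Icc c d ⊆ Metric.ball p r → |circ F G a b c d| ≤ 18 * e * (b - a) * (d - c)
    let P := R ∩ {p | Loc p}ᶜ
    have hopen : IsOpen {p | Loc p} := by
      rw [Metric.isOpen_iff]
      rintro p ⟨r, hr, h⟩
      refine ⟨r, hr, fun q hq => ⟨r - dist q p, sub_pos.2 hq, fun a b c d h1 h2 h3 h4 h5 h6 hs => ?_⟩⟩
      exact h a b c d h1 h2 h3 h4 h5 h6 (hs.trans (Metric.ball_subset_ball' (by linarith)))
    have hP : IsClosed P := (isClosed_Icc.prod isClosed_Icc).inter hopen.isClosed_compl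
    have hoff : ∀ a b c d, A₁ ≤ a → a ≤ b → b ≤ A₂ → C₁ ≤ c → c ≤ d → d ≤ C₂ →
        Disjoint (Icc a b ×ˢ Icc c d) P → |circ F G a b c d| ≤ 18 * e * (b - a) * (d - c) := by
      intro a b c d h1 h2 h3 h4 h5 h6 hdis
      refine abs_circ_le_of_locally hF hG h2 h5 fun p hp => ?_
      have hpR : p ∈ R := Set.prod_mono (Icc_subset_Icc h1 h3) (Icc_subset_Icc h4 h6) hp
      have hpL : Loc p := by
        by_contra hcon
        exact disjoint_left.1 hdis hp ⟨hpR, hcon⟩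
      obtain ⟨r, hr, h⟩ := hpL
      exact ⟨r, hr, fun a' b' c' d' k1 k2 k3 k4 k5 k6 hs =>
        h a' b' c' d' (by linarith) k2 (by linarith) (by linarith) k5 (by linarith) hs⟩
    have hempty : P = ∅ := by
      by_contra hne
      obtain ⟨p₀, hp₀, r, hr, δ, hδ, aF, bF, aG, bG, hab', hsl⟩ := exists_portion hF hG isClosed_Icc isClosed_Icc
        hFt hFx hGt hGx hdiv hP inter_subset_left (nonempty_iff_ne_empty.2 hne) he
      refine hp₀.2 ⟨r, hr, fun a b c d h1 h2 h3 h4 h5 h6 hs => ?_⟩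
      refine portion_estimate hF hG hP he rfl hδ hab' h2 h5 (Icc_subset_Icc h1 h3) (Icc_subset_Icc h4 h6)
        (fun p hp hpS => hsl p hp (hs hpS)) ?_
      intro a' b' c' d' k1 k2 k3 k4 k5 k6 hdis
      exact abs_circ_le_of_disjoint_interior hF hG hoff (by linarith) k2 (by linarith) (by linarith) k5
        (by linarith) hdis
    exact hoff a b c d ha hab hb hc hcd hd (by rw [hempty]; exact disjoint_empty _)
  have h0 : |circ F G a b c d| ≤ 0 := by
    have ht : Tendsto (fun e : ℝ => 18 * e * (b - a) * (d - c)) (𝓝[>] 0) (𝓝 0) := by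
      have : Continuous fun e : ℝ => 18 * e * (b - a) * (d - c) := by fun_prop
      have := this.tendsto 0
      simp only [mul_zero, zero_mul] at this
      exact this.mono_left nhdsWithin_le_nhds
    exact ge_of_tendsto ht (eventually_nhdsWithin_of_forall fun e he => main e he)
  exact abs_nonpos_iff.1 h0

/-- Time primitive of `w`. -/
noncomputable def prim (w : ℝ → ℝ → ℝ) (t x : ℝ) : ℝ := ∫ s in (0:ℝ)..t, w s x

theorem SepCont.measurable {B : ℝ} {H : ℝ → ℝ → ℝ} (h : SepCont B H) :
    Measurable (Function.uncurry H) := by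
  have := measurable_uncurry_of_continuous_of_measurable (u := fun x t => H t x)
    (fun t => h.right t) (fun x => (h.left x).measurable)
  exact this.comp measurable_swap

theorem SepCont.hasDerivAt_prim {B : ℝ} {w : ℝ → ℝ → ℝ} (h : SepCont B w) (t x : ℝ) :
    HasDerivAt (fun t => prim w t x) (w t x) t :=
  intervalIntegral.integral_hasDerivAt_right ((h.left x).intervalIntegrable _ _)
    ((h.left x).stronglyMeasurableAtFilter _ _) (h.left x).continuousAt

theorem SepCont.continuous_prim_right {B : ℝ} {w : ℝ → ℝ → ℝ} (h : SepCont B w) (t : ℝ) :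
    Continuous (prim w t) := by
  refine intervalIntegral.continuous_of_dominated_interval (bound := fun _ => B) ?_ ?_ ?_ ?_
  · intro x; exact (h.left x).aestronglyMeasurable
  · intro x; filter_upwards with s _; exact h.bound s x
  · exact intervalIntegrable_const
  · filter_upwards with s _; exact h.right s

theorem SepCont.abs_prim_sub_le {B : ℝ} {w : ℝ → ℝ → ℝ} (h : SepCont B w) (s t x : ℝ) :
    |prim w t x - prim w s x| ≤ B * |t - s| := by
  unfold prim
  rw [intervalIntegral.integral_interval_sub_left ((h.left x).intervalIntegrable _ _)
    ((h.left x).intervalIntegrable _ _)]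
  exact intervalIntegral.norm_integral_le_of_norm_le_const (f := fun y => w y x) fun y _ => h.bound y x

theorem SepCont.nonneg {B : ℝ} {w : ℝ → ℝ → ℝ} (h : SepCont B w) : 0 ≤ B :=
  (abs_nonneg _).trans (h.bound 0 0)

theorem SepCont.abs_prim_le {B : ℝ} {w : ℝ → ℝ → ℝ} (h : SepCont B w) (t x : ℝ) :
    |prim w t x| ≤ B * |t| := by
  have := h.abs_prim_sub_le 0 t x
  simpa [prim] using this

theorem SepCont.continuous_prim {B : ℝ} {w : ℝ → ℝ → ℝ} (h : SepCont B w) :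
    Continuous (Function.uncurry (prim w)) := by
  refine continuous_prod_of_continuous_lipschitzWith _ ⟨B, h.nonneg⟩
    (fun t => h.continuous_prim_right t) (fun x => ?_)
  refine LipschitzWith.of_dist_le_mul fun t s => ?_
  exact h.abs_prim_sub_le s t x

theorem prim_of_nonpos {w : ℝ → ℝ → ℝ} (h : ∀ t ≤ 0, ∀ x, w t x = 0) {t : ℝ} (ht : t ≤ 0) (x : ℝ) :
    prim w t x = 0 := by
  unfold prim
  rw [intervalIntegral.integral_congr (g := fun _ => 0)]
  · simp
  · intro s hs
    rw [uIcc_of_ge ht] at hs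
    exact h s hs.2 x

theorem deriv_nonpos_of_left_min {f : ℝ → ℝ} {f' a b t : ℝ} (ht : t ∈ Ioc a b)
    (hf : HasDerivWithinAt f f' (Icc a b) t) (hmin : ∀ s ∈ Icc a b, f t ≤ f s) : f' ≤ 0 := by
  have h1 : HasDerivWithinAt f f' (Ico a t) t := hf.mono fun s hs => ⟨hs.1, hs.2.le.trans ht.2⟩
  rw [hasDerivWithinAt_iff_tendsto_slope' (by simp)] at h1
  have : (𝓝[Ico a t] t).NeBot := by
    rw [← mem_closure_iff_nhdsWithin_neBot, closure_Ico ht.1.ne]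
    exact right_mem_Icc.2 ht.1.le
  refine le_of_tendsto h1 (eventually_nhdsWithin_of_forall fun s hs => ?_)
  rw [slope_def_field]
  exact div_nonpos_of_nonneg_of_nonpos (sub_nonneg.2 (hmin s ⟨hs.1, hs.2.le.trans ht.2⟩))
    (by linarith [hs.2])

theorem min_principle {T c ω : ℝ} (hT : 0 ≤ T) (hc : 0 ≤ c) (hω : 0 < ω) {Q Qt Qx : ℝ → ℝ → ℝ}
    (hcont : ContinuousOn (Function.uncurry Q) (Icc 0 T ×ˢ Icc 0 1))
    (hQt : ∀ t ∈ Ioc 0 T, ∀ x ∈ Ioc (0:ℝ) 1, HasDerivWithinAt (fun s => Q s x) (Qt t x) (Icc 0 T) t)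
    (hQx : ∀ t ∈ Ioc 0 T, ∀ x ∈ Ioc (0:ℝ) 1, HasDerivWithinAt (Q t) (Qx t x) (Icc 0 1) x)
    (hpos : ∀ t ∈ Ioc 0 T, ∀ x ∈ Ioc (0:ℝ) 1, 0 ≤ Qt t x + c * Qx t x + ω * Q t x)
    (h0 : ∀ x ∈ Icc (0:ℝ) 1, 0 ≤ Q 0 x) (hb : ∀ t ∈ Icc 0 T, 0 ≤ Q t 0) :
    ∀ t ∈ Icc 0 T, ∀ x ∈ Icc (0:ℝ) 1, 0 ≤ Q t x := by
  obtain ⟨⟨t₀, x₀⟩, ⟨ht₀, hx₀⟩, hmin⟩ := (isCompact_Icc.prod isCompact_Icc).exists_isMinOn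
    ⟨((0:ℝ), (0:ℝ)), ⟨left_mem_Icc.2 hT, left_mem_Icc.2 zero_le_one⟩⟩ hcont
  rw [isMinOn_iff] at hmin
  have hmin' : ∀ t ∈ Icc 0 T, ∀ x ∈ Icc (0:ℝ) 1, Q t₀ x₀ ≤ Q t x := fun t ht x hx => hmin (t, x) ⟨ht, hx⟩
  suffices h : 0 ≤ Q t₀ x₀ from fun t ht x hx => h.trans (hmin' t ht x hx)
  by_contra hneg
  push Not at hneg
  simp only at ht₀ hx₀
  have ht : t₀ ∈ Ioc 0 T := ⟨lt_of_le_of_ne ht₀.1 (by rintro rfl; linarith [h0 x₀ hx₀]), ht₀.2⟩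
  have hx : x₀ ∈ Ioc (0:ℝ) 1 := ⟨lt_of_le_of_ne hx₀.1 (by rintro rfl; linarith [hb t₀ ht₀]), hx₀.2⟩
  have d1 := deriv_nonpos_of_left_min ht (hQt _ ht _ hx) (fun s hs => hmin' s hs _ hx₀)
  have d2 := deriv_nonpos_of_left_min hx (hQx _ ht _ hx) (fun s hs => hmin' _ ht₀ s hs)
  nlinarith [hpos _ ht _ hx, mul_neg_of_pos_of_neg hω hneg, mul_nonpos_of_nonneg_of_nonpos hc d2]

/-- Integrated (in time) form of the transport equation `w_t + c w_x + ω w = S_t`, with zero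
initial data. -/
structure Tr (T c ω B C : ℝ) (S w : ℝ → ℝ → ℝ) : Prop where
  sep : SepCont B w
  src : SepCont C S
  zero : ∀ t ≤ 0, ∀ x, w t x = 0
  src_zero : ∀ t ≤ 0, ∀ x, S t x = 0
  eq : ∀ t ≤ T, ∀ x ∈ Icc (0:ℝ) 1, c * (prim w t x - prim w t 0)
    = ∫ y in (0:ℝ)..x, (S t y - ω * prim w t y - w t y)

section
variable {T c ω B C : ℝ} {S w : ℝ → ℝ → ℝ}

theorem Tr.continuous_flux (h : Tr T c ω B C S w) (t : ℝ) :
    Continuous fun y => S t y - ω * prim w t y - w t y :=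
  ((h.src.right t).sub (continuous_const.mul (h.sep.continuous_prim_right t))).sub (h.sep.right t)

theorem Tr.hasDerivWithinAt (h : Tr T c ω B C S w) {t x : ℝ} (ht : t ≤ T) (hx : x ∈ Icc (0:ℝ) 1) :
    HasDerivWithinAt (fun y => c * prim w t y) (S t x - ω * prim w t x - w t x) (Icc 0 1) x := by
  have hc := h.continuous_flux t
  have h1 : HasDerivAt (fun x => ∫ y in (0:ℝ)..x, (S t y - ω * prim w t y - w t y))
      (S t x - ω * prim w t x - w t x) x :=
    intervalIntegral.integral_hasDerivAt_right (hc.intervalIntegrable _ _)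
      (hc.stronglyMeasurableAtFilter _ _) hc.continuousAt
  refine (h1.add_const (c * prim w t 0)).hasDerivWithinAt.congr_of_mem (fun y hy => ?_) hx
  rw [← h.eq t ht y hy]; ring

theorem Tr.hasDerivWithinAt' (hc : 0 < c) (h : Tr T c ω B C S w) {t x : ℝ} (ht : t ≤ T) (hx : x ∈ Icc (0:ℝ) 1) :
    HasDerivWithinAt (prim w t) ((S t x - ω * prim w t x - w t x) / c) (Icc 0 1) x := by
  have := (h.hasDerivWithinAt ht hx).div_const c
  refine this.congr (fun y _ => ?_) ?_ <;> field_simp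

theorem Tr.abs_prim_le (h : Tr T c ω B C S w) (hT : 0 ≤ T) (hc : 0 < c) (hω : 0 < ω) {ε : ℝ}
    (hS : ∀ t ∈ Icc 0 T, ∀ x ∈ Icc (0:ℝ) 1, |S t x| ≤ ε)
    (hb : ∀ t ∈ Icc 0 T, |prim w t 0| ≤ ε * t) :
    ∀ t ∈ Icc 0 T, ∀ x ∈ Icc (0:ℝ) 1, |prim w t x| ≤ ε * t := by
  have hε : 0 ≤ ε := (abs_nonneg _).trans (hS 0 (left_mem_Icc.2 hT) 0 (left_mem_Icc.2 zero_le_one))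
  have hcont := h.sep.continuous_prim
  have h0 : ∀ x, prim w 0 x = 0 := fun x => by simp [prim]
  have key : ∀ σ : ℝ, |σ| = 1 → ∀ t ∈ Icc 0 T, ∀ x ∈ Icc (0:ℝ) 1, 0 ≤ σ * prim w t x + ε * t := by
    intro σ hσ
    have hab : ∀ r, -|r| ≤ σ * r := fun r => by
      have := neg_abs_le (σ * r); rwa [abs_mul, hσ, one_mul] at this
    refine min_principle (c := c) (ω := ω) hT hc.le hω (Q := fun t x => σ * prim w t x + ε * t)
      (Qt := fun t x => σ * w t x + ε)
      (Qx := fun t x => σ * ((S t x - ω * prim w t x - w t x) / c)) ?_ ?_ ?_ ?_ ?_ ?_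
    · refine Continuous.continuousOn ?_
      change Continuous fun p : ℝ × ℝ => σ * Function.uncurry (prim w) p + ε * p.1
      fun_prop
    · intro t _ x _
      have := ((h.sep.hasDerivAt_prim t x).const_mul σ).add ((hasDerivAt_id t).const_mul ε)
      rw [mul_one] at this
      exact this.hasDerivWithinAt
    · intro t ht x hx
      exact ((h.hasDerivWithinAt' hc ht.2 (Ioc_subset_Icc_self hx)).const_mul σ).add_const _
    · intro t ht x hx
      have h1 := hab (S t x)
      have h2 := hS t (Ioc_subset_Icc_self ht) x (Ioc_subset_Icc_self hx)
      have h3 : 0 ≤ ω * (ε * t) := by have := ht.1; positivity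
      have h4 : σ * w t x + ε + c * (σ * ((S t x - ω * prim w t x - w t x) / c)) +
        ω * (σ * prim w t x + ε * t) = σ * S t x + ε + ω * (ε * t) := by field_simp; ring
      rw [h4]; linarith
    · intro x _; simp [h0]
    · intro t ht
      linarith [hab (prim w t 0), hb t ht]
  intro t ht x hx
  have h1 := key 1 (by simp) t ht x hx
  have h2 := key (-1) (by simp) t ht x hx
  rw [abs_le]; constructor <;> linarith

/-- Lower bounds on time increments of the source and of the boundary values propagate. -/
theorem Tr.increment_ge (h : Tr T c ω B C S w) (hT : 0 ≤ T) (hc : 0 < c) (hω : 0 < ω) {τ s : ℝ}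
    (hτ : 0 ≤ τ) (hS : ∀ t ∈ Icc 0 T, ∀ x ∈ Icc (0:ℝ) 1, -s ≤ S t x - S (t - τ) x)
    (hb : ∀ t ∈ Icc 0 T, -(s / ω * (1 - Real.exp (-(ω * t)))) ≤ prim w t 0 - prim w (t - τ) 0) :
    ∀ t ∈ Icc 0 T, ∀ x ∈ Icc (0:ℝ) 1,
      -(s / ω * (1 - Real.exp (-(ω * t)))) ≤ prim w t x - prim w (t - τ) x := by
  have hcont := h.sep.continuous_prim
  have key : ∀ t ∈ Icc 0 T, ∀ x ∈ Icc (0:ℝ) 1,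
      0 ≤ prim w t x - prim w (t - τ) x + s / ω * (1 - Real.exp (-(ω * t))) := by
    refine min_principle (c := c) (ω := ω) hT hc.le hω
      (Q := fun t x => prim w t x - prim w (t - τ) x + s / ω * (1 - Real.exp (-(ω * t))))
      (Qt := fun t x => w t x - w (t - τ) x + s * Real.exp (-(ω * t)))
      (Qx := fun t x => (S t x - ω * prim w t x - w t x) / c -
        (S (t - τ) x - ω * prim w (t - τ) x - w (t - τ) x) / c) ?_ ?_ ?_ ?_ ?_ ?_
    · refine Continuous.continuousOn ?_
      change Continuous fun p : ℝ × ℝ => Function.uncurry (prim w) p -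
        Function.uncurry (prim w) (p.1 - τ, p.2) + s / ω * (1 - Real.exp (-(ω * p.1)))
      fun_prop
    · intro t _ x _
      have d1 := (h.sep.hasDerivAt_prim (t - τ) x).comp_sub_const t τ
      have d2 : HasDerivAt (fun t => s / ω * (1 - Real.exp (-(ω * t)))) (s * Real.exp (-(ω * t))) t := by
        have := ((((hasDerivAt_id t).const_mul ω).neg.exp).const_sub 1).const_mul (s / ω)
        refine this.congr_deriv ?_
        simp only [id, Pi.neg_apply]; field_simp
      exact (((h.sep.hasDerivAt_prim t x).sub d1).add d2).hasDerivWithinAt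
    · intro t ht x hx
      exact ((h.hasDerivWithinAt' hc ht.2 (Ioc_subset_Icc_self hx)).sub
        (h.hasDerivWithinAt' hc (by linarith [ht.2]) (Ioc_subset_Icc_self hx))).add_const _
    · intro t ht x hx
      have h1 := hS t (Ioc_subset_Icc_self ht) x (Ioc_subset_Icc_self hx)
      have h4 : w t x - w (t - τ) x + s * Real.exp (-(ω * t)) + c * ((S t x - ω * prim w t x - w t x) / c -
        (S (t - τ) x - ω * prim w (t - τ) x - w (t - τ) x) / c) +
        ω * (prim w t x - prim w (t - τ) x + s / ω * (1 - Real.exp (-(ω * t)))) =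
        S t x - S (t - τ) x + s := by field_simp; ring
      rw [h4]; linarith
    · intro x _
      rw [prim_of_nonpos h.zero le_rfl, prim_of_nonpos h.zero (by linarith)]; simp
    · intro t ht
      linarith [hb t ht]
  intro t ht x hx
  linarith [key t ht x hx]

end

theorem SepCont.mono {B B' : ℝ} {H : ℝ → ℝ → ℝ} (h : SepCont B H) (hB : B ≤ B') : SepCont B' H :=
  ⟨h.left, h.right, fun t x => (h.bound t x).trans hB⟩

theorem SepCont.sub {B B' : ℝ} {H H' : ℝ → ℝ → ℝ} (h : SepCont B H) (h' : SepCont B' H') :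
    SepCont (B + B') fun t x => H t x - H' t x :=
  ⟨fun x => (h.left x).sub (h'.left x), fun t => (h.right t).sub (h'.right t),
    fun t x => (abs_sub _ _).trans (add_le_add (h.bound t x) (h'.bound t x))⟩

theorem SepCont.mul_left {B K : ℝ} {H : ℝ → ℝ → ℝ} {e : ℝ → ℝ} (h : SepCont B H)
    (he : Continuous e) (hK : ∀ t, |e t| ≤ K) : SepCont (K * B) fun t x => e t * H t x :=
  ⟨fun x => he.mul (h.left x), fun t => continuous_const.mul (h.right t), fun t x => by
    rw [abs_mul]
    exact mul_le_mul (hK t) (h.bound t x) (abs_nonneg _) ((abs_nonneg _).trans (hK t))⟩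

theorem SepCont.integral_swap {B : ℝ} {H : ℝ → ℝ → ℝ} (h : SepCont B H) (a b c d : ℝ) :
    ∫ t in a..b, ∫ x in c..d, H t x = ∫ x in c..d, ∫ t in a..b, H t x := by
  have h0 : IntegrableOn (Function.uncurry H) (uIoc a b ×ˢ uIoc c d) := by
    refine Measure.integrableOn_of_bounded (M := B) ?_ h.measurable.aestronglyMeasurable ?_
    · rw [Measure.volume_eq_prod, Measure.prod_prod]
      exact by simp [uIoc, ENNReal.mul_eq_top]
    · filter_upwards with p using h.bound p.1 p.2
  exact intervalIntegral_intervalIntegral_swap h0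

theorem add_integral_eq_zero_of_exp {k v : ℝ → ℝ} {ω T : ℝ} (hv : Continuous v)
    (h : ∀ t ∈ Icc 0 T, Real.exp (ω * t) * k t + ∫ s in (0:ℝ)..t, Real.exp (ω * s) * v s = 0) :
    ∀ t ∈ Icc 0 T, k t + ω * (∫ s in (0:ℝ)..t, k s) + ∫ s in (0:ℝ)..t, v s = 0 := by
  set m : ℝ → ℝ := fun t => -(Real.exp (-(ω * t)) * ∫ s in (0:ℝ)..t, Real.exp (ω * s) * v s) with hm
  have hkm : ∀ t ∈ Icc 0 T, k t = m t := by
    intro t ht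
    have := h t ht
    have h2 : Real.exp (-(ω * t)) * Real.exp (ω * t) = 1 := by rw [← Real.exp_add]; simp
    simp only [hm]
    linear_combination Real.exp (-(ω * t)) * this - k t * h2
  have hcv : Continuous fun s => Real.exp (ω * s) * v s := by fun_prop
  have hd : ∀ t, HasDerivAt m (-(ω * m t) - v t) t := by
    intro t
    have h1 : HasDerivAt (fun t => ∫ s in (0:ℝ)..t, Real.exp (ω * s) * v s) (Real.exp (ω * t) * v t) t :=
      intervalIntegral.integral_hasDerivAt_right (hcv.intervalIntegrable _ _)
        (hcv.stronglyMeasurableAtFilter _ _) hcv.continuousAt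
    have h2 : HasDerivAt (fun t => Real.exp (-(ω * t))) (-(ω * Real.exp (-(ω * t)))) t := by
      have := ((hasDerivAt_id t).const_mul ω).neg.exp
      refine this.congr_deriv ?_
      simp only [id, Pi.neg_apply]; ring
    refine (h2.mul h1).neg.congr_deriv ?_
    have h3 : Real.exp (-(ω * t)) * Real.exp (ω * t) = 1 := by rw [← Real.exp_add]; simp
    simp only [hm]
    linear_combination (-v t) * h3
  have hcm : Continuous m := continuous_iff_continuousAt.2 fun t => (hd t).continuousAt
  intro t ht
  have h1 := intervalIntegral.integral_eq_sub_of_hasDerivAt (a := 0) (b := t) (fun s _ => hd s)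
    (((continuous_const.mul hcm).neg.sub hv).intervalIntegrable _ _)
  rw [intervalIntegral.integral_sub (f := fun s => -(ω * m s))
    ((continuous_const.mul hcm).neg.intervalIntegrable _ _) (hv.intervalIntegrable _ _), intervalIntegral.integral_neg, intervalIntegral.integral_const_mul] at h1
  have h2 : ∫ s in (0:ℝ)..t, k s = ∫ s in (0:ℝ)..t, m s := by
    refine intervalIntegral.integral_congr fun s hs => ?_
    rw [uIcc_of_le ht.1] at hs
    exact hkm s ⟨hs.1, hs.2.trans ht.2⟩
  have h0 : m 0 = 0 := by simp [hm]
  rw [h2, hkm t ht]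
  linarith

theorem Tr.of_raw {T c ω B C : ℝ} {w z S wt wx zt zx : ℝ → ℝ → ℝ} (hω : 0 ≤ ω) (hc : 0 ≤ c)
    (hw : SepCont B w) (hz : SepCont B z) (hS : SepCont C S) (hw0 : ∀ t ≤ 0, ∀ x, w t x = 0)
    (hz0 : ∀ t ≤ 0, ∀ x, z t x = 0) (hS0 : ∀ t ≤ 0, ∀ x, S t x = 0)
    (hSz : ∀ t ∈ Icc 0 T, ∀ x ∈ Icc (0:ℝ) 1, S t x = z t x + ω * prim z t x)
    (hwt : ∀ t ∈ Icc 0 T, ∀ x ∈ Icc (0:ℝ) 1, HasDerivWithinAt (fun s => w s x) (wt t x) (Icc 0 T) t)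
    (hwx : ∀ t ∈ Icc 0 T, ∀ x ∈ Icc (0:ℝ) 1, HasDerivWithinAt (w t) (wx t x) (Icc 0 1) x)
    (hzt : ∀ t ∈ Icc 0 T, ∀ x ∈ Icc (0:ℝ) 1, HasDerivWithinAt (fun s => z s x) (zt t x) (Icc 0 T) t)
    (hzx : ∀ t ∈ Icc 0 T, ∀ x ∈ Icc (0:ℝ) 1, HasDerivWithinAt (z t) (zx t x) (Icc 0 1) x)
    (heq : ∀ t ∈ Icc 0 T, ∀ x ∈ Icc (0:ℝ) 1, wt t x + c * wx t x + ω * w t x = zt t x + ω * z t x) :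
    Tr T c ω B C S w := by
  refine ⟨hw, hS, hw0, hS0, fun t ht x hx => ?_⟩
  rcases le_total t 0 with h0 | h0
  · simp [prim_of_nonpos hw0 h0, hw0 t h0, hS0 t h0]
  set E : ℝ → ℝ := fun t => Real.exp (ω * max 0 (min t T)) with hE
  have hEc : Continuous E := by fun_prop
  have hT : 0 ≤ T := h0.trans ht
  have hEb : ∀ t, |E t| ≤ Real.exp (ω * T) := fun t => by
    rw [hE, abs_of_pos (Real.exp_pos _), Real.exp_le_exp]
    exact mul_le_mul_of_nonneg_left (max_le hT (min_le_right _ _)) hω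
  have hEe : ∀ t ∈ Icc 0 T, E t = Real.exp (ω * t) := fun t ht => by
    simp only [hE]; rw [min_eq_left ht.2, max_eq_right ht.1]
  have hEd : ∀ t ∈ Icc 0 T, HasDerivWithinAt E (ω * E t) (Icc 0 T) t := by
    intro t ht
    have h1 : HasDerivAt (fun t => Real.exp (ω * t)) (ω * Real.exp (ω * t)) t := by
      have := ((hasDerivAt_id t).const_mul ω).exp
      refine this.congr_deriv ?_
      simp only [id]; ring
    rw [hEe t ht]
    exact h1.hasDerivWithinAt.congr hEe (hEe t ht)
  have hG := (hw.sub hz).mul_left hEc hEb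
  have hF : SepCont (c * Real.exp (ω * T) * B) fun t x => c * E t * w t x :=
    hw.mul_left (e := fun t => c * E t) (by fun_prop) fun t => by
      rw [abs_mul, abs_of_nonneg hc]; exact mul_le_mul_of_nonneg_left (hEb t) hc
  have hB := hw.nonneg
  have hp := Real.exp_pos (ω * T)
  have hcirc : ∀ t ∈ Icc 0 T, circ (fun t x => c * E t * w t x) (fun t x => E t * (w t x - z t x)) 0 t 0 x = 0 := by
    intro t ht
    refine circ_eq_zero (B := (c + 2) * Real.exp (ω * T) * B) (A₁ := 0) (A₂ := T) (C₁ := 0) (C₂ := 1)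
      (hF.mono ?_) (hG.mono ?_)
      (Ft := fun t x => c * (ω * E t) * w t x + c * E t * wt t x) (Fx := fun t x => c * E t * wx t x)
      (Gt := fun t x => ω * E t * (w t x - z t x) + E t * (wt t x - zt t x))
      (Gx := fun t x => E t * (wx t x - zx t x)) ?_ ?_ ?_ ?_ ?_ le_rfl ht.1 ht.2 le_rfl hx.1 hx.2
    · nlinarith [mul_nonneg hp.le hB]
    · nlinarith [mul_nonneg hc (mul_nonneg hp.le hB)]
    · intro t ht x hx
      exact ((hEd t ht).const_mul c).mul (hwt t ht x hx)
    · intro t ht x hx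
      exact (hwx t ht x hx).const_mul _
    · intro t ht x hx
      exact (hEd t ht).mul ((hwt t ht x hx).sub (hzt t ht x hx))
    · intro t ht x hx
      exact ((hwx t ht x hx).sub (hzx t ht x hx)).const_mul _
    · intro t ht x hx
      linear_combination E t * heq t ht x hx
  have hwz := hw.sub hz
  have hk := add_integral_eq_zero_of_exp (T := T) (ω := ω) (k := fun t => ∫ y in (0:ℝ)..x, (w t y - z t y))
    (v := fun t => c * (w t x - w t 0)) (continuous_const.mul ((hw.left x).sub (hw.left 0))) (by
      intro t ht
      refine Eq.trans ?_ (hcirc t ht)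
      rw [circ, ← hEe t ht]
      congr 1
      · rw [← intervalIntegral.integral_const_mul]
        refine intervalIntegral.integral_congr fun y _ => ?_
        simp [hw0, hz0]
      · refine intervalIntegral.integral_congr fun s hs => ?_
        rw [uIcc_of_le ht.1] at hs
        rw [← hEe s ⟨hs.1, hs.2.trans ht.2⟩]; ring) t ⟨h0, ht⟩
  rw [hwz.integral_swap, intervalIntegral.integral_const_mul, intervalIntegral.integral_sub
    ((hw.left x).intervalIntegrable _ _) ((hw.left 0).intervalIntegrable _ _)] at hk
  have h1 : ∀ y, ∫ s in (0:ℝ)..t, (w s y - z s y) = prim w t y - prim z t y := fun y =>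
    intervalIntegral.integral_sub ((hw.left y).intervalIntegrable _ _) ((hz.left y).intervalIntegrable _ _)
  simp only [h1] at hk
  have h2 : ∫ y in (0:ℝ)..x, (S t y - ω * prim w t y - w t y) =
      -((∫ y in (0:ℝ)..x, (w t y - z t y)) + ω * ∫ y in (0:ℝ)..x, (prim w t y - prim z t y)) := by
    rw [← intervalIntegral.integral_const_mul, ← intervalIntegral.integral_add
      (g := fun y => ω * (prim w t y - prim z t y)) ((hwz.right t).intervalIntegrable _ _) ((continuous_const.mul
        ((hw.continuous_prim_right t).sub (hz.continuous_prim_right t))).intervalIntegrable _ _),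
      ← intervalIntegral.integral_neg]
    refine intervalIntegral.integral_congr fun y hy => ?_
    rw [uIcc_of_le hx.1] at hy
    rw [hSz t ⟨h0, ht⟩ y ⟨hy.1, hy.2.trans hx.2⟩]; ring
  rw [h2]
  simp only [prim] at hk ⊢
  linarith

/-- The free transport of boundary data `b` with speed `c` and damping rate `ω`. -/
noncomputable def freeTr (c ω : ℝ) (b : ℝ → ℝ) (t x : ℝ) : ℝ :=
  Real.exp (-(ω / c * max 0 (min x 1))) * b (t - max 0 (min x 1) / c)

section
variable {T c ω B B' C : ℝ} {S w : ℝ → ℝ → ℝ} {b : ℝ → ℝ}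

theorem sepCont_freeTr (hc : 0 < c) (hω : 0 ≤ ω) (hb : Continuous b) (hbB : ∀ t, |b t| ≤ B') :
    SepCont B' (freeTr c ω b) := by
  refine ⟨fun x => ?_, fun t => ?_, fun t x => ?_⟩
  · unfold freeTr; fun_prop
  · unfold freeTr; fun_prop
  · unfold freeTr
    rw [abs_mul, Real.abs_exp]
    have h1 : Real.exp (-(ω / c * max 0 (min x 1))) ≤ 1 := by
      rw [Real.exp_le_one_iff]
      have : 0 ≤ max 0 (min x 1) := le_max_left _ _
      have := mul_nonneg (div_nonneg hω hc.le) this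
      linarith
    exact (mul_le_of_le_one_left (abs_nonneg _) h1).trans (hbB _)

theorem freeTr_nonneg (hb : ∀ t, 0 ≤ b t) (t x : ℝ) : 0 ≤ freeTr c ω b t x :=
  mul_nonneg (Real.exp_pos _).le (hb _)

theorem freeTr_zero_right (t : ℝ) : freeTr c ω b t 0 = b t := by simp [freeTr]

theorem prim_freeTr (hc : 0 < c) (hb : Continuous b) (hb0 : ∀ t ≤ 0, b t = 0) (t x : ℝ) :
    prim (freeTr c ω b) t x =
      Real.exp (-(ω / c * max 0 (min x 1))) * ∫ s in (0:ℝ)..(t - max 0 (min x 1) / c), b s := by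
  unfold prim freeTr
  have hx : 0 ≤ max 0 (min x 1) / c := div_nonneg (le_max_left _ _) hc.le
  generalize max 0 (min x 1) / c = d at hx
  rw [intervalIntegral.integral_const_mul, intervalIntegral.integral_comp_sub_right,
    ← intervalIntegral.integral_add_adjacent_intervals (b := 0) (hb.intervalIntegrable _ _)
      (hb.intervalIntegrable _ _), intervalIntegral.integral_congr (a := 0 - d) (b := 0) (g := fun _ => 0)]
  · simp
  · intro s hs
    rw [uIcc_of_le (by linarith)] at hs
    exact hb0 s hs.2

theorem prim_freeTr_mono (hc : 0 < c) (hb : Continuous b) (hb0 : ∀ t, 0 ≤ b t) {s t : ℝ} (hst : s ≤ t)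
    (x : ℝ) (hω : 0 ≤ ω) (hbB : ∀ t, |b t| ≤ B') :
    prim (freeTr c ω b) s x ≤ prim (freeTr c ω b) t x := by
  have h := sepCont_freeTr hc hω hb hbB
  rw [← sub_nonneg]
  unfold prim
  rw [intervalIntegral.integral_interval_sub_left ((h.left x).intervalIntegrable _ _)
    ((h.left x).intervalIntegrable _ _)]
  exact intervalIntegral.integral_nonneg hst fun _ _ => freeTr_nonneg hb0 _ _

theorem prim_sub {B₁ B₂ : ℝ} {v w : ℝ → ℝ → ℝ} (hv : SepCont B₁ v) (hw : SepCont B₂ w) (t x : ℝ) :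
    prim (fun t x => v t x - w t x) t x = prim v t x - prim w t x :=
  intervalIntegral.integral_sub ((hv.left x).intervalIntegrable _ _) ((hw.left x).intervalIntegrable _ _)

theorem Tr.sub_freeTr (h : Tr T c ω B C S w) (hc : 0 < c) (hω : 0 ≤ ω) (hb : Continuous b)
    (hbB : ∀ t, |b t| ≤ B') (hb0 : ∀ t ≤ 0, b t = 0) :
    Tr T c ω (B + B') C S fun t x => w t x - freeTr c ω b t x := by
  have hf := sepCont_freeTr hc hω hb hbB
  refine ⟨h.sep.sub hf, h.src, fun t ht x => ?_, h.src_zero, fun t ht x hx => ?_⟩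
  · rw [h.zero t ht, freeTr, hb0]
    · simp
    · have : 0 ≤ max 0 (min x 1) / c := div_nonneg (le_max_left _ _) hc.le
      linarith
  · have hβ : ∀ t, HasDerivAt (fun t => ∫ s in (0:ℝ)..t, b s) (b t) t := fun t =>
      intervalIntegral.integral_hasDerivAt_right (hb.intervalIntegrable _ _)
        (hb.stronglyMeasurableAtFilter _ _) hb.continuousAt
    have hβc : Continuous fun t => ∫ s in (0:ℝ)..t, b s :=
      continuous_iff_continuousAt.2 fun t => (hβ t).continuousAt
    have hd : ∀ y, HasDerivAt (fun y => c * (Real.exp (-(ω / c * y)) * ∫ s in (0:ℝ)..(t - y / c), b s))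
        (-(Real.exp (-(ω / c * y)) * (ω * (∫ s in (0:ℝ)..(t - y / c), b s) + b (t - y / c)))) y := by
      intro y
      have h1 : HasDerivAt (fun y => Real.exp (-(ω / c * y))) (-(ω / c * Real.exp (-(ω / c * y)))) y := by
        have := ((hasDerivAt_id y).const_mul (ω / c)).neg.exp
        refine this.congr_deriv ?_
        simp only [id, Pi.neg_apply]; ring
      have h2 : HasDerivAt (fun y => t - y / c) (-(1 / c)) y :=
        ((hasDerivAt_id y).div_const c).const_sub t
      refine ((h1.mul ((hβ _).comp y h2)).const_mul c).congr_deriv ?_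
      simp only [Function.comp]
      field_simp
      ring
    have hdc : Continuous fun y => -(Real.exp (-(ω / c * y)) * (ω * (∫ s in (0:ℝ)..(t - y / c), b s) + b (t - y / c))) := by
      fun_prop
    have hI := intervalIntegral.integral_eq_sub_of_hasDerivAt (a := 0) (b := x) (fun s _ => hd s)
      (hdc.intervalIntegrable _ _)
    have hcl : ∀ y ∈ Icc (0:ℝ) 1, max 0 (min y 1) = y := fun y hy => by
      rw [min_eq_left hy.2, max_eq_right hy.1]
    have h3 : ∫ y in (0:ℝ)..x, (S t y - ω * prim (fun t x => w t x - freeTr c ω b t x) t y -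
          (w t y - freeTr c ω b t y)) =
        (∫ y in (0:ℝ)..x, (S t y - ω * prim w t y - w t y)) - ∫ y in (0:ℝ)..x,
          -(Real.exp (-(ω / c * y)) * (ω * (∫ s in (0:ℝ)..(t - y / c), b s) + b (t - y / c))) := by
      rw [← intervalIntegral.integral_sub ((h.continuous_flux t).intervalIntegrable _ _)
        (hdc.intervalIntegrable _ _)]
      refine intervalIntegral.integral_congr fun y hy => ?_
      rw [uIcc_of_le hx.1] at hy
      have hy' := hcl y ⟨hy.1, hy.2.trans hx.2⟩
      simp only [prim_sub h.sep hf, prim_freeTr hc hb hb0]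
      simp only [freeTr, hy']
      ring
    rw [h3, hI, ← h.eq t ht x hx]
    simp only [prim_sub h.sep hf, prim_freeTr hc hb hb0, hcl x hx, hcl 0 (left_mem_Icc.2 zero_le_one)]
    simp
    ring

end

/-- Lebesgue measure on the space-time domain. -/
noncomputable abbrev txMeasure (T : ℝ) : Measure (ℝ × ℝ) :=
  (volume.restrict (Ioc 0 T)).prod (volume.restrict (Ioc 0 1))

theorem ae_txMeasure (T : ℝ) : ∀ᵐ p ∂txMeasure T, p ∈ Ioc 0 T ×ˢ Ioc (0:ℝ) 1 := by
  rw [txMeasure, Measure.prod_restrict]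
  exact ae_restrict_mem (measurableSet_Ioc.prod measurableSet_Ioc)

theorem txMeasure_real_univ {T : ℝ} (hT : 0 ≤ T) : (txMeasure T).real univ = T := by
  rw [txMeasure, Measure.prod_restrict, measureReal_restrict_apply_univ, measureReal_def,
    Measure.prod_prod]
  simp [hT]

theorem abs_integral_tx_le {T K : ℝ} (hT : 0 ≤ T) {f : ℝ × ℝ → ℝ}
    (h : ∀ p ∈ Ioc 0 T ×ˢ Ioc (0:ℝ) 1, |f p| ≤ K) : |∫ p, f p ∂txMeasure T| ≤ K * T := by
  have := norm_integral_le_of_norm_le_const (μ := txMeasure T) (f := f) (C := K)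
    ((ae_txMeasure T).mono fun p hp => h p hp)
  rwa [txMeasure_real_univ hT] at this

theorem integrable_tx {T K : ℝ} {f : ℝ × ℝ → ℝ} (hf : Measurable f)
    (h : ∀ p ∈ Ioc 0 T ×ˢ Ioc (0:ℝ) 1, |f p| ≤ K) : Integrable f (txMeasure T) :=
  Integrable.of_bound hf.aestronglyMeasurable K ((ae_txMeasure T).mono fun p hp => h p hp)

section
variable {T ω B C c₁ c₂ δ : ℝ} {S w₁ w₂ : ℝ → ℝ → ℝ}

theorem SepCont.measurable_prim {B : ℝ} {w : ℝ → ℝ → ℝ} (h : SepCont B w) :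
    Measurable fun p : ℝ × ℝ => prim w p.1 p.2 := h.continuous_prim.measurable

theorem Tr.measurable_flux {c : ℝ} (h : Tr T c ω B C S w₁) :
    Measurable fun p : ℝ × ℝ => S p.1 p.2 - ω * prim w₁ p.1 p.2 - w₁ p.1 p.2 :=
  (h.src.measurable.sub (h.sep.measurable_prim.const_mul ω)).sub h.sep.measurable

theorem Tr.abs_flux_le {c : ℝ} (hω : 0 ≤ ω) (h : Tr T c ω B C S w₁)
    (hδ : ∀ t ≤ T, ∀ x ∈ Icc (0:ℝ) 1, |prim w₁ t x| ≤ δ) {t x : ℝ} (ht : t ≤ T) (hx : x ∈ Icc (0:ℝ) 1) :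
    |S t x - ω * prim w₁ t x - w₁ t x| ≤ C + ω * δ + B := by
  refine (abs_sub _ _).trans (add_le_add ((abs_sub _ _).trans (add_le_add (h.src.bound _ _) ?_))
    (h.sep.bound _ _))
  rw [abs_mul, abs_of_nonneg hω]
  exact mul_le_mul_of_nonneg_left (hδ t ht x hx) hω

/-- Discrete Jacobian identity. -/
theorem Tr.jacobian (h₁ : Tr T c₁ ω B C S w₁) (h₂ : Tr T c₂ ω B C S w₂) (hc₁ : 0 < c₁) (hc₂ : 0 < c₂)
    {t t' : ℝ} (ht : t ≤ T) (ht' : t' ≤ T) :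
    ∫ x in (0:ℝ)..1, (c₁ * (prim w₁ t x - prim w₁ t' x) * (S t x - ω * prim w₂ t x - w₂ t x)
      - c₂ * (S t' x - ω * prim w₁ t' x - w₁ t' x) * (prim w₂ t x - prim w₂ t' x)) =
    c₁ * c₂ * ((prim w₁ t 1 - prim w₁ t' 1) * prim w₂ t 1 - (prim w₁ t 0 - prim w₁ t' 0) * prim w₂ t 0)
    - ((∫ x in (0:ℝ)..1, c₂ * (S t x - ω * prim w₁ t x - w₁ t x) * prim w₂ t x) -
      ∫ x in (0:ℝ)..1, c₂ * (S t' x - ω * prim w₁ t' x - w₁ t' x) * prim w₂ t' x) := by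
  have f1 := h₁.continuous_flux t
  have f1' := h₁.continuous_flux t'
  have f2 := h₂.continuous_flux t
  have p1 := h₁.sep.continuous_prim_right t
  have p1' := h₁.sep.continuous_prim_right t'
  have p2 := h₂.sep.continuous_prim_right t
  have p2' := h₂.sep.continuous_prim_right t'
  have hd : ∀ x ∈ Icc (0:ℝ) 1, HasDerivWithinAt (fun x => c₁ * c₂ * ((prim w₁ t x - prim w₁ t' x) * prim w₂ t x))
      (c₂ * ((S t x - ω * prim w₁ t x - w₁ t x) - (S t' x - ω * prim w₁ t' x - w₁ t' x)) * prim w₂ t x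
        + c₁ * (prim w₁ t x - prim w₁ t' x) * (S t x - ω * prim w₂ t x - w₂ t x)) (Icc 0 1) x := by
    intro x hx
    refine ((((h₁.hasDerivWithinAt' hc₁ ht hx).sub (h₁.hasDerivWithinAt' hc₁ ht' hx)).mul
      (h₂.hasDerivWithinAt' hc₂ ht hx)).const_mul (c₁ * c₂)).congr_deriv ?_
    simp only [Pi.sub_apply]
    field_simp
  have hI := intervalIntegral.integral_eq_sub_of_hasDerivAt_of_le (a := 0) (b := 1) zero_le_one
    (f := fun x => c₁ * c₂ * ((prim w₁ t x - prim w₁ t' x) * prim w₂ t x))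
    (fun x hx => (hd x hx).continuousWithinAt)
    (fun x hx => (hd x (Ioo_subset_Icc_self hx)).hasDerivAt (Icc_mem_nhds hx.1 hx.2))
    ((by fun_prop : Continuous _).intervalIntegrable _ _)
  rw [← intervalIntegral.integral_sub ((by fun_prop : Continuous _).intervalIntegrable _ _)
    ((by fun_prop : Continuous _).intervalIntegrable _ _), mul_sub, ← hI,
    ← intervalIntegral.integral_sub ((by fun_prop : Continuous _).intervalIntegrable _ _)
    ((by fun_prop : Continuous _).intervalIntegrable _ _)]
  refine intervalIntegral.integral_congr fun x _ => ?_
  ring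

end

theorem integral_sub_shift_le {π : ℝ → ℝ} {T h P : ℝ} (hT : 0 ≤ T) (hh : 0 < h) (hm : Measurable π)
    (hP : ∀ t ≤ T, |π t| ≤ P) (h0 : ∀ t ≤ 0, π t = 0) :
    |∫ t in (0:ℝ)..T, (π t - π (t - h))| ≤ P * h := by
  have hi : ∀ a b, a ≤ T → b ≤ T → IntervalIntegrable π volume a b := by
    intro a b ha hb
    refine (intervalIntegrable_const (c := P)).mono_fun hm.aestronglyMeasurable ?_
    refine (ae_restrict_iff' measurableSet_uIoc).2 (Eventually.of_forall fun t ht => ?_)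
    have : t ≤ T := ht.2.trans (max_le ha hb)
    exact (hP t this).trans (le_abs_self P)
  have hi' : IntervalIntegrable (fun t => π (t - h)) volume 0 T := by
    refine (intervalIntegrable_const (c := P)).mono_fun (hm.comp (measurable_id.sub_const h)).aestronglyMeasurable ?_
    refine (ae_restrict_iff' measurableSet_uIoc).2 (Eventually.of_forall fun t ht => ?_)
    have : t ≤ T := ht.2.trans (max_le hT le_rfl)
    exact (hP _ (by linarith)).trans (le_abs_self P)
  rw [intervalIntegral.integral_sub (hi _ _ hT le_rfl) hi', intervalIntegral.integral_comp_sub_right,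
    ← intervalIntegral.integral_add_adjacent_intervals (hi 0 (T - h) hT (by linarith)) (hi _ _ (by linarith) le_rfl),
    ← intervalIntegral.integral_add_adjacent_intervals (hi (0 - h) 0 (by linarith) hT) (hi 0 (T - h) hT (by linarith))]
  have h1 : ∫ t in (0 - h)..0, π t = 0 := by
    rw [intervalIntegral.integral_congr (g := fun _ => 0)]
    · simp
    · intro t ht
      rw [uIcc_of_le (by linarith)] at ht
      exact h0 t ht.2
  have h2 := intervalIntegral.norm_integral_le_of_norm_le_const (a := T - h) (b := T) (C := P) (f := π) (by
    intro t ht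
    rw [uIoc_of_le (by linarith)] at ht
    exact hP t ht.2)
  rw [h1]
  rw [Real.norm_eq_abs, show T - (T - h) = h by ring, abs_of_pos hh] at h2
  refine le_trans (le_of_eq ?_) h2
  congr 1; ring

section
variable {T ω B C c₁ c₂ δ : ℝ} {S w₁ w₂ : ℝ → ℝ → ℝ}

theorem Tr.jacobian_diff_bound (h₁ : Tr T c₁ ω B C S w₁) (h₂ : Tr T c₂ ω B C S w₂) (hT : 0 ≤ T)
    (hω : 0 ≤ ω) (hc₁ : 0 < c₁) (hc₂ : 0 < c₂)
    (hδ₁ : ∀ t ≤ T, ∀ x ∈ Icc (0:ℝ) 1, |prim w₁ t x| ≤ δ)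
    (hδ₂ : ∀ t ≤ T, ∀ x ∈ Icc (0:ℝ) 1, |prim w₂ t x| ≤ δ) {h : ℝ} (hh : 0 < h) :
    |∫ t in (0:ℝ)..T, ∫ x in (0:ℝ)..1,
      (c₁ * (prim w₁ t x - prim w₁ (t - h) x) * (S t x - ω * prim w₂ t x - w₂ t x)
      - c₂ * (S (t - h) x - ω * prim w₁ (t - h) x - w₁ (t - h) x) * (prim w₂ t x - prim w₂ (t - h) x))| ≤
    (2 * c₁ * c₂ * B * δ * T + c₂ * (C + ω * δ + B) * δ) * h := by
  set π : ℝ → ℝ := fun t => ∫ x in (0:ℝ)..1, c₂ * (S t x - ω * prim w₁ t x - w₁ t x) * prim w₂ t x with hπ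
  set A : ℝ → ℝ := fun t => c₁ * c₂ * ((prim w₁ t 1 - prim w₁ (t - h) 1) * prim w₂ t 1 -
    (prim w₁ t 0 - prim w₁ (t - h) 0) * prim w₂ t 0) with hA
  have hδ : 0 ≤ δ := (abs_nonneg _).trans (hδ₁ 0 hT 0 (left_mem_Icc.2 zero_le_one))
  have hB := h₁.sep.nonneg
  have hm : Measurable π := by
    have : Measurable (Function.uncurry fun t x => c₂ * (S t x - ω * prim w₁ t x - w₁ t x) * prim w₂ t x) :=
      (h₁.measurable_flux.const_mul c₂).mul h₂.sep.measurable_prim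
    have := this.stronglyMeasurable.integral_prod_right (ν := volume.restrict (Ioc (0:ℝ) 1))
    simp only [hπ, intervalIntegral.integral_of_le zero_le_one]
    exact this.measurable
  have hP : ∀ t ≤ T, |π t| ≤ c₂ * (C + ω * δ + B) * δ := by
    intro t ht
    have := intervalIntegral.norm_integral_le_of_norm_le_const (a := 0) (b := 1)
      (C := c₂ * (C + ω * δ + B) * δ)
      (f := fun x => c₂ * (S t x - ω * prim w₁ t x - w₁ t x) * prim w₂ t x) (by
      intro x hx
      rw [uIoc_of_le zero_le_one] at hx
      have hx' := Ioc_subset_Icc_self hx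
      rw [Real.norm_eq_abs, abs_mul, abs_mul, abs_of_pos hc₂]
      have h3 := h₁.abs_flux_le hω hδ₁ ht hx'
      exact mul_le_mul (mul_le_mul_of_nonneg_left h3 hc₂.le) (hδ₂ t ht x hx')
        (abs_nonneg _) (mul_nonneg hc₂.le ((abs_nonneg _).trans h3)))
    simpa using this
  have h0 : ∀ t ≤ 0, π t = 0 := by
    intro t ht
    simp [hπ, prim_of_nonpos h₂.zero ht]
  have hπs := integral_sub_shift_le hT hh hm hP h0
  have c1 := h₁.sep.continuous_prim
  have c2 := h₂.sep.continuous_prim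
  have hAc : Continuous A := by
    change Continuous fun t => c₁ * c₂ * ((Function.uncurry (prim w₁) (t, 1) - Function.uncurry (prim w₁) (t - h, 1)) * Function.uncurry (prim w₂) (t, 1) -
    (Function.uncurry (prim w₁) (t, 0) - Function.uncurry (prim w₁) (t - h, 0)) * Function.uncurry (prim w₂) (t, 0))
    fun_prop
  have hAb : |∫ t in (0:ℝ)..T, A t| ≤ 2 * c₁ * c₂ * B * δ * h * T := by
    have := intervalIntegral.norm_integral_le_of_norm_le_const (a := 0) (b := T)
      (C := 2 * c₁ * c₂ * B * δ * h) (f := A) (by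
      intro t ht
      rw [uIoc_of_le hT] at ht
      have e : ∀ x ∈ Icc (0:ℝ) 1, |(prim w₁ t x - prim w₁ (t - h) x) * prim w₂ t x| ≤ B * h * δ := by
        intro x hx
        rw [abs_mul]
        have := h₁.sep.abs_prim_sub_le (t - h) t x
        rw [show t - (t - h) = h by ring, abs_of_pos hh] at this
        exact mul_le_mul this (hδ₂ t ht.2 x hx) (abs_nonneg _) (by positivity)
      rw [Real.norm_eq_abs, hA, abs_mul, abs_mul, abs_of_pos hc₁, abs_of_pos hc₂]
      have := (abs_sub _ _).trans (add_le_add (e 1 (right_mem_Icc.2 zero_le_one)) (e 0 (left_mem_Icc.2 zero_le_one)))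
      calc _ ≤ c₁ * c₂ * (B * h * δ + B * h * δ) := mul_le_mul_of_nonneg_left this (by positivity)
        _ = _ := by ring)
    simpa [abs_of_nonneg hT] using this
  have hkey : (∫ t in (0:ℝ)..T, ∫ x in (0:ℝ)..1,
      (c₁ * (prim w₁ t x - prim w₁ (t - h) x) * (S t x - ω * prim w₂ t x - w₂ t x)
      - c₂ * (S (t - h) x - ω * prim w₁ (t - h) x - w₁ (t - h) x) * (prim w₂ t x - prim w₂ (t - h) x))) =
      (∫ t in (0:ℝ)..T, A t) - ∫ t in (0:ℝ)..T, (π t - π (t - h)) := by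
    rw [← intervalIntegral.integral_sub (hAc.intervalIntegrable _ _)]
    · refine intervalIntegral.integral_congr fun t ht => ?_
      rw [uIcc_of_le hT] at ht
      exact h₁.jacobian h₂ hc₁ hc₂ ht.2 (by linarith [ht.2])
    · refine (intervalIntegrable_const (c := c₂ * (C + ω * δ + B) * δ + c₂ * (C + ω * δ + B) * δ)).mono_fun
        (hm.sub (hm.comp (measurable_id.sub_const h))).aestronglyMeasurable ?_
      refine (ae_restrict_iff' measurableSet_uIoc).2 (Eventually.of_forall fun t ht => ?_)
      rw [uIoc_of_le hT] at ht
      exact ((abs_sub _ _).trans (add_le_add (hP t ht.2) (hP (t - h) (by linarith [ht.2])))).trans (le_abs_self _)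
  rw [hkey]
  refine (abs_sub _ _).trans ((add_le_add hAb hπs).trans (le_of_eq ?_))
  ring

end

section
variable {T ω B C c₁ c₂ δ : ℝ} {S w₁ w₂ : ℝ → ℝ → ℝ}

theorem SepCont.tendsto_diff {w : ℝ → ℝ → ℝ} (h : SepCont B w) (t x : ℝ) :
    Tendsto (fun n : ℕ => (prim w t x - prim w (t - 1 / ((n:ℝ) + 1)) x) / (1 / ((n:ℝ) + 1))) atTop (𝓝 (w t x)) := by
  have h1 := (h.hasDerivAt_prim t x).tendsto_slope
  have h2 : Tendsto (fun n : ℕ => t - 1 / ((n:ℝ) + 1)) atTop (𝓝[≠] t) := by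
    refine tendsto_nhdsWithin_iff.2 ⟨?_, Eventually.of_forall fun n => ?_⟩
    · have := (tendsto_const_nhds (x := t)).sub (tendsto_one_div_add_atTop_nhds_zero_nat (𝕜 := ℝ))
      simpa using this
    · have : (0:ℝ) < 1 / ((n:ℝ) + 1) := by positivity
      simp only [mem_compl_iff, mem_singleton_iff]
      linarith
  refine (h1.comp h2).congr fun n => ?_
  have : (0:ℝ) < 1 / ((n:ℝ) + 1) := by positivity
  simp only [Function.comp, slope_def_field]
  rw [← neg_div_neg_eq]
  congr 1 <;> ring

theorem Tr.jacobian_bound (h₁ : Tr T c₁ ω B C S w₁) (h₂ : Tr T c₂ ω B C S w₂) (hT : 0 ≤ T)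
    (hω : 0 ≤ ω) (hc₁ : 0 < c₁) (hc₂ : 0 < c₂)
    (hδ₁ : ∀ t ≤ T, ∀ x ∈ Icc (0:ℝ) 1, |prim w₁ t x| ≤ δ)
    (hδ₂ : ∀ t ≤ T, ∀ x ∈ Icc (0:ℝ) 1, |prim w₂ t x| ≤ δ) :
    |∫ p, (c₁ * w₁ p.1 p.2 * (S p.1 p.2 - ω * prim w₂ p.1 p.2 - w₂ p.1 p.2)
      - c₂ * (S p.1 p.2 - ω * prim w₁ p.1 p.2 - w₁ p.1 p.2) * w₂ p.1 p.2) ∂txMeasure T| ≤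
    2 * c₁ * c₂ * B * δ * T + c₂ * (C + ω * δ + B) * δ := by
  set F : ℕ → ℝ × ℝ → ℝ := fun n p =>
    c₁ * ((prim w₁ p.1 p.2 - prim w₁ (p.1 - 1 / ((n:ℝ) + 1)) p.2) / (1 / ((n:ℝ) + 1))) *
      (S p.1 p.2 - ω * prim w₂ p.1 p.2 - w₂ p.1 p.2)
    - c₂ * (S (p.1 - 1 / ((n:ℝ) + 1)) p.2 - ω * prim w₁ (p.1 - 1 / ((n:ℝ) + 1)) p.2 - w₁ (p.1 - 1 / ((n:ℝ) + 1)) p.2) *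
      ((prim w₂ p.1 p.2 - prim w₂ (p.1 - 1 / ((n:ℝ) + 1)) p.2) / (1 / ((n:ℝ) + 1))) with hF
  have hB := h₁.sep.nonneg
  have hn : ∀ n : ℕ, (0:ℝ) < 1 / ((n:ℝ) + 1) := fun n => by positivity
  have hq : ∀ {w : ℝ → ℝ → ℝ}, SepCont B w → ∀ (n : ℕ) t x,
      |(prim w t x - prim w (t - 1 / ((n:ℝ) + 1)) x) / (1 / ((n:ℝ) + 1))| ≤ B := by
    intro w hw n t x
    rw [abs_div, div_le_iff₀ (by rw [abs_of_pos (hn n)]; exact hn n)]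
    refine (hw.abs_prim_sub_le (t - 1 / ((n:ℝ) + 1)) t x).trans (le_of_eq ?_)
    rw [sub_sub_cancel]
  have hshift : ∀ n : ℕ, Measurable fun p : ℝ × ℝ => (p.1 - 1 / ((n:ℝ) + 1), p.2) := fun n => by fun_prop
  have hFm : ∀ n, Measurable (F n) := fun n =>
    ((((h₁.sep.measurable_prim.sub (h₁.sep.measurable_prim.comp (hshift n))).div_const _).const_mul c₁).mul
      h₂.measurable_flux).sub (((h₁.measurable_flux.comp (hshift n)).const_mul c₂).mul
      ((h₂.sep.measurable_prim.sub (h₂.sep.measurable_prim.comp (hshift n))).div_const _))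
  set K := c₁ * B * (C + ω * δ + B) + c₂ * (C + ω * δ + B) * B
  have hFb : ∀ n, ∀ p ∈ Ioc 0 T ×ˢ Ioc (0:ℝ) 1, |F n p| ≤ K := by
    intro n p hp
    have hx := Ioc_subset_Icc_self hp.2
    have e1 := h₂.abs_flux_le hω hδ₂ hp.1.2 hx
    have e2 := h₁.abs_flux_le hω hδ₁ (t := p.1 - 1 / ((n:ℝ) + 1)) (by linarith [hp.1.2, hn n]) hx
    refine (abs_sub _ _).trans (add_le_add ?_ ?_)
    · rw [abs_mul, abs_mul, abs_of_pos hc₁]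
      exact mul_le_mul (mul_le_mul_of_nonneg_left (hq h₁.sep _ _ _) hc₁.le) e1 (abs_nonneg _) (by positivity)
    · rw [abs_mul, abs_mul, abs_of_pos hc₂]
      exact mul_le_mul (mul_le_mul_of_nonneg_left e2 hc₂.le) (hq h₂.sep _ _ _) (abs_nonneg _)
        (mul_nonneg hc₂.le ((abs_nonneg _).trans e2))
  have hlim : Tendsto (fun n => ∫ p, F n p ∂txMeasure T) atTop (𝓝 (∫ p,
      (c₁ * w₁ p.1 p.2 * (S p.1 p.2 - ω * prim w₂ p.1 p.2 - w₂ p.1 p.2)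
      - c₂ * (S p.1 p.2 - ω * prim w₁ p.1 p.2 - w₁ p.1 p.2) * w₂ p.1 p.2) ∂txMeasure T)) := by
    refine tendsto_integral_of_dominated_convergence (fun _ => K) (fun n => (hFm n).aestronglyMeasurable)
      (integrable_const K) (fun n => (ae_txMeasure T).mono fun p hp => hFb n p hp)
      (Eventually.of_forall fun p => ?_)
    have hs : Tendsto (fun n : ℕ => p.1 - 1 / ((n:ℝ) + 1)) atTop (𝓝 p.1) := by
      have := (tendsto_const_nhds (x := p.1)).sub (tendsto_one_div_add_atTop_nhds_zero_nat (𝕜 := ℝ))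
      simpa using this
    have hcq : Continuous fun t => S t p.2 - ω * prim w₁ t p.2 - w₁ t p.2 := by
      have a1 := h₁.src.left p.2
      have a2 := h₁.sep.left p.2
      have a3 : Continuous fun t => prim w₁ t p.2 :=
        continuous_iff_continuousAt.2 fun t => (h₁.sep.hasDerivAt_prim t p.2).continuousAt
      fun_prop
    exact (((h₁.sep.tendsto_diff p.1 p.2).const_mul c₁).mul_const _).sub
      ((((hcq.tendsto p.1).comp hs).const_mul c₂).mul (h₂.sep.tendsto_diff p.1 p.2))
  refine le_of_tendsto hlim.abs (Eventually.of_forall fun n => ?_)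
  have e := h₁.jacobian_diff_bound h₂ hT hω hc₁ hc₂ hδ₁ hδ₂ (hn n)
  have e2 : (∫ p, F n p ∂txMeasure T) = (∫ t in (0:ℝ)..T, ∫ x in (0:ℝ)..1,
      (c₁ * (prim w₁ t x - prim w₁ (t - 1 / ((n:ℝ) + 1)) x) * (S t x - ω * prim w₂ t x - w₂ t x)
      - c₂ * (S (t - 1 / ((n:ℝ) + 1)) x - ω * prim w₁ (t - 1 / ((n:ℝ) + 1)) x - w₁ (t - 1 / ((n:ℝ) + 1)) x) *
        (prim w₂ t x - prim w₂ (t - 1 / ((n:ℝ) + 1)) x))) / (1 / ((n:ℝ) + 1)) := by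
    rw [txMeasure, integral_prod _ (integrable_tx (hFm n) (hFb n)), ← intervalIntegral.integral_of_le hT,
      ← intervalIntegral.integral_div]
    refine intervalIntegral.integral_congr fun t _ => ?_
    rw [← intervalIntegral.integral_of_le zero_le_one, ← intervalIntegral.integral_div]
    refine intervalIntegral.integral_congr fun x _ => ?_
    simp only [hF]
    ring
  rw [e2, abs_div, abs_of_pos (hn n), div_le_iff₀ (hn n)]
  exact e

/-- Two solutions with the same source and damping but different speeds are almost orthogonal. -/
theorem Tr.abs_integral_mul_le (h₁ : Tr T c₁ ω B C S w₁) (h₂ : Tr T c₂ ω B C S w₂) (hT : 0 ≤ T)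
    (hω : 0 ≤ ω) (hc₁ : 0 < c₁) (hc₂ : 0 < c₂)
    (hδ₁ : ∀ t ≤ T, ∀ x ∈ Icc (0:ℝ) 1, |prim w₁ t x| ≤ δ)
    (hδ₂ : ∀ t ≤ T, ∀ x ∈ Icc (0:ℝ) 1, |prim w₂ t x| ≤ δ) :
    |c₁ - c₂| * |∫ p, w₁ p.1 p.2 * w₂ p.1 p.2 ∂txMeasure T| ≤
    2 * c₁ * c₂ * B * δ * T + c₂ * (C + ω * δ + B) * δ + (c₁ + c₂) * B * (C + ω * δ) * T := by
  have hB := h₁.sep.nonneg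
  have hSW : ∀ {c : ℝ} {w : ℝ → ℝ → ℝ}, (∀ t ≤ T, ∀ x ∈ Icc (0:ℝ) 1, |prim w t x| ≤ δ) →
      ∀ p ∈ Ioc 0 T ×ˢ Ioc (0:ℝ) 1, |S p.1 p.2 - ω * prim w p.1 p.2| ≤ C + ω * δ := by
    intro c w hw p hp
    refine (abs_sub _ _).trans (add_le_add (h₁.src.bound _ _) ?_)
    rw [abs_mul, abs_of_nonneg hω]
    exact mul_le_mul_of_nonneg_left (hw _ hp.1.2 _ (Ioc_subset_Icc_self hp.2)) hω
  have hδ : 0 ≤ δ := (abs_nonneg _).trans (hδ₁ 0 hT 0 (left_mem_Icc.2 zero_le_one))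
  have hC := h₁.src.nonneg
  have hr : ∀ p ∈ Ioc 0 T ×ˢ Ioc (0:ℝ) 1, |c₁ * w₁ p.1 p.2 * (S p.1 p.2 - ω * prim w₂ p.1 p.2)
      - c₂ * w₂ p.1 p.2 * (S p.1 p.2 - ω * prim w₁ p.1 p.2)| ≤ (c₁ + c₂) * B * (C + ω * δ) := by
    intro p hp
    refine (abs_sub _ _).trans ?_
    rw [add_mul, add_mul, abs_mul, abs_mul, abs_mul, abs_mul, abs_of_pos hc₁, abs_of_pos hc₂]
    refine add_le_add ?_ ?_
    · exact mul_le_mul (mul_le_mul_of_nonneg_left (h₁.sep.bound _ _) hc₁.le) (hSW (c := c₂) hδ₂ p hp) (abs_nonneg _) (by positivity)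
    · exact mul_le_mul (mul_le_mul_of_nonneg_left (h₂.sep.bound _ _) hc₂.le) (hSW (c := c₁) hδ₁ p hp) (abs_nonneg _) (by positivity)
  have hrm : Measurable fun p : ℝ × ℝ => c₁ * w₁ p.1 p.2 * (S p.1 p.2 - ω * prim w₂ p.1 p.2)
      - c₂ * w₂ p.1 p.2 * (S p.1 p.2 - ω * prim w₁ p.1 p.2) :=
    ((h₁.sep.measurable.const_mul c₁).mul (h₁.src.measurable.sub (h₂.sep.measurable_prim.const_mul ω))).sub
      ((h₂.sep.measurable.const_mul c₂).mul (h₁.src.measurable.sub (h₁.sep.measurable_prim.const_mul ω)))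
  have hwm : Measurable fun p : ℝ × ℝ => w₁ p.1 p.2 * w₂ p.1 p.2 := h₁.sep.measurable.mul h₂.sep.measurable
  have hwi : Integrable (fun p : ℝ × ℝ => w₁ p.1 p.2 * w₂ p.1 p.2) (txMeasure T) :=
    integrable_tx (K := B * B) hwm fun p _ => by
      rw [abs_mul]; exact mul_le_mul (h₁.sep.bound _ _) (h₂.sep.bound _ _) (abs_nonneg _) hB
  have hJ := h₁.jacobian_bound h₂ hT hω hc₁ hc₂ hδ₁ hδ₂
  have hR := abs_integral_tx_le hT hr
  have e : (∫ p, (c₁ * w₁ p.1 p.2 * (S p.1 p.2 - ω * prim w₂ p.1 p.2 - w₂ p.1 p.2)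
      - c₂ * (S p.1 p.2 - ω * prim w₁ p.1 p.2 - w₁ p.1 p.2) * w₂ p.1 p.2) ∂txMeasure T) =
      (c₂ - c₁) * (∫ p, w₁ p.1 p.2 * w₂ p.1 p.2 ∂txMeasure T) +
      ∫ p, (c₁ * w₁ p.1 p.2 * (S p.1 p.2 - ω * prim w₂ p.1 p.2)
      - c₂ * w₂ p.1 p.2 * (S p.1 p.2 - ω * prim w₁ p.1 p.2)) ∂txMeasure T := by
    rw [← integral_const_mul, ← integral_add (hwi.const_mul _) (integrable_tx hrm hr)]
    refine integral_congr_ae (Eventually.of_forall fun p => ?_)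
    simp only
    ring
  rw [abs_sub_comm, ← abs_mul]
  have e3 := abs_sub (∫ p, (c₁ * w₁ p.1 p.2 * (S p.1 p.2 - ω * prim w₂ p.1 p.2 - w₂ p.1 p.2)
      - c₂ * (S p.1 p.2 - ω * prim w₁ p.1 p.2 - w₁ p.1 p.2) * w₂ p.1 p.2) ∂txMeasure T)
      (∫ p, (c₁ * w₁ p.1 p.2 * (S p.1 p.2 - ω * prim w₂ p.1 p.2)
      - c₂ * w₂ p.1 p.2 * (S p.1 p.2 - ω * prim w₁ p.1 p.2)) ∂txMeasure T)
  rw [show (c₂ - c₁) * (∫ p, w₁ p.1 p.2 * w₂ p.1 p.2 ∂txMeasure T) = _ from (eq_sub_of_add_eq e.symm)]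
  linarith

end

section
variable {α : Type*} [MeasurableSpace α]

theorem measurable_of_continuous_of_dense {h : ℝ → α → ℝ} (hc : ∀ a, Continuous fun t => h t a)
    (hm : ∀ q : ℚ, Measurable (h q)) (t : ℝ) : Measurable (h t) := by
  have hd : t ∈ closure (range ((↑) : ℚ → ℝ)) := Rat.denseRange_cast t
  obtain ⟨s, hs, hlim⟩ := mem_closure_iff_seq_limit.1 hd
  refine measurable_of_tendsto_metrizable (f := fun n a => h (s n) a) (fun n => ?_)
    (tendsto_pi_nhds.2 fun a => ((hc a).tendsto t).comp hlim)
  obtain ⟨q, hq⟩ := hs n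
  exact hq ▸ hm q

theorem measurable_of_separately_continuous {h : ℝ → ℝ → α → ℝ}
    (ht : ∀ x a, Continuous fun t => h t x a) (hx : ∀ t a, Continuous fun x => h t x a)
    (hm : ∀ q r : ℚ, Measurable (h q r)) :
    Measurable fun p : ℝ × ℝ × α => h p.1 p.2.1 p.2.2 := by
  have h1 : ∀ (t : ℝ) (r : ℚ), Measurable (h t r) := fun t r =>
    measurable_of_continuous_of_dense (h := fun t => h t r) (ht _) (fun q => hm q r) t
  have h2 : ∀ t x, Measurable (h t x) := fun t x =>
    measurable_of_continuous_of_dense (hx t) (h1 t) x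
  have h3 : ∀ t, Measurable fun p : ℝ × α => h t p.1 p.2 := fun t =>
    measurable_uncurry_of_continuous_of_measurable (u := h t) (fun a => hx t a) (h2 t)
  exact measurable_uncurry_of_continuous_of_measurable (u := fun t (p : ℝ × α) => h t p.1 p.2)
    (fun p => ht p.1 p.2) h3

/-- A Carathéodory function is, off a null set of parameters, jointly measurable. -/
theorem exists_measurable_of_separately_continuous {h : ℝ → ℝ → α → ℝ} {ν : Measure α}
    (ht : ∀ᵐ a ∂ν, ∀ x, Continuous fun t => h t x a) (hx : ∀ᵐ a ∂ν, ∀ t, Continuous fun x => h t x a)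
    (hm : ∀ t x, AEStronglyMeasurable (h t x) ν) :
    ∃ h' : ℝ × ℝ × α → ℝ, Measurable h' ∧ (∀ t x a, |h' (t, x, a)| ≤ |h t x a|) ∧
      ∀ᵐ a ∂ν, ∀ t x, h' (t, x, a) = h t x a := by
  have hae : ∀ᵐ a ∂ν, (∀ x, Continuous fun t => h t x a) ∧ (∀ t, Continuous fun x => h t x a) ∧
      ∀ q r : ℚ, h q r a = (hm q r).mk _ a := by
    filter_upwards [ht, hx, ae_all_iff.2 fun q : ℚ => ae_all_iff.2 fun r : ℚ => (hm q r).ae_eq_mk]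
      with a h1 h2 h3 using ⟨h1, h2, h3⟩
  set Z := toMeasurable ν {a | ¬((∀ x, Continuous fun t => h t x a) ∧ (∀ t, Continuous fun x => h t x a) ∧
      ∀ q r : ℚ, h q r a = (hm q r).mk _ a)} with hZ
  have hZm : MeasurableSet Z := measurableSet_toMeasurable _ _
  have hZν : ν Z = 0 := by rw [hZ, measure_toMeasurable]; exact hae
  have hZP : ∀ a ∉ Z, (∀ x, Continuous fun t => h t x a) ∧ (∀ t, Continuous fun x => h t x a) ∧
      ∀ q r : ℚ, h q r a = (hm q r).mk _ a := by
    intro a ha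
    by_contra hn
    exact ha (subset_toMeasurable _ _ hn)
  set h' : ℝ → ℝ → α → ℝ := fun t x => Zᶜ.indicator (h t x) with hh'
  refine ⟨fun p => h' p.1 p.2.1 p.2.2, measurable_of_separately_continuous (fun x a => ?_) (fun t a => ?_)
    (fun q r => ?_), fun t x a => ?_, ?_⟩
  · by_cases ha : a ∈ Z
    · simp [hh', ha, continuous_const]
    · simpa [hh', ha] using (hZP a ha).1 x
  · by_cases ha : a ∈ Z
    · simp [hh', ha, continuous_const]
    · simpa [hh', ha] using (hZP a ha).2.1 t
  · have : h' q r = Zᶜ.indicator ((hm q r).mk _) := by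
      ext a
      by_cases ha : a ∈ Z
      · simp [hh', ha]
      · simp only [hh', indicator_of_mem (show a ∈ Zᶜ from ha)]
        exact (hZP a ha).2.2 q r
    rw [this]
    exact (hm q r).stronglyMeasurable_mk.measurable.indicator hZm.compl
  · by_cases ha : a ∈ Z <;> simp [hh', ha]
  · have : ∀ᵐ a ∂ν, a ∉ Z := by rwa [ae_iff, show {a | ¬a ∉ Z} = Z by ext; simp]
    filter_upwards [this] with a ha t x
    simp [hh', ha]

end

theorem integral_strip_le {G : ℝ → ℝ} {r L m : ℝ} (hL : 0 ≤ L) (hr : 0 < r) (hGL : ∀ m', |G m'| ≤ L)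
    (hG : ∀ᵐ m' ∂volume.restrict (Ioc (0:ℝ) 1), |m - m'| * |G m'| ≤ r ^ 4) :
    |∫ m' in Ioc (0:ℝ) 1, G m'| ≤ (2 * L + 1) * r ^ 2 := by
  set J := Ioo (m - r ^ 2) (m + r ^ 2) with hJ
  have hi1 : Integrable (fun _ : ℝ => r ^ 2) (volume.restrict (Ioc (0:ℝ) 1)) := integrable_const _
  have hi2 : Integrable (J.indicator fun _ : ℝ => L) (volume.restrict (Ioc (0:ℝ) 1)) :=
    (integrable_const L).indicator measurableSet_Ioo
  have h1 := norm_integral_le_of_norm_le (μ := volume.restrict (Ioc (0:ℝ) 1)) (f := G)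
    (hi1.add hi2) (by
      filter_upwards [hG] with m' hm'
      simp only [Pi.add_apply, Real.norm_eq_abs]
      by_cases h : m' ∈ J
      · rw [indicator_of_mem h]
        linarith [hGL m', sq_nonneg r]
      · rw [indicator_of_notMem h, add_zero]
        have h2 : r ^ 2 ≤ |m - m'| := by
          by_contra hlt
          push Not at hlt
          rw [abs_lt] at hlt
          exact h ⟨by linarith [hlt.2], by linarith [hlt.1]⟩
        have h3 : r ^ 2 * |G m'| ≤ r ^ 2 * r ^ 2 :=
          (mul_le_mul_of_nonneg_right h2 (abs_nonneg _)).trans (hm'.trans (le_of_eq (by ring)))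
        exact le_of_mul_le_mul_left h3 (by positivity))
  rw [Real.norm_eq_abs] at h1
  refine h1.trans ?_
  have h4 : ∫ m' in Ioc (0:ℝ) 1, ((fun _ : ℝ => r ^ 2) + J.indicator fun _ : ℝ => L) m' =
      r ^ 2 + (volume.restrict (Ioc (0:ℝ) 1)).real J * L := by
    rw [integral_add' hi1 hi2, integral_indicator_const _ measurableSet_Ioo]
    simp [hJ]
  rw [h4]
  have h5 : (volume.restrict (Ioc (0:ℝ) 1)).real J ≤ 2 * r ^ 2 := by
    have : (volume.restrict (Ioc (0:ℝ) 1)).real J ≤ (volume : Measure ℝ).real J := by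
      refine ENNReal.toReal_mono (by simp [hJ]) (Measure.restrict_apply_le _ _)
    refine this.trans (le_of_eq ?_)
    rw [hJ, Real.volume_real_Ioo_of_le (by nlinarith)]
    ring
  nlinarith

theorem average_bound {T : ℝ} (hT : 0 ≤ T) {v : ℝ × ℝ × ℝ → ℝ} (hv : Measurable v) {K r : ℝ}
    (hK : ∀ q, |v q| ≤ K) (hr : 0 < r)
    (h : ∀ᵐ m ∂volume.restrict (Ioc (0:ℝ) 1), ∀ᵐ m' ∂volume.restrict (Ioc (0:ℝ) 1),
      |m - m'| * |∫ p, v (m, p) * v (m', p) ∂txMeasure T| ≤ r ^ 4) :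
    ∫ p, |∫ m in Ioc (0:ℝ) 1, v (m, p)| ∂txMeasure T ≤ (T + 2 * (K * K * T) + 1) * r := by
  set ν := volume.restrict (Ioc (0:ℝ) 1) with hν
  have hK0 : 0 ≤ K := (abs_nonneg _).trans (hK (0, 0, 0))
  set L := K * K * T with hL
  have hL0 : 0 ≤ L := by positivity
  set a : ℝ × ℝ → ℝ := fun p => ∫ m, v (m, p) ∂ν with ha
  have ham : Measurable a :=
    (StronglyMeasurable.integral_prod_left (f := fun m p => v (m, p)) (μ := ν) hv.stronglyMeasurable).measurable
  have hab : ∀ p, |a p| ≤ K := fun p => by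
    have := norm_integral_le_of_norm_le_const (μ := ν) (f := fun m => v (m, p)) (C := K)
      (Eventually.of_forall fun m => hK _)
    simpa [hν] using this
  have hG : ∀ m m', |∫ p, v (m, p) * v (m', p) ∂txMeasure T| ≤ L := fun m m' =>
    abs_integral_tx_le hT fun p _ => by
      rw [abs_mul]; exact mul_le_mul (hK _) (hK _) (abs_nonneg _) hK0
  have s1 : ∫ p, a p * a p ∂txMeasure T = ∫ m, ∫ p, v (m, p) * a p ∂txMeasure T ∂ν := by
    rw [integral_integral_swap]
    · refine integral_congr_ae (Eventually.of_forall fun p => ?_)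
      simp only [ha, integral_mul_const]
    · refine Integrable.of_bound (hv.mul (ham.comp measurable_snd)).aestronglyMeasurable (K * K)
        (Eventually.of_forall fun q => ?_)
      rw [Real.norm_eq_abs, Function.uncurry, abs_mul]
      exact mul_le_mul (hK _) (hab _) (abs_nonneg _) hK0
  have s2 : ∀ m, ∫ p, v (m, p) * a p ∂txMeasure T = ∫ m', (∫ p, v (m, p) * v (m', p) ∂txMeasure T) ∂ν := by
    intro m
    rw [integral_integral_swap]
    · refine integral_congr_ae (Eventually.of_forall fun p => ?_)
      simp only [ha, integral_const_mul]
    · refine Integrable.of_bound ((hv.comp (measurable_const.prodMk measurable_snd)).mul hv).aestronglyMeasurable (K * K)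
        (Eventually.of_forall fun q => ?_)
      rw [Real.norm_eq_abs, Function.uncurry, abs_mul]
      exact mul_le_mul (hK _) (hK _) (abs_nonneg _) hK0
  have s3 : ∫ p, a p * a p ∂txMeasure T ≤ (2 * L + 1) * r ^ 2 := by
    rw [s1]
    have := norm_integral_le_of_norm_le_const (μ := ν) (f := fun m => ∫ p, v (m, p) * a p ∂txMeasure T)
      (C := (2 * L + 1) * r ^ 2) (by
        filter_upwards [h] with m hm
        rw [s2, Real.norm_eq_abs]
        exact integral_strip_le hL0 hr (hG m) hm)
    have h2 : ν.real univ = 1 := by simp [hν]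
    rw [h2, mul_one] at this
    exact (le_abs_self _).trans this
  have hai : Integrable (fun p => a p * a p) (txMeasure T) :=
    integrable_tx (K := K * K) (ham.mul ham) fun p _ => by
      rw [abs_mul]; exact mul_le_mul (hab _) (hab _) (abs_nonneg _) hK0
  have hai' : Integrable (fun p => |a p|) (txMeasure T) :=
    integrable_tx (K := K) ham.abs fun p _ => by rw [abs_abs]; exact hab p
  have s4 : ∫ p, |a p| ∂txMeasure T ≤ ∫ p, (r / 2 + a p * a p / (2 * r)) ∂txMeasure T := by
    refine integral_mono hai' ((integrable_const _).add (hai.div_const _)) fun p => ?_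
    have : 0 ≤ (r - |a p|) ^ 2 / (2 * r) := by positivity
    have e : (r - |a p|) ^ 2 / (2 * r) = r / 2 + a p * a p / (2 * r) - |a p| := by
      rw [← abs_mul_abs_self (a p)]; field_simp; ring
    simp only
    linarith
  rw [integral_add (integrable_const _) (hai.div_const _), integral_div _ fun p => a p * a p, integral_const,
    txMeasure_real_univ hT] at s4
  refine s4.trans ?_
  have : (∫ p, a p * a p ∂txMeasure T) / (2 * r) ≤ (2 * L + 1) * r / 2 := by
    rw [div_le_iff₀ (by positivity)]
    nlinarith
  simp only [smul_eq_mul]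
  nlinarith [mul_nonneg hT hr.le, mul_nonneg hL0 hr.le]

/-- Solutions at a fixed frequency `ω`, with arguments `t x μ`, in time-integrated form. -/
structure FSol (T ω η B C : ℝ) (S : ℝ → ℝ → ℝ) (w : ℝ → ℝ → ℝ → ℝ) : Prop where
  T_pos : 0 < T
  freq_pos : 0 < ω
  coeff : η ∈ Icc (0:ℝ) 1
  bound : ∀ t x μ, |w t x μ| ≤ B
  right : ∀ μ ∈ Ioc (0:ℝ) 1, Tr T (μ * ω) ω B C S fun t x => w t x μ
  left : ∀ μ ∈ Ioc (0:ℝ) 1, Tr T (μ * ω) ω B C (fun t x => S t (1 - x)) fun t x => w t (1 - x) (-μ)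
  inflow : ∀ μ ∈ Ioc (0:ℝ) 1, ∀ t, 0 ≤ w t 0 μ
  refl : ∀ μ ∈ Ioc (0:ℝ) 1, ∀ t, η * w t 1 μ ≤ w t 1 (-μ)
  meas : ∀ t x, AEStronglyMeasurable (w t x) (volume.restrict (Icc (-1) 1))

/-- Right-moving part with the inflow removed. -/
noncomputable def fR (ω : ℝ) (w : ℝ → ℝ → ℝ → ℝ) (μ t x : ℝ) : ℝ :=
  w t x μ - freeTr (μ * ω) ω (fun s => w s 0 μ) t x

/-- Left-moving part with the excess inflow at the reflecting wall removed. -/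
noncomputable def fL (ω η : ℝ) (w : ℝ → ℝ → ℝ → ℝ) (μ t x : ℝ) : ℝ :=
  w t (1 - x) (-μ) - freeTr (μ * ω) ω (fun s => w s 1 (-μ) - η * fR ω w μ s 1) t x

namespace FSol

variable {T ω η B C : ℝ} {S : ℝ → ℝ → ℝ} {w : ℝ → ℝ → ℝ → ℝ}

theorem nonneg (h : FSol T ω η B C S w) : 0 ≤ B := (abs_nonneg _).trans (h.bound 0 0 0)

theorem speed_pos (h : FSol T ω η B C S w) {μ : ℝ} (hμ : μ ∈ Ioc (0:ℝ) 1) : 0 < μ * ω :=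
  mul_pos hμ.1 h.freq_pos

theorem tr_fR (h : FSol T ω η B C S w) {μ : ℝ} (hμ : μ ∈ Ioc (0:ℝ) 1) :
    Tr T (μ * ω) ω (B + B) C S (fR ω w μ) :=
  (h.right μ hμ).sub_freeTr (h.speed_pos hμ) h.freq_pos.le ((h.right μ hμ).sep.left 0)
    (fun _ => h.bound _ _ _) fun t ht => (h.right μ hμ).zero t ht 0

theorem fR_le (h : FSol T ω η B C S w) {μ : ℝ} (hμ : μ ∈ Ioc (0:ℝ) 1) (t x : ℝ) :
    fR ω w μ t x ≤ w t x μ :=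
  sub_le_self _ (freeTr_nonneg (h.inflow μ hμ) t x)

theorem fR_zero_right (t : ℝ) (μ : ℝ) : fR ω w μ t 0 = 0 := by simp [fR, freeTr_zero_right]

theorem excess_nonneg (h : FSol T ω η B C S w) {μ : ℝ} (hμ : μ ∈ Ioc (0:ℝ) 1) (t : ℝ) :
    0 ≤ w t 1 (-μ) - η * fR ω w μ t 1 := by
  have := mul_le_mul_of_nonneg_left (h.fR_le hμ t 1) h.coeff.1
  linarith [h.refl μ hμ t]

theorem continuous_excess (h : FSol T ω η B C S w) {μ : ℝ} (hμ : μ ∈ Ioc (0:ℝ) 1) :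
    Continuous fun t => w t 1 (-μ) - η * fR ω w μ t 1 := by
  have h1 := (h.left μ hμ).sep.left 0
  simp only [sub_zero] at h1
  exact h1.sub (continuous_const.mul ((h.tr_fR hμ).sep.left 1))

theorem abs_excess_le (h : FSol T ω η B C S w) {μ : ℝ} (hμ : μ ∈ Ioc (0:ℝ) 1) (t : ℝ) :
    |w t 1 (-μ) - η * fR ω w μ t 1| ≤ 3 * B := by
  refine (abs_sub _ _).trans ?_
  have h1 := (h.tr_fR hμ).sep.bound t 1
  have h2 : |η * fR ω w μ t 1| ≤ B + B := by
    rw [abs_mul, abs_of_nonneg h.coeff.1]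
    exact (mul_le_of_le_one_left (abs_nonneg _) h.coeff.2).trans h1
  linarith [h.bound t 1 (-μ)]

theorem tr_fL (h : FSol T ω η B C S w) {μ : ℝ} (hμ : μ ∈ Ioc (0:ℝ) 1) :
    Tr T (μ * ω) ω (4 * B) C (fun t x => S t (1 - x)) (fL ω η w μ) := by
  have := (h.left μ hμ).sub_freeTr (h.speed_pos hμ) h.freq_pos.le (h.continuous_excess hμ)
    (h.abs_excess_le hμ) fun t ht => by
      have h1 := (h.left μ hμ).zero t ht 0
      simp only [sub_zero] at h1
      rw [h1, (h.tr_fR hμ).zero t ht]; simp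
  rw [show B + 3 * B = 4 * B by ring] at this
  exact this

theorem fL_le (h : FSol T ω η B C S w) {μ : ℝ} (hμ : μ ∈ Ioc (0:ℝ) 1) (t x : ℝ) :
    fL ω η w μ t x ≤ w t (1 - x) (-μ) :=
  sub_le_self _ (freeTr_nonneg (h.excess_nonneg hμ) t x)

theorem fL_zero_right (t : ℝ) (μ : ℝ) : fL ω η w μ t 0 = η * fR ω w μ t 1 := by
  simp [fL, freeTr_zero_right]

theorem prim_fR_zero (t : ℝ) (μ : ℝ) : prim (fR ω w μ) t 0 = 0 := by
  simp [prim, fR_zero_right]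

theorem prim_fL_zero (t : ℝ) (μ : ℝ) : prim (fL ω η w μ) t 0 = η * prim (fR ω w μ) t 1 := by
  simp [prim, fL_zero_right]

theorem abs_prim_fR_le (h : FSol T ω η B C S w) {μ : ℝ} (hμ : μ ∈ Ioc (0:ℝ) 1) :
    ∀ t ∈ Icc 0 T, ∀ x ∈ Icc (0:ℝ) 1, |prim (fR ω w μ) t x| ≤ C * t :=
  (h.tr_fR hμ).abs_prim_le h.T_pos.le (h.speed_pos hμ) h.freq_pos
    (fun t _ x _ => (h.tr_fR hμ).src.bound t x) fun t ht => by
      rw [prim_fR_zero, abs_zero]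
      exact mul_nonneg (h.tr_fR hμ).src.nonneg ht.1

theorem abs_prim_fL_le (h : FSol T ω η B C S w) {μ : ℝ} (hμ : μ ∈ Ioc (0:ℝ) 1) :
    ∀ t ∈ Icc 0 T, ∀ x ∈ Icc (0:ℝ) 1, |prim (fL ω η w μ) t x| ≤ C * t :=
  (h.tr_fL hμ).abs_prim_le h.T_pos.le (h.speed_pos hμ) h.freq_pos
    (fun t _ x _ => (h.tr_fL hμ).src.bound t x) fun t ht => by
      rw [prim_fL_zero, abs_mul, abs_of_nonneg h.coeff.1]
      exact (mul_le_of_le_one_left (abs_nonneg _) h.coeff.2).trans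
        (h.abs_prim_fR_le hμ t ht 1 (right_mem_Icc.2 zero_le_one))

theorem abs_prim_le_of_tr {c B' : ℝ} {S' v : ℝ → ℝ → ℝ} (hT : 0 < T) (h : Tr T c ω B' C S' v)
    (hv : ∀ t ∈ Icc 0 T, ∀ x ∈ Icc (0:ℝ) 1, |prim v t x| ≤ C * t) :
    ∀ t ≤ T, ∀ x ∈ Icc (0:ℝ) 1, |prim v t x| ≤ C * T := by
  intro t ht x hx
  have hC := h.src.nonneg
  rcases le_total t 0 with h0 | h0
  · rw [prim_of_nonpos h.zero h0, abs_zero]; positivity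
  · exact (hv t ⟨h0, ht⟩ x hx).trans (mul_le_mul_of_nonneg_left ht hC)

section increments
variable {τ s : ℝ}

theorem increment_fR (h : FSol T ω η B C S w) {μ : ℝ} (hμ : μ ∈ Ioc (0:ℝ) 1) (hτ : 0 ≤ τ) (hs : 0 ≤ s)
    (hS : ∀ t ∈ Icc 0 T, ∀ x ∈ Icc (0:ℝ) 1, -s ≤ S t x - S (t - τ) x) :
    ∀ t ∈ Icc 0 T, ∀ x ∈ Icc (0:ℝ) 1, -(s / ω * (1 - Real.exp (-(ω * t)))) ≤
      prim (fR ω w μ) t x - prim (fR ω w μ) (t - τ) x := by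
  refine (h.tr_fR hμ).increment_ge h.T_pos.le (h.speed_pos hμ) h.freq_pos hτ hS fun t ht => ?_
  rw [prim_fR_zero, prim_fR_zero]
  have h1 : 0 ≤ 1 - Real.exp (-(ω * t)) := by
    rw [sub_nonneg, Real.exp_le_one_iff]; linarith [mul_nonneg h.freq_pos.le ht.1]
  have := mul_nonneg (div_nonneg hs h.freq_pos.le) h1
  linarith

theorem increment_fL (h : FSol T ω η B C S w) {μ : ℝ} (hμ : μ ∈ Ioc (0:ℝ) 1) (hτ : 0 ≤ τ) (hs : 0 ≤ s)
    (hS : ∀ t ∈ Icc 0 T, ∀ x ∈ Icc (0:ℝ) 1, -s ≤ S t x - S (t - τ) x) :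
    ∀ t ∈ Icc 0 T, ∀ x ∈ Icc (0:ℝ) 1, -(s / ω * (1 - Real.exp (-(ω * t)))) ≤
      prim (fL ω η w μ) t x - prim (fL ω η w μ) (t - τ) x := by
  refine (h.tr_fL hμ).increment_ge h.T_pos.le (h.speed_pos hμ) h.freq_pos hτ
    (fun t ht x hx => hS t ht (1 - x) ⟨by linarith [hx.2], by linarith [hx.1]⟩) fun t ht => ?_
  rw [prim_fL_zero, prim_fL_zero, ← mul_sub]
  have h1 : 0 ≤ 1 - Real.exp (-(ω * t)) := by
    rw [sub_nonneg, Real.exp_le_one_iff]; linarith [mul_nonneg h.freq_pos.le ht.1]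
  have h2 := mul_nonneg (div_nonneg hs h.freq_pos.le) h1
  have h3 := h.increment_fR hμ hτ hs hS t ht 1 (right_mem_Icc.2 zero_le_one)
  have h4 := mul_le_mul_of_nonneg_left h3 h.coeff.1
  nlinarith [h.coeff.2, h.coeff.1]

theorem increment_right (h : FSol T ω η B C S w) {μ : ℝ} (hμ : μ ∈ Ioc (0:ℝ) 1) (hτ : 0 ≤ τ) (hs : 0 ≤ s)
    (hS : ∀ t ∈ Icc 0 T, ∀ x ∈ Icc (0:ℝ) 1, -s ≤ S t x - S (t - τ) x) :
    ∀ t ∈ Icc 0 T, ∀ x ∈ Icc (0:ℝ) 1, -(s / ω * (1 - Real.exp (-(ω * t)))) ≤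
      prim (fun t x => w t x μ) t x - prim (fun t x => w t x μ) (t - τ) x := by
  intro t ht x hx
  have h1 := h.increment_fR hμ hτ hs hS t ht x hx
  have hb := (h.right μ hμ).sep.left 0
  have h2 := prim_freeTr_mono (h.speed_pos hμ) hb (h.inflow μ hμ) (sub_le_self t hτ) x h.freq_pos.le
    (fun t => h.bound _ _ _)
  have hf := sepCont_freeTr (h.speed_pos hμ) h.freq_pos.le hb (fun t => h.bound _ _ _)
  have h3 : ∀ t, prim (fR ω w μ) t x = _ := fun t => prim_sub (h.right μ hμ).sep hf t x
  rw [h3, h3] at h1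
  linarith

theorem increment_left (h : FSol T ω η B C S w) {μ : ℝ} (hμ : μ ∈ Ioc (0:ℝ) 1) (hτ : 0 ≤ τ) (hs : 0 ≤ s)
    (hS : ∀ t ∈ Icc 0 T, ∀ x ∈ Icc (0:ℝ) 1, -s ≤ S t x - S (t - τ) x) :
    ∀ t ∈ Icc 0 T, ∀ x ∈ Icc (0:ℝ) 1, -(s / ω * (1 - Real.exp (-(ω * t)))) ≤
      prim (fun t x => w t x (-μ)) t x - prim (fun t x => w t x (-μ)) (t - τ) x := by
  intro t ht x hx
  have h1 := h.increment_fL hμ hτ hs hS t ht (1 - x) ⟨by linarith [hx.2], by linarith [hx.1]⟩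
  have hb := h.continuous_excess hμ
  have h2 := prim_freeTr_mono (h.speed_pos hμ) hb (h.excess_nonneg hμ) (sub_le_self t hτ) (1 - x) h.freq_pos.le
    (h.abs_excess_le hμ)
  have hf := sepCont_freeTr (h.speed_pos hμ) h.freq_pos.le hb (h.abs_excess_le hμ)
  have h3 : ∀ t, prim (fL ω η w μ) t (1 - x) = _ := fun t => prim_sub (h.left μ hμ).sep hf t (1 - x)
  have h4 : ∀ t, prim (fun t x => w t (1 - x) (-μ)) t (1 - x) = prim (fun t x => w t x (-μ)) t x := fun t => by
    simp [prim]
  rw [h3, h3, h4, h4] at h1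
  linarith

end increments

end FSol

theorem abs_freeTr_le {c ω B : ℝ} {b : ℝ → ℝ} (hc : 0 < c) (hω : 0 ≤ ω) (hb : ∀ t, |b t| ≤ B) (t x : ℝ) :
    |freeTr c ω b t x| ≤ B := by
  unfold freeTr
  rw [abs_mul, Real.abs_exp]
  have h1 : Real.exp (-(ω / c * max 0 (min x 1))) ≤ 1 := by
    rw [Real.exp_le_one_iff]
    have := mul_nonneg (div_nonneg hω hc.le) (le_max_left 0 (min x 1))
    linarith
  exact (mul_le_of_le_one_left (abs_nonneg _) h1).trans (hb _)

theorem integral_Icc_neg_one_one {f : ℝ → ℝ} (hf : IntegrableOn f (Icc (-1) 1)) :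
    ∫ μ in Icc (-1:ℝ) 1, f μ = (∫ μ in Ioc (0:ℝ) 1, f μ) + ∫ μ in Ioc (0:ℝ) 1, f (-μ) := by
  have h0 : IntervalIntegrable f volume (-1) 1 :=
    (intervalIntegrable_iff_integrableOn_Icc_of_le (by norm_num)).2 hf
  have hl : IntervalIntegrable f volume (-1) 0 := h0.mono_set (by
    rw [uIcc_of_le (by norm_num), uIcc_of_le (by norm_num)]; exact Icc_subset_Icc_right zero_le_one)
  have hr : IntervalIntegrable f volume 0 1 := h0.mono_set (by
    rw [uIcc_of_le (by norm_num), uIcc_of_le (by norm_num)]; exact Icc_subset_Icc_left (by norm_num))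
  rw [integral_Icc_eq_integral_Ioc, ← intervalIntegral.integral_of_le (by norm_num),
    ← intervalIntegral.integral_of_le zero_le_one, ← intervalIntegral.integral_of_le zero_le_one,
    intervalIntegral.integral_comp_neg, neg_zero, add_comm]
  exact (intervalIntegral.integral_add_adjacent_intervals hl hr).symm

theorem integral_tx_reflect (T : ℝ) {f : ℝ → ℝ → ℝ} {K : ℝ} (hf : Measurable fun p : ℝ × ℝ => f p.1 p.2)
    (hK : ∀ t x, |f t x| ≤ K) :
    ∫ p, f p.1 (1 - p.2) ∂txMeasure T = ∫ p, f p.1 p.2 ∂txMeasure T := by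
  have hf' : Measurable fun p : ℝ × ℝ => f p.1 (1 - p.2) :=
    hf.comp (measurable_fst.prodMk (measurable_const.sub measurable_snd))
  rw [integral_prod _ (integrable_tx hf' fun p _ => hK _ _), integral_prod _ (integrable_tx hf fun p _ => hK _ _)]
  refine integral_congr_ae (ae_of_all _ fun t => ?_)
  simp only
  rw [← intervalIntegral.integral_of_le zero_le_one, ← intervalIntegral.integral_of_le zero_le_one,
    intervalIntegral.integral_comp_sub_left (fun x => f t x)]
  simp

/-- A velocity average of solutions whose time primitives are small is small in `L¹`. -/
theorem average_of_tr {T ω B C r : ℝ} (hT : 0 < T) (hω : 0 < ω) {S : ℝ → ℝ → ℝ} {u : ℝ → ℝ → ℝ → ℝ}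
    {v : ℝ × ℝ × ℝ → ℝ} (hv : Measurable v) (hB : ∀ q, |v q| ≤ B)
    (hvu : ∀ᵐ m ∂volume.restrict (Ioc (0:ℝ) 1), ∀ p : ℝ × ℝ, v (m, p) = u m p.1 p.2)
    (hu : ∀ m ∈ Ioc (0:ℝ) 1, Tr T (m * ω) ω B C S (u m))
    (hp : ∀ m ∈ Ioc (0:ℝ) 1, ∀ t ≤ T, ∀ x ∈ Icc (0:ℝ) 1, |prim (u m) t x| ≤ C * T) (hr : 0 < r)
    (hκ : 2 * ω * B * (C * T) * T + (C + ω * (C * T) + B) * (C * T) + 2 * B * (C + ω * (C * T)) * T ≤ r ^ 4) :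
    ∫ p, |∫ m in Ioc (0:ℝ) 1, v (m, p)| ∂txMeasure T ≤ (T + 2 * (B * B * T) + 1) * r := by
  refine average_bound hT.le hv hB hr ?_
  filter_upwards [hvu, ae_restrict_mem measurableSet_Ioc] with m hm hm0
  filter_upwards [hvu, ae_restrict_mem measurableSet_Ioc] with m' hm' hm0'
  have h := (hu m hm0).abs_integral_mul_le (hu m' hm0') hT.le hω.le (mul_pos hm0.1 hω) (mul_pos hm0'.1 hω)
    (hp m hm0) (hp m' hm0')
  simp only [hm, hm']
  set I := |∫ p, u m p.1 p.2 * u m' p.1 p.2 ∂txMeasure T|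
  have hB0 : 0 ≤ B := (abs_nonneg _).trans (hB 0)
  have hC0 : 0 ≤ C := (hu m hm0).src.nonneg
  rw [← sub_mul, abs_mul, abs_of_pos hω] at h
  refine le_trans (le_of_mul_le_mul_left ?_ hω) hκ
  have e1 : 2 * (m * ω) * (m' * ω) * B * (C * T) * T ≤ 2 * ω * ω * B * (C * T) * T := by
    have : m * m' ≤ 1 := mul_le_one₀ hm0.2 hm0'.1.le hm0'.2
    have h2 : 0 ≤ 2 * ω * ω * B * (C * T) * T := by positivity
    nlinarith [mul_le_mul_of_nonneg_right this h2]
  have e2 : m' * ω * (C + ω * (C * T) + B) * (C * T) ≤ ω * (C + ω * (C * T) + B) * (C * T) := by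
    have h2 : 0 ≤ ω * (C + ω * (C * T) + B) * (C * T) := by positivity
    nlinarith [mul_le_mul_of_nonneg_right hm0'.2 h2]
  have e3 : (m * ω + m' * ω) * B * (C + ω * (C * T)) * T ≤ 2 * ω * B * (C + ω * (C * T)) * T := by
    have h2 : 0 ≤ ω * B * (C + ω * (C * T)) * T := by positivity
    nlinarith [mul_le_mul_of_nonneg_right hm0'.2 h2, mul_le_mul_of_nonneg_right hm0.2 h2]
  linarith

namespace FSol

variable {T ω η B C : ℝ} {S : ℝ → ℝ → ℝ} {w : ℝ → ℝ → ℝ → ℝ}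

theorem sep_left (h : FSol T ω η B C S w) {μ : ℝ} (hμ : μ ∈ Ioc (0:ℝ) 1) :
    SepCont B fun t x => w t x (-μ) := by
  have h1 := (h.left μ hμ).sep
  refine ⟨fun x => ?_, fun t => ?_, fun t x => h.bound _ _ _⟩
  · simpa using h1.left (1 - x)
  · have h2 : Continuous fun x => w t (1 - (1 - x)) (-μ) :=
      (h1.right t).comp (continuous_const.sub continuous_id : Continuous fun x : ℝ => 1 - x)
    simpa using h2

theorem ae_sep (h : FSol T ω η B C S w) :
    ∀ᵐ μ ∂volume.restrict (Icc (-1:ℝ) 1), SepCont B fun t x => w t x μ := by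
  filter_upwards [ae_restrict_mem measurableSet_Icc, ae_restrict_of_ae (Measure.ae_ne volume (0:ℝ))] with μ hμ h0
  rcases lt_or_gt_of_ne h0 with h1 | h1
  · simpa using h.sep_left (μ := -μ) ⟨by linarith, by linarith [hμ.1]⟩
  · exact (h.right μ ⟨h1, hμ.2⟩).sep

/-- Velocity average. -/
noncomputable def _root_.vavg (w : ℝ → ℝ → ℝ → ℝ) (t x : ℝ) : ℝ := ∫ μ in Icc (-1:ℝ) 1, w t x μ

theorem integrable_velocity (h : FSol T ω η B C S w) (t x : ℝ) : IntegrableOn (w t x) (Icc (-1) 1) :=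
  Integrable.of_bound (h.meas t x) B (ae_of_all _ fun μ => h.bound t x μ)

theorem sepCont_vavg (h : FSol T ω η B C S w) : SepCont (2 * B) (vavg w) := by
  refine ⟨fun x => ?_, fun t => ?_, fun t x => ?_⟩
  · exact continuous_of_dominated (fun t => h.meas t x) (fun t => ae_of_all _ fun μ => h.bound t x μ)
      (integrable_const B) (h.ae_sep.mono fun μ hμ => hμ.left x)
  · exact continuous_of_dominated (fun x => h.meas t x) (fun x => ae_of_all _ fun μ => h.bound t x μ)
      (integrable_const B) (h.ae_sep.mono fun μ hμ => hμ.right t)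
  · have := norm_integral_le_of_norm_le_const (μ := volume.restrict (Icc (-1:ℝ) 1)) (f := w t x) (C := B)
      (ae_of_all _ fun μ => h.bound t x μ)
    have h2 : (volume.restrict (Icc (-1:ℝ) 1)).real univ = 2 := by simp [measureReal_def]; norm_num
    rw [h2, mul_comm] at this
    exact this

theorem exists_measurable_velocity (h : FSol T ω η B C S w) :
    ∃ W : ℝ × ℝ × ℝ → ℝ, Measurable W ∧ (∀ q, |W q| ≤ B) ∧
      ∀ᵐ μ ∂volume.restrict (Icc (-1:ℝ) 1), ∀ t x, W (t, x, μ) = w t x μ := by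
  obtain ⟨W, h1, h2, h3⟩ := exists_measurable_of_separately_continuous (h := fun t x μ => w t x μ)
    (h.ae_sep.mono fun μ hμ => hμ.left) (h.ae_sep.mono fun μ hμ => hμ.right) h.meas
  exact ⟨W, h1, fun q => (h2 _ _ _).trans (h.bound _ _ _), h3⟩

theorem ae_velocity_pair {P : ℝ → Prop} (h : ∀ᵐ μ ∂volume.restrict (Icc (-1:ℝ) 1), P μ) :
    ∀ᵐ μ ∂volume.restrict (Ioc (0:ℝ) 1), P μ ∧ P (-μ) := by
  rw [ae_restrict_iff' measurableSet_Icc] at h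
  have h' := (Measure.measurePreserving_neg (volume : Measure ℝ)).quasiMeasurePreserving.ae h
  filter_upwards [ae_restrict_mem measurableSet_Ioc, ae_restrict_of_ae h, ae_restrict_of_ae h'] with μ hμ h1 h2
  exact ⟨h1 ⟨by linarith [hμ.1], hμ.2⟩, h2 ⟨by linarith [hμ.2], by linarith [hμ.1]⟩⟩

theorem integral_neg_part_vavg_le (h : FSol T ω η B C S w) {r : ℝ} (hr : 0 < r)
    (hκ : 2 * ω * (4 * B) * (C * T) * T + (C + ω * (C * T) + 4 * B) * (C * T)
      + 2 * (4 * B) * (C + ω * (C * T)) * T ≤ r ^ 4) :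
    ∫ p, max (-vavg w p.1 p.2) 0 ∂txMeasure T ≤ 2 * ((T + 2 * (4 * B * (4 * B) * T) + 1) * r) := by
  have hB := h.nonneg
  obtain ⟨W', hW, hWB, hWw⟩ := h.exists_measurable_velocity
  set W : ℝ → ℝ → ℝ → ℝ := fun t x μ => W' (t, x, μ) with hWd
  have hgood := ae_velocity_pair hWw
  set D : Set (ℝ × ℝ × ℝ) := Ioc (0:ℝ) 1 ×ˢ univ with hD
  have hDm : MeasurableSet D := measurableSet_Ioc.prod MeasurableSet.univ
  set vR : ℝ × ℝ × ℝ → ℝ := D.indicator fun q => fR ω W q.1 q.2.1 q.2.2 with hvR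
  set vL : ℝ × ℝ × ℝ → ℝ := D.indicator fun q => fL ω η W q.1 q.2.1 q.2.2 with hvL
  have mR : Measurable vR := by
    refine Measurable.indicator ?_ hDm
    unfold fR freeTr
    fun_prop
  have mL : Measurable vL := by
    refine Measurable.indicator ?_ hDm
    unfold fL fR freeTr
    fun_prop
  have bfR : ∀ m ∈ Ioc (0:ℝ) 1, ∀ t x, |fR ω W m t x| ≤ B + B := fun m hm t x =>
    (abs_sub _ _).trans (add_le_add (hWB _)
      (abs_freeTr_le (h.speed_pos hm) h.freq_pos.le (fun s => hWB _) t x))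
  have bR : ∀ q, |vR q| ≤ 4 * B := fun q => by
    by_cases hq : q ∈ D
    · rw [hvR, indicator_of_mem hq]
      linarith [bfR q.1 hq.1 q.2.1 q.2.2]
    · rw [hvR, indicator_of_notMem hq]; simpa using hB
  have bL : ∀ q, |vL q| ≤ 4 * B := fun q => by
    by_cases hq : q ∈ D
    · rw [hvL, indicator_of_mem hq]
      refine (abs_sub _ _).trans ?_
      have : ∀ s, |W s 1 (-q.1) - η * fR ω W q.1 s 1| ≤ 3 * B := fun s => by
        refine (abs_sub _ _).trans ?_
        have h2 : |η * fR ω W q.1 s 1| ≤ B + B := by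
          rw [abs_mul, abs_of_nonneg h.coeff.1]
          exact (mul_le_of_le_one_left (abs_nonneg _) h.coeff.2).trans (bfR q.1 hq.1 s 1)
        linarith [hWB (s, 1, -q.1)]
      have h3 := abs_freeTr_le (h.speed_pos hq.1) h.freq_pos.le this q.2.1 q.2.2
      have h4 := hWB (q.2.1, 1 - q.2.2, -q.1)
      linarith
    · rw [hvL, indicator_of_notMem hq]; simpa using hB
  have eR : ∀ᵐ m ∂volume.restrict (Ioc (0:ℝ) 1), ∀ p : ℝ × ℝ, vR (m, p) = fR ω w m p.1 p.2 := by
    filter_upwards [hgood, ae_restrict_mem measurableSet_Ioc] with m hm hm0 p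
    rw [hvR, indicator_of_mem (show (m, p) ∈ D from ⟨hm0, trivial⟩)]
    simp only [fR, hWd, hm.1]
  have eL : ∀ᵐ m ∂volume.restrict (Ioc (0:ℝ) 1), ∀ p : ℝ × ℝ, vL (m, p) = fL ω η w m p.1 p.2 := by
    filter_upwards [hgood, ae_restrict_mem measurableSet_Ioc] with m hm hm0 p
    rw [hvL, indicator_of_mem (show (m, p) ∈ D from ⟨hm0, trivial⟩)]
    simp only [fL, fR, hWd, hm.1, hm.2]
  have trR : ∀ m ∈ Ioc (0:ℝ) 1, Tr T (m * ω) ω (4 * B) C S (fR ω w m) := fun m hm =>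
    { h.tr_fR hm with sep := (h.tr_fR hm).sep.mono (by linarith) }
  have aR := average_of_tr h.T_pos h.freq_pos mR bR eR trR
    (fun m hm => abs_prim_le_of_tr h.T_pos (trR m hm) (h.abs_prim_fR_le hm)) hr hκ
  have aL := average_of_tr h.T_pos h.freq_pos mL bL eL (fun m hm => h.tr_fL hm)
    (fun m hm => abs_prim_le_of_tr h.T_pos (h.tr_fL hm) (h.abs_prim_fL_le hm)) hr hκ
  set aRf : ℝ → ℝ → ℝ := fun t x => |∫ m in Ioc (0:ℝ) 1, vR (m, t, x)|
  set aLf : ℝ → ℝ → ℝ := fun t x => |∫ m in Ioc (0:ℝ) 1, vL (m, t, x)|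
  have gm : ∀ {v : ℝ × ℝ × ℝ → ℝ}, Measurable v →
      Measurable fun p : ℝ × ℝ => |∫ m in Ioc (0:ℝ) 1, v (m, p)| := fun {v} hv =>
    (StronglyMeasurable.integral_prod_left (f := fun m p => v (m, p)) (μ := volume.restrict (Ioc (0:ℝ) 1))
      hv.stronglyMeasurable).measurable.abs
  have gb : ∀ {v : ℝ × ℝ × ℝ → ℝ}, (∀ q, |v q| ≤ 4 * B) → ∀ t x,
      |(|∫ m in Ioc (0:ℝ) 1, v (m, t, x)|)| ≤ 4 * B := fun {v} hv t x => by
    rw [abs_abs]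
    have := norm_integral_le_of_norm_le_const (μ := volume.restrict (Ioc (0:ℝ) 1))
      (f := fun m => v (m, t, x)) (C := 4 * B) (ae_of_all _ fun m => hv _)
    simpa [measureReal_def] using this
  have iv : ∀ {v : ℝ × ℝ × ℝ → ℝ}, Measurable v → (∀ q, |v q| ≤ 4 * B) → ∀ t x,
      IntegrableOn (fun m => v (m, t, x)) (Ioc (0:ℝ) 1) := fun {v} hv hb t x =>
    Integrable.of_bound (hv.comp (measurable_id.prodMk measurable_const)).aestronglyMeasurable (4 * B)
      (ae_of_all _ fun m => hb _)
  have mRf : Measurable fun p : ℝ × ℝ => aRf p.1 p.2 := gm mR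
  have mLf : Measurable fun p : ℝ × ℝ => aLf p.1 p.2 := gm mL
  have mLf' : Measurable fun p : ℝ × ℝ => aLf p.1 (1 - p.2) :=
    mLf.comp (measurable_fst.prodMk (measurable_const.sub measurable_snd))
  have key : ∀ t x, max (-vavg w t x) 0 ≤ aRf t x + aLf t (1 - x) := by
    intro t x
    refine max_le ?_ (add_nonneg (abs_nonneg _) (abs_nonneg _))
    have hi := h.integrable_velocity t x
    have hsplit : vavg w t x = _ := integral_Icc_neg_one_one hi
    have i1 : IntegrableOn (w t x) (Ioc 0 1) :=
      hi.mono_set (Ioc_subset_Icc_self.trans (Icc_subset_Icc_left (by norm_num)))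
    have i2 : IntegrableOn (fun m => w t x (-m)) (Ioc 0 1) := by
      have := hi.comp_neg
      refine this.mono_set fun m hm => ?_
      rw [Set.mem_neg]
      exact ⟨by linarith [hm.2], by linarith [hm.1]⟩
    have c1 : ∫ m in Ioc (0:ℝ) 1, vR (m, t, x) ≤ ∫ m in Ioc (0:ℝ) 1, w t x m := by
      refine integral_mono_ae (iv mR bR t x) i1 ?_
      filter_upwards [eR, ae_restrict_mem measurableSet_Ioc] with m hm hm0
      rw [hm]; exact h.fR_le hm0 t x
    have c2 : ∫ m in Ioc (0:ℝ) 1, vL (m, t, 1 - x) ≤ ∫ m in Ioc (0:ℝ) 1, w t x (-m) := by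
      refine integral_mono_ae (iv mL bL t (1 - x)) i2 ?_
      filter_upwards [eL, ae_restrict_mem measurableSet_Ioc] with m hm hm0
      rw [hm]; simpa using h.fL_le hm0 t (1 - x)
    have d1 : -aRf t x ≤ ∫ m in Ioc (0:ℝ) 1, vR (m, t, x) := neg_abs_le _
    have d2 : -aLf t (1 - x) ≤ ∫ m in Ioc (0:ℝ) 1, vL (m, t, 1 - x) := neg_abs_le _
    linarith
  have iR : Integrable (fun p : ℝ × ℝ => aRf p.1 p.2) (txMeasure T) := integrable_tx mRf fun p _ => gb bR _ _
  have iL : Integrable (fun p : ℝ × ℝ => aLf p.1 (1 - p.2)) (txMeasure T) :=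
    integrable_tx mLf' fun p _ => gb bL _ _
  calc ∫ p, max (-vavg w p.1 p.2) 0 ∂txMeasure T
      ≤ ∫ p, (aRf p.1 p.2 + aLf p.1 (1 - p.2)) ∂txMeasure T :=
        integral_mono_of_nonneg (ae_of_all _ fun p => le_max_right _ _) (iR.add iL)
          (ae_of_all _ fun p => key p.1 p.2)
    _ = (∫ p, aRf p.1 p.2 ∂txMeasure T) + ∫ p, aLf p.1 p.2 ∂txMeasure T := by
        rw [integral_add iR iL, integral_tx_reflect T mLf (fun t x => gb bL t x)]
    _ ≤ _ := by
        have aR' : ∫ p, aRf p.1 p.2 ∂txMeasure T ≤ _ := aR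
        have aL' : ∫ p, aLf p.1 p.2 ∂txMeasure T ≤ _ := aL
        linarith

theorem prim_vavg (h : FSol T ω η B C S w) (t x : ℝ) :
    prim (vavg w) t x = ∫ μ in Icc (-1:ℝ) 1, prim (fun t x => w t x μ) t x := by
  obtain ⟨W, hW, hWB, hWw⟩ := h.exists_measurable_velocity
  have e1 : ∀ s, vavg w s x = ∫ μ in Icc (-1:ℝ) 1, W (s, x, μ) := fun s =>
    integral_congr_ae (hWw.mono fun μ hμ => (hμ s x).symm)
  have e2 : ∫ μ in Icc (-1:ℝ) 1, prim (fun t x => w t x μ) t x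
      = ∫ μ in Icc (-1:ℝ) 1, ∫ s in (0:ℝ)..t, W (s, x, μ) :=
    integral_congr_ae (hWw.mono fun μ hμ => by simp only [prim, hμ])
  rw [e2, prim]
  simp only [e1]
  have hi : ∀ a b : ℝ, Integrable (Function.uncurry fun s μ => W (s, x, μ))
      ((volume.restrict (Ioc a b)).prod (volume.restrict (Icc (-1:ℝ) 1))) := fun a b =>
    Integrable.of_bound (hW.comp (by fun_prop : Measurable fun p : ℝ × ℝ => (p.1, x, p.2))).aestronglyMeasurable B
      (ae_of_all _ fun p => hWB _)
  simp only [intervalIntegral]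
  rw [integral_integral_swap (hi 0 t), integral_integral_swap (hi t 0)]
  exact (integral_sub (hi 0 t).integral_prod_right (hi t 0).integral_prod_right).symm

theorem vavg_increment (h : FSol T ω η B C S w) {τ s : ℝ} (hτ : 0 ≤ τ) (hs : 0 ≤ s)
    (hS : ∀ t ∈ Icc 0 T, ∀ x ∈ Icc (0:ℝ) 1, -s ≤ S t x - S (t - τ) x) :
    ∀ t ∈ Icc 0 T, ∀ x ∈ Icc (0:ℝ) 1, -(2 * (s / ω * (1 - Real.exp (-(ω * t))))) ≤
      prim (vavg w) t x - prim (vavg w) (t - τ) x := by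
  intro t ht x hx
  set k := s / ω * (1 - Real.exp (-(ω * t)))
  have hp : ∀ t, IntegrableOn (fun μ => prim (fun t x => w t x μ) t x) (Icc (-1:ℝ) 1) := fun t => by
    obtain ⟨W, hW, hWB, hWw⟩ := h.exists_measurable_velocity
    refine Integrable.of_bound (C := B * |t|) ?_ (h.ae_sep.mono fun μ hμ => hμ.abs_prim_le t x)
    refine AEStronglyMeasurable.congr (f := fun μ => ∫ s in (0:ℝ)..t, W (s, x, μ)) ?_
      (hWw.mono fun μ hμ => by simp only [prim, hμ])
    have hm : StronglyMeasurable (Function.uncurry fun (μ s : ℝ) => W (s, x, μ)) :=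
      (hW.comp (by fun_prop : Measurable fun q : ℝ × ℝ => (q.2, x, q.1))).stronglyMeasurable
    simp only [intervalIntegral]
    exact (hm.integral_prod_right.sub hm.integral_prod_right).aestronglyMeasurable
  rw [h.prim_vavg, h.prim_vavg, ← integral_sub (hp _) (hp _)]
  have h2 : ∫ μ in Icc (-1:ℝ) 1, -k = -(2 * k) := by
    simp; left; norm_num
  rw [← h2]
  refine integral_mono_ae (integrable_const _) ((hp _).sub (hp _)) ?_
  filter_upwards [ae_restrict_mem measurableSet_Icc, ae_restrict_of_ae (Measure.ae_ne volume (0:ℝ))] with μ hμ h0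
  rcases lt_or_gt_of_ne h0 with h1 | h1
  · simpa using h.increment_left (μ := -μ) ⟨by linarith, by linarith [hμ.1]⟩ hτ hs hS t ht x hx
  · exact h.increment_right ⟨h1, hμ.2⟩ hτ hs hS t ht x hx

end FSol

/-- Clamped solutions over all frequencies, with arguments `ω t x μ`; `J` is the time primitive of
the collision gain `⟨ω w⟩`. -/
structure Fam (T B K m : ℝ) (M : ℝ → ℝ) (J : ℝ → ℝ → ℝ) (w : ℝ → ℝ → ℝ → ℝ → ℝ) : Prop where
  fsol : ∀ ω > 0, ∃ η, FSol T ω η B (M ω * K) (fun t x => M ω * J t x) (w ω)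
  T_pos : 0 < T
  sep : SepCont K J
  zero : ∀ t ≤ 0, ∀ x, J t x = 0
  int : ∀ t x, IntegrableOn (fun ω => ω * vavg (w ω) t x) (Ioi 0)
  deriv : ∀ x ∈ Icc (0:ℝ) 1, ∀ t ∈ Icc 0 T,
    HasDerivWithinAt (fun t => J t x) (∫ ω in Ioi (0:ℝ), ω * vavg (w ω) t x) (Icc 0 T) t
  pos : ∀ ω > 0, 0 < M ω
  le : ∀ ω > 0, M ω ≤ m * Real.exp (-(ω / 2))
  intM : IntegrableOn M (Ioi 0)
  mass : 2 * ∫ ω in Ioi (0:ℝ), M ω = 1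

theorem one_add_le_mul_exp {ω k : ℝ} (hk : 1 ≤ k) : 1 + ω ≤ k * Real.exp (ω / k) := by
  have h := Real.add_one_le_exp (ω / k)
  have h2 := mul_le_mul_of_nonneg_left h (by linarith : 0 ≤ k)
  have h3 : k * (ω / k + 1) = ω + k := by field_simp
  linarith

namespace Fam

variable {T B K m : ℝ} {M : ℝ → ℝ} {J : ℝ → ℝ → ℝ} {w : ℝ → ℝ → ℝ → ℝ → ℝ}

theorem B_nonneg (h : Fam T B K m M J w) : 0 ≤ B := by
  obtain ⟨η, h1⟩ := h.fsol 1 one_pos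
  exact h1.nonneg

theorem m_nonneg (h : Fam T B K m M J w) : 0 ≤ m := by
  have := (h.pos 1 one_pos).le.trans (h.le 1 one_pos)
  exact nonneg_of_mul_nonneg_left this (Real.exp_pos _)

theorem sepCont_vavg (h : Fam T B K m M J w) {ω : ℝ} (hω : 0 < ω) : SepCont (2 * B) (vavg (w ω)) := by
  obtain ⟨η, h1⟩ := h.fsol ω hω
  exact h1.sepCont_vavg

theorem aestronglyMeasurable_vavg (h : Fam T B K m M J w) (t x : ℝ) :
    AEStronglyMeasurable (fun ω => vavg (w ω) t x) (volume.restrict (Ioi 0)) := by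
  have h1 : AEStronglyMeasurable (fun ω : ℝ => ω⁻¹ * (ω * vavg (w ω) t x)) (volume.restrict (Ioi 0)) :=
    measurable_inv.aestronglyMeasurable.mul (h.int t x).aestronglyMeasurable
  refine h1.congr ?_
  filter_upwards [ae_restrict_mem measurableSet_Ioi] with ω hω
  rw [inv_mul_cancel_left₀ (ne_of_gt hω)]

theorem exists_measurable_freq (h : Fam T B K m M J w) :
    ∃ A : ℝ × ℝ × ℝ → ℝ, Measurable A ∧
      ∀ᵐ ω ∂volume.restrict (Ioi (0:ℝ)), ∀ t x, A (t, x, ω) = vavg (w ω) t x := by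
  have hs : ∀ᵐ ω ∂volume.restrict (Ioi (0:ℝ)), SepCont (2 * B) (vavg (w ω)) :=
    (ae_restrict_mem measurableSet_Ioi).mono fun ω hω => h.sepCont_vavg hω
  obtain ⟨A, h1, -, h3⟩ := exists_measurable_of_separately_continuous (h := fun t x ω => vavg (w ω) t x)
    (hs.mono fun μ hμ => hμ.left) (hs.mono fun μ hμ => hμ.right) h.aestronglyMeasurable_vavg
  exact ⟨A, h1, h3⟩

theorem exists_neg_part_bound (h : Fam T B K m M J w) : ∃ R : ℝ, ∀ ω > 0,
    ∫ p, max (-vavg (w ω) p.1 p.2) 0 ∂txMeasure T ≤ R * Real.exp (-(ω / 16)) := by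
  have hB := h.B_nonneg
  have hT := h.T_pos
  have hm := h.m_nonneg
  have hK := h.sep.nonneg
  set c := m * K with hc
  have hc0 : 0 ≤ c := by positivity
  set P := 8 * B * T ^ 2 + (c * (1 + T) + 4 * B) * T + 8 * B * (1 + T) * T with hP
  have hP0 : 0 ≤ P := by positivity
  set R := 1 + 4 * c * P with hR
  have hR1 : 1 ≤ R := by have : 0 ≤ 4 * c * P := by positivity
                         linarith
  refine ⟨2 * ((T + 2 * (4 * B * (4 * B) * T) + 1) * R), fun ω hω => ?_⟩
  obtain ⟨η, h1⟩ := h.fsol ω hω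
  have hr : 0 < R * Real.exp (-(ω / 16)) := by positivity
  refine (h1.integral_neg_part_vavg_le hr ?_).trans (le_of_eq (by ring))
  have hM := h.pos ω hω
  set C := M ω * K with hC
  have hC0 : 0 ≤ C := by positivity
  have hCe : C ≤ c * Real.exp (-(ω / 2)) := by
    have := mul_le_mul_of_nonneg_right (h.le ω hω) hK
    linarith
  have hCc : C ≤ c := by
    have : Real.exp (-(ω / 2)) ≤ 1 := by rw [Real.exp_le_one_iff]; linarith
    nlinarith
  have e1 : 2 * ω * (4 * B) * (C * T) * T + (C + ω * (C * T) + 4 * B) * (C * T)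
      + 2 * (4 * B) * (C + ω * (C * T)) * T ≤ C * (P * (1 + ω)) := by
    have a1 : C * (8 * B * T ^ 2 * ω) ≤ C * (8 * B * T ^ 2 * (1 + ω)) := by gcongr; linarith
    have a2 : C * ((C * (1 + T * ω) + 4 * B) * T) ≤ C * ((c * (1 + T) + 4 * B) * T * (1 + ω)) := by
      refine mul_le_mul_of_nonneg_left ?_ hC0
      have b1 : C * (1 + T * ω) ≤ c * ((1 + T) * (1 + ω)) :=
        mul_le_mul hCc (by nlinarith) (by positivity) hc0
      have b2 : 4 * B ≤ 4 * B * (1 + ω) := by nlinarith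
      nlinarith [mul_le_mul_of_nonneg_right (add_le_add b1 b2) hT.le]
    have a3 : C * (8 * B * (1 + T * ω) * T) ≤ C * (8 * B * (1 + T) * T * (1 + ω)) := by
      refine mul_le_mul_of_nonneg_left ?_ hC0
      have : 1 + T * ω ≤ (1 + T) * (1 + ω) := by nlinarith
      nlinarith [mul_le_mul_of_nonneg_right this (by positivity : 0 ≤ 8 * B * T)]
    rw [hP]
    nlinarith
  have e2 : 1 + ω ≤ 4 * Real.exp (ω / 4) := one_add_le_mul_exp (by norm_num)
  have e3 : C * (P * (1 + ω)) ≤ (c * Real.exp (-(ω / 2))) * (P * (4 * Real.exp (ω / 4))) := by gcongr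
  have e4 : (c * Real.exp (-(ω / 2))) * (P * (4 * Real.exp (ω / 4))) = 4 * c * P * Real.exp (-(ω / 4)) := by
    have : Real.exp (-(ω / 4)) = Real.exp (-(ω / 2)) * Real.exp (ω / 4) := by
      rw [← Real.exp_add]; congr 1; ring
    rw [this]; ring
  have e5 : (R * Real.exp (-(ω / 16))) ^ 4 = R ^ 4 * Real.exp (-(ω / 4)) := by
    rw [mul_pow, ← Real.exp_nat_mul]; congr 2; push_cast; ring
  have e6 : R ≤ R ^ 4 := le_self_pow₀ hR1 (by norm_num)
  rw [e5]
  refine (e1.trans (e3.trans e4.le)).trans ?_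
  have : 4 * c * P ≤ R ^ 4 := by linarith
  gcongr

theorem integrable_freq_weight (c : ℝ) : IntegrableOn (fun ω : ℝ => ω * (c * Real.exp (-(ω / 16)))) (Ioi 0) := by
  have h0 : IntegrableOn (fun ω : ℝ => ω * Real.exp (-(ω / 16))) (Ioi 0) := by
    have h1 : IntegrableOn (fun ω : ℝ => 32 * Real.exp (-(1 / 32) * ω)) (Ioi 0) :=
      (exp_neg_integrableOn_Ioi 0 (by norm_num)).const_mul _
    refine Integrable.mono' h1 (by fun_prop) ?_
    filter_upwards [ae_restrict_mem measurableSet_Ioi] with ω hω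
    have hω' : 0 < ω := hω
    rw [Real.norm_of_nonneg (by positivity)]
    have h2 : 1 + ω ≤ 32 * Real.exp (ω / 32) := one_add_le_mul_exp (by norm_num)
    calc ω * Real.exp (-(ω / 16)) ≤ (32 * Real.exp (ω / 32)) * Real.exp (-(ω / 16)) := by
          gcongr; linarith
      _ = 32 * Real.exp (-(1 / 32) * ω) := by
          rw [mul_assoc, ← Real.exp_add]; congr 2; ring
  refine (h0.const_mul c).congr (ae_of_all _ fun ω => ?_)
  simp only; ring

theorem theta_lt_one (h : Fam T B K m M J w) :
    IntegrableOn (fun ω => M ω * (1 - Real.exp (-(ω * T)))) (Ioi 0) ∧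
    2 * ∫ ω in Ioi (0:ℝ), M ω * (1 - Real.exp (-(ω * T))) < 1 := by
  have hT := h.T_pos
  have h1 : IntegrableOn (fun ω => M ω * Real.exp (-(ω * T))) (Ioi 0) := by
    refine Integrable.mono' h.intM (h.intM.aestronglyMeasurable.mul (by fun_prop)) ?_
    filter_upwards [ae_restrict_mem measurableSet_Ioi] with ω hω
    have hω' : 0 < ω := hω
    have := h.pos ω hω'
    rw [Real.norm_of_nonneg (by positivity)]
    refine mul_le_of_le_one_right this.le ?_
    rw [Real.exp_le_one_iff]
    have : 0 < ω * T := by positivity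
    linarith
  have e : (fun ω => M ω * (1 - Real.exp (-(ω * T)))) = fun ω => M ω - M ω * Real.exp (-(ω * T)) := by
    funext ω; ring
  rw [e]
  refine ⟨h.intM.sub h1, ?_⟩
  rw [integral_sub h.intM h1, mul_sub, h.mass]
  have : 0 < ∫ ω in Ioi (0:ℝ), M ω * Real.exp (-(ω * T)) := by
    rw [setIntegral_pos_iff_support_of_nonneg_ae _ h1]
    · have : Ioi (0:ℝ) ⊆ Function.support (fun ω => M ω * Real.exp (-(ω * T))) ∩ Ioi 0 := fun ω hω =>
        ⟨(mul_pos (h.pos ω hω) (Real.exp_pos _)).ne', hω⟩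
      refine lt_of_lt_of_le ?_ (measure_mono this)
      simp
    · filter_upwards [ae_restrict_mem measurableSet_Ioi] with ω hω
      exact (mul_pos (h.pos ω hω) (Real.exp_pos _)).le
  linarith

end Fam

namespace Fam

variable {T B K m : ℝ} {M : ℝ → ℝ} {J : ℝ → ℝ → ℝ} {w : ℝ → ℝ → ℝ → ℝ → ℝ}

theorem ae_integrable_neg_part (h : Fam T B K m M J w) {A : ℝ × ℝ × ℝ → ℝ} (hA : Measurable A)
    (hAw : ∀ᵐ ω ∂volume.restrict (Ioi (0:ℝ)), ∀ t x, A (t, x, ω) = vavg (w ω) t x) :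
    ∀ᵐ x ∂volume.restrict (Ioc (0:ℝ) 1), Integrable (fun q : ℝ × ℝ => q.1 * max (-A (q.2, x, q.1)) 0)
      ((volume.restrict (Ioi (0:ℝ))).prod (volume.restrict (Ioc 0 T))) := by
  obtain ⟨R, hR⟩ := h.exists_neg_part_bound
  set F : ℝ × ℝ × ℝ → ℝ := fun q => q.1 * max (-A (q.2.1, q.2.2, q.1)) 0 with hF
  have hFm : Measurable F := by fun_prop
  have hi : Integrable F ((volume.restrict (Ioi (0:ℝ))).prod (txMeasure T)) := by
    rw [integrable_prod_iff hFm.aestronglyMeasurable]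
    constructor
    · filter_upwards [hAw, ae_restrict_mem measurableSet_Ioi] with ω h1 hω
      refine integrable_tx (K := ω * (2 * B)) (hFm.comp (measurable_const.prodMk measurable_id)) fun p _ => ?_
      have hω' : 0 < ω := hω
      have h2 := (h.sepCont_vavg hω').bound p.1 p.2
      simp only [hF, h1]
      rw [abs_mul, abs_of_pos hω', abs_of_nonneg (le_max_right _ _)]
      refine mul_le_mul_of_nonneg_left (max_le ?_ ((abs_nonneg _).trans h2)) hω'.le
      exact (neg_le_abs _).trans h2
    · refine Integrable.mono' (integrable_freq_weight R)
        (hFm.norm.stronglyMeasurable.integral_prod_right.aestronglyMeasurable) ?_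
      filter_upwards [hAw, ae_restrict_mem measurableSet_Ioi] with ω h1 hω
      have hω' : 0 < ω := hω
      have e : ∀ p : ℝ × ℝ, ‖F (ω, p)‖ = ω * max (-vavg (w ω) p.1 p.2) 0 := fun p => by
        simp only [hF, h1]
        exact Real.norm_of_nonneg (mul_nonneg hω'.le (le_max_right _ _))
      simp only [e]
      have h0 : 0 ≤ ∫ p, max (-vavg (w ω) p.1 p.2) 0 ∂txMeasure T := integral_nonneg fun p => le_max_right _ _
      rw [integral_const_mul, Real.norm_of_nonneg (mul_nonneg hω'.le h0)]
      exact mul_le_mul_of_nonneg_left (hR ω hω') hω'.le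
  have h2 := (measurePreserving_prodAssoc (volume.restrict (Ioi (0:ℝ))) (volume.restrict (Ioc 0 T))
    (volume.restrict (Ioc (0:ℝ) 1))).integrable_comp_of_integrable hi
  exact h2.prod_left_ae

theorem drop_le_of_integrable (h : Fam T B K m M J w) {A : ℝ × ℝ × ℝ → ℝ} (hA : Measurable A)
    (hAw : ∀ᵐ ω ∂volume.restrict (Ioi (0:ℝ)), ∀ t x, A (t, x, ω) = vavg (w ω) t x) {σ x : ℝ} (hσ : 0 ≤ σ)
    (hx : x ∈ Icc (0:ℝ) 1)
    (hxi : Integrable (fun q : ℝ × ℝ => q.1 * max (-A (q.2, x, q.1)) 0)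
      ((volume.restrict (Ioi (0:ℝ))).prod (volume.restrict (Ioc 0 T))))
    {t' t : ℝ} (ht' : 0 ≤ t') (htt : t' ≤ t) (ht : t ≤ T)
    (hJ : ∀ t₁ ∈ Icc 0 T, ∀ y ∈ Icc (0:ℝ) 1, -σ ≤ J t₁ y - J (t₁ - (t - t')) y) :
    J t' x - J t x ≤ (2 * ∫ ω in Ioi (0:ℝ), M ω * (1 - Real.exp (-(ω * T)))) * σ := by
  set ν := volume.restrict (Ioi (0:ℝ)) with hν
  set N : ℝ → ℝ := fun t => ∫ ω, ω * vavg (w ω) t x ∂ν with hN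
  set F : ℝ × ℝ → ℝ := fun q => q.1 * max (-A (q.2, x, q.1)) 0 with hF
  have hFm : Measurable F := by fun_prop
  have hsub : Ioc t' t ⊆ Ioc 0 T := Ioc_subset_Ioc ht' ht
  set Θ : ℕ → ℝ × ℝ → ℝ := fun n q => if q.1 ≤ n then q.1 * A (q.2, x, q.1) else -F q with hΘ
  have hcut : ∀ n : ℕ, MeasurableSet {q : ℝ × ℝ | q.1 ≤ n} := fun n =>
    measurableSet_le measurable_fst measurable_const
  have hΘm : ∀ n, Measurable (Θ n) := fun n =>
    Measurable.ite (hcut n) (by fun_prop) hFm.neg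
  have hB := h.B_nonneg
  have hAb : ∀ᵐ ω ∂ν, ∀ s, |A (s, x, ω)| ≤ 2 * B := by
    filter_upwards [hAw, ae_restrict_mem measurableSet_Ioi] with ω h1 hω s
    rw [h1]; exact (h.sepCont_vavg hω).bound s x
  have hAF : ∀ q : ℝ × ℝ, 0 ≤ q.1 → -F q ≤ q.1 * A (q.2, x, q.1) := fun q hq => by
    simp only [hF]
    have := mul_le_mul_of_nonneg_left (le_max_left (-A (q.2, x, q.1)) 0) hq
    linarith
  have hFi : Integrable F (ν.prod (volume.restrict (Ioc t' t))) := by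
    refine hxi.mono_measure ?_
    exact Measure.prod_mono le_rfl (Measure.restrict_mono hsub le_rfl)
  have hΘi : ∀ n, Integrable (Θ n) (ν.prod (volume.restrict (Ioc t' t))) := by
    intro n
    have hlow : Integrable (fun q : ℝ × ℝ => (Iic (n:ℝ)).indicator (fun _ => (n:ℝ) * (2 * B)) q.1 * 1)
        (ν.prod (volume.restrict (Ioc t' t))) := by
      refine Integrable.mul_prod (f := (Iic (n:ℝ)).indicator (fun _ => (n:ℝ) * (2 * B))) (g := fun _ => (1:ℝ)) ?_
        (integrable_const _)
      rw [integrable_indicator_iff measurableSet_Iic]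
      refine integrableOn_const ?_
      rw [hν, Measure.restrict_apply measurableSet_Iic, Iic_inter_Ioi]
      simp
    refine Integrable.mono' (hlow.add hFi.norm) (hΘm n).aestronglyMeasurable ?_
    have h1 : ∀ᵐ q ∂ν.prod (volume.restrict (Ioc t' t)), 0 < q.1 ∧ ∀ s, |A (s, x, q.1)| ≤ 2 * B :=
      Measure.quasiMeasurePreserving_fst.ae ((ae_restrict_mem measurableSet_Ioi).and hAb)
    filter_upwards [h1] with q hq
    simp only [hΘ, Pi.add_apply]
    split_ifs with hn
    · rw [indicator_of_mem (show q.1 ∈ Iic (n:ℝ) from hn), mul_one]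
      refine le_add_of_le_of_nonneg ?_ (norm_nonneg _)
      rw [Real.norm_eq_abs, abs_mul, abs_of_pos hq.1]
      exact mul_le_mul hn (hq.2 _) (abs_nonneg _) (by positivity)
    · rw [norm_neg, indicator_of_notMem (show q.1 ∉ Iic (n:ℝ) from hn), zero_mul, zero_add]
  have hΘs : ∀ n s, Integrable (fun ω => Θ n (ω, s)) ν := by
    intro n s
    have hi := h.int s x
    refine Integrable.mono' hi.norm ((hΘm n).comp (measurable_id.prodMk measurable_const)).aestronglyMeasurable ?_
    filter_upwards [hAw, ae_restrict_mem measurableSet_Ioi] with ω h1 hω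
    have hω' : 0 < ω := hω
    simp only [hΘ, hF, h1]
    split_ifs
    · exact le_rfl
    · rw [norm_neg, norm_mul, norm_mul]
      refine mul_le_mul_of_nonneg_left ?_ (norm_nonneg _)
      rw [Real.norm_of_nonneg (le_max_right _ _)]
      exact max_le (neg_le_abs _) (norm_nonneg _)
  have hle : ∀ n s, ∫ ω, Θ n (ω, s) ∂ν ≤ N s := by
    intro n s
    refine integral_mono_ae (hΘs n s) (h.int s x) ?_
    filter_upwards [hAw, ae_restrict_mem measurableSet_Ioi] with ω h1 hω
    have h3 := hAF (ω, s) (le_of_lt hω)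
    simp only [hΘ]
    rw [← h1]
    split_ifs
    · exact le_rfl
    · exact h3
  have hftc : ∀ n, ∫ s in t'..t, ∫ ω, Θ n (ω, s) ∂ν ≤ J t x - J t' x := by
    intro n
    refine intervalIntegral.integral_le_sub_of_hasDeriv_right_of_le htt (h.sep.left x).continuousOn
      (g' := N) (fun s hs => ?_) ?_ fun s _ => hle n s
    · have h1 := h.deriv x hx s ⟨ht'.trans hs.1.le, hs.2.le.trans ht⟩
      exact (h1.hasDerivAt (Icc_mem_nhds (ht'.trans_lt hs.1) (hs.2.trans_le ht))).hasDerivWithinAt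
    · rw [integrableOn_Icc_iff_integrableOn_Ioc]
      exact (hΘi n).integral_prod_right
  set q : ℝ → ℝ := fun ω => ∫ s in Ioc 0 T, F (ω, s) with hq
  have hqi : Integrable q ν := hxi.integral_prod_left
  obtain ⟨hθi, -⟩ := h.theta_lt_one
  have hlow : ∀ n : ℕ, -((2 * ∫ ω in Ioi (0:ℝ), M ω * (1 - Real.exp (-(ω * T)))) * σ)
      - ∫ ω, (Ioi (n:ℝ)).indicator q ω ∂ν ≤ ∫ s in t'..t, ∫ ω, Θ n (ω, s) ∂ν := by
    intro n
    rw [intervalIntegral.integral_of_le htt, ← integral_integral_swap (f := fun ω s => Θ n (ω, s)) (hΘi n)]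
    have e : -((2 * ∫ ω in Ioi (0:ℝ), M ω * (1 - Real.exp (-(ω * T)))) * σ)
      - ∫ ω, (Ioi (n:ℝ)).indicator q ω ∂ν
      = ∫ ω, (-(2 * σ) * (M ω * (1 - Real.exp (-(ω * T)))) - (Ioi (n:ℝ)).indicator q ω) ∂ν := by
      rw [integral_sub (hθi.const_mul _) (hqi.indicator measurableSet_Ioi), integral_const_mul]
      ring
    rw [e]
    refine integral_mono_ae ((hθi.const_mul _).sub (hqi.indicator measurableSet_Ioi))
      (hΘi n).integral_prod_left ?_
    filter_upwards [hAw, ae_restrict_mem measurableSet_Ioi, hxi.prod_right_ae] with ω h1 hω hFω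
    have hω' : 0 < ω := hω
    have hMω := h.pos ω hω'
    have hexp : 0 ≤ 1 - Real.exp (-(ω * T)) := by
      rw [sub_nonneg, Real.exp_le_one_iff]
      linarith [mul_pos hω' h.T_pos]
    have hq0 : 0 ≤ M ω * (1 - Real.exp (-(ω * T))) := mul_nonneg hMω.le hexp
    simp only [hΘ]
    split_ifs with hn
    · rw [indicator_of_notMem (show ω ∉ Ioi (n:ℝ) from not_lt.2 hn), sub_zero]
      simp only [h1]
      obtain ⟨η, hf⟩ := h.fsol ω hω'
      have h5 := hf.vavg_increment (τ := t - t') (s := M ω * σ) (sub_nonneg.2 htt) (mul_nonneg hMω.le hσ)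
        (fun t₁ h₁ y hy => by
          have := mul_le_mul_of_nonneg_left (hJ t₁ h₁ y hy) hMω.le
          linarith) t ⟨ht'.trans htt, ht⟩ x hx
      rw [sub_sub_cancel] at h5
      have hs := h.sepCont_vavg hω'
      have e2 : ∫ s in Ioc t' t, ω * vavg (w ω) s x = ω * (prim (vavg (w ω)) t x - prim (vavg (w ω)) t' x) := by
        rw [integral_const_mul, ← intervalIntegral.integral_of_le htt]
        simp only [prim]
        rw [intervalIntegral.integral_interval_sub_left ((hs.left x).intervalIntegrable _ _)
          ((hs.left x).intervalIntegrable _ _)]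
      rw [e2]
      have h6 := mul_le_mul_of_nonneg_left h5 hω'.le
      have e3 : ω * -(2 * (M ω * σ / ω * (1 - Real.exp (-(ω * t)))))
          = -(2 * σ) * (M ω * (1 - Real.exp (-(ω * t)))) := by field_simp
      rw [e3] at h6
      refine le_trans ?_ h6
      have h7 : Real.exp (-(ω * T)) ≤ Real.exp (-(ω * t)) := by
        apply Real.exp_le_exp.2
        linarith [mul_le_mul_of_nonneg_left ht hω'.le]
      nlinarith [mul_le_mul_of_nonneg_left h7 (mul_nonneg hσ hMω.le)]
    · rw [indicator_of_mem (show ω ∈ Ioi (n:ℝ) from not_le.1 hn), integral_neg]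
      have h8 : ∫ s in Ioc t' t, F (ω, s) ≤ q ω :=
        setIntegral_mono_set hFω (ae_of_all _ fun s => mul_nonneg hω'.le (le_max_right _ _))
          (ae_of_all _ fun s hs => hsub hs)
      have h9 : 0 ≤ (2 * σ) * (M ω * (1 - Real.exp (-(ω * T)))) := mul_nonneg (by linarith) hq0
      linarith
  have htail : Tendsto (fun n : ℕ => ∫ ω, (Ioi (n:ℝ)).indicator q ω ∂ν) atTop (𝓝 0) := by
    have := tendsto_integral_of_dominated_convergence (μ := ν) (F := fun (n : ℕ) ω => (Ioi (n:ℝ)).indicator q ω)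
      (f := fun _ => (0:ℝ)) (fun ω => ‖q ω‖) (fun n => (hqi.indicator measurableSet_Ioi).aestronglyMeasurable)
      hqi.norm (fun n => ae_of_all _ fun ω => norm_indicator_le_norm_self _ _) (ae_of_all _ fun ω => by
        obtain ⟨k, hk⟩ := exists_nat_ge ω
        refine tendsto_const_nhds.congr' ?_
        filter_upwards [eventually_ge_atTop k] with n hn
        rw [indicator_of_notMem]
        have : (k:ℝ) ≤ n := by exact_mod_cast hn
        exact not_lt.2 (hk.trans this))
    simpa using this
  have h1 : ∀ n : ℕ, J t' x - J t x - (2 * ∫ ω in Ioi (0:ℝ), M ω * (1 - Real.exp (-(ω * T)))) * σ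
      ≤ ∫ ω, (Ioi (n:ℝ)).indicator q ω ∂ν := fun n => by
    linarith [hlow n, hftc n]
  have := ge_of_tendsto' htail h1
  linarith

theorem nonneg_of_ae {f : ℝ → ℝ} (hf : Continuous f) (h : ∀ᵐ x ∂volume.restrict (Ioc (0:ℝ) 1), 0 ≤ f x) :
    ∀ x ∈ Icc (0:ℝ) 1, 0 ≤ f x := by
  have h1 : (fun x => min (f x) 0) =ᵐ[volume.restrict (Icc (0:ℝ) 1)] fun _ => 0 := by
    rw [← restrict_Ioc_eq_restrict_Icc]
    filter_upwards [h] with x hx using min_eq_right hx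
  have h2 := Measure.eqOn_Icc_of_ae_eq volume zero_ne_one h1 (by fun_prop) continuousOn_const
  intro x hx
  exact min_eq_right_iff.1 (h2 hx)

theorem gain_mono (h : Fam T B K m M J w) {t x τ : ℝ} (ht : t ∈ Icc 0 T) (hx : x ∈ Icc (0:ℝ) 1) (hτ : 0 ≤ τ) :
    0 ≤ J t x - J (t - τ) x := by
  set D : Set ℝ := {d | ∃ t ∈ Icc 0 T, ∃ x ∈ Icc (0:ℝ) 1, ∃ τ ≥ 0, d = J (t - τ) x - J t x} with hD
  have hbdd : BddAbove D := by
    refine ⟨2 * K, ?_⟩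
    rintro d ⟨t, -, x, -, τ, -, rfl⟩
    have h1 := abs_le.1 (h.sep.bound (t - τ) x)
    have h2 := abs_le.1 (h.sep.bound t x)
    linarith [h1.2, h2.1]
  have hne : (0:ℝ) ∈ D := ⟨0, ⟨le_rfl, h.T_pos.le⟩, 0, ⟨le_rfl, zero_le_one⟩, 0, le_rfl, by simp⟩
  set σ := sSup D with hσd
  have hσ : 0 ≤ σ := le_csSup hbdd hne
  have hle : ∀ τ ≥ 0, ∀ t ∈ Icc 0 T, ∀ x ∈ Icc (0:ℝ) 1, -σ ≤ J t x - J (t - τ) x := by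
    intro τ hτ t ht x hx
    have := le_csSup hbdd ⟨t, ht, x, hx, τ, hτ, rfl⟩
    linarith
  obtain ⟨A, hA, hAw⟩ := h.exists_measurable_freq
  have hgood := h.ae_integrable_neg_part hA hAw
  set θ := 2 * ∫ ω in Ioi (0:ℝ), M ω * (1 - Real.exp (-(ω * T))) with hθ
  have hθ1 : θ < 1 := h.theta_lt_one.2
  have hθ0 : 0 ≤ θ := mul_nonneg zero_le_two (setIntegral_nonneg measurableSet_Ioi fun ω hω =>
    mul_nonneg (h.pos ω hω).le (by
      rw [sub_nonneg, Real.exp_le_one_iff]; linarith [mul_pos (show 0 < ω from hω) h.T_pos]))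
  have hdrop : ∀ t' t, 0 ≤ t' → t' ≤ t → t ≤ T → ∀ x ∈ Icc (0:ℝ) 1, J t' x - J t x ≤ θ * σ := by
    intro t' t h0 h1 h2 x hx
    have h3 : ∀ᵐ x ∂volume.restrict (Ioc (0:ℝ) 1), 0 ≤ θ * σ - (J t' x - J t x) := by
      filter_upwards [hgood, ae_restrict_mem measurableSet_Ioc] with x hx hx0
      rw [sub_nonneg]
      exact h.drop_le_of_integrable hA hAw hσ (Ioc_subset_Icc_self hx0) hx h0 h1 h2
        (hle _ (sub_nonneg.2 h1))
    have hc : Continuous fun x => θ * σ - (J t' x - J t x) :=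
      continuous_const.sub ((h.sep.right t').sub (h.sep.right t))
    linarith [nonneg_of_ae hc h3 x hx]
  have hσle : σ ≤ θ * σ := by
    refine csSup_le ⟨0, hne⟩ ?_
    rintro d ⟨t, ht, x, hx, τ, hτ, rfl⟩
    rcases le_total 0 (t - τ) with h0 | h0
    · exact hdrop _ _ h0 (sub_le_self _ hτ) ht.2 x hx
    · rw [h.zero _ h0, ← h.zero 0 le_rfl x]
      exact hdrop 0 t le_rfl ht.1 ht.2 x hx
  have hσ0 : σ = 0 := by nlinarith
  have := hle τ hτ t ht x hx
  linarith

end Fam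

theorem gstar_pos {ω : ℝ} (hω : 0 < ω) : 0 < gstar ω := by
  have h : 0 < Real.exp ω - 1 := by linarith [Real.add_one_lt_exp hω.ne']
  unfold gstar
  positivity

theorem mul_gstar_le {ω : ℝ} (hω : 0 < ω) : ω * gstar ω ≤ 216 * Real.exp (-(ω / 2)) := by
  have h : 0 < Real.exp ω - 1 := by linarith [Real.add_one_lt_exp hω.ne']
  have h1 : Real.exp ω * ω ≤ (Real.exp ω - 1) * (1 + ω) := by linarith [Real.add_one_le_exp ω]
  have h2 : gstar ω ≤ (1 + ω) ^ 2 * Real.exp (-ω) := by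
    unfold gstar
    rw [div_le_iff₀ (by positivity)]
    have h3 := pow_le_pow_left₀ (by positivity) h1 2
    have h4 : Real.exp (-ω) * Real.exp ω = 1 := by rw [← Real.exp_add]; simp
    have h5 := mul_le_mul_of_nonneg_left h3 (Real.exp_pos (-ω)).le
    calc ω ^ 2 * Real.exp ω = Real.exp (-ω) * (Real.exp ω * ω) ^ 2 := by
          linear_combination (-(ω ^ 2 * Real.exp ω)) * h4
      _ ≤ _ := h5
      _ = _ := by ring
  have h3 : 1 + ω ≤ 6 * Real.exp (ω / 6) := one_add_le_mul_exp (by norm_num)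
  calc ω * gstar ω ≤ (1 + ω) * ((1 + ω) ^ 2 * Real.exp (-ω)) :=
        mul_le_mul (by linarith) h2 (gstar_pos hω).le (by positivity)
    _ = (1 + ω) ^ 3 * Real.exp (-ω) := by ring
    _ ≤ (6 * Real.exp (ω / 6)) ^ 3 * Real.exp (-ω) := by gcongr
    _ = 216 * Real.exp (-(ω / 2)) := by
        rw [mul_pow, ← Real.exp_nat_mul, mul_assoc, ← Real.exp_add]
        norm_num
        ring

theorem measurable_gstar : Measurable gstar := by
  unfold gstar
  fun_prop

theorem integrableOn_mul_gstar : IntegrableOn (fun ω => ω * gstar ω) (Ioi 0) := by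
  have h1 : IntegrableOn (fun ω : ℝ => 216 * Real.exp (-(1 / 2) * ω)) (Ioi 0) :=
    (exp_neg_integrableOn_Ioi 0 (by norm_num)).const_mul _
  refine Integrable.mono' h1 (measurable_id.mul measurable_gstar).aestronglyMeasurable ?_
  filter_upwards [ae_restrict_mem measurableSet_Ioi] with ω hω
  rw [Real.norm_of_nonneg (mul_pos hω (gstar_pos hω)).le]
  refine (mul_gstar_le hω).trans (le_of_eq ?_)
  congr 2; ring

theorem wgstar_pos : 0 < wgstar := by
  unfold wgstar
  refine mul_pos two_pos ?_
  rw [setIntegral_pos_iff_support_of_nonneg_ae _ integrableOn_mul_gstar]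
  · have : Ioi (0:ℝ) ⊆ Function.support (fun ω => ω * gstar ω) ∩ Ioi 0 := fun ω hω =>
      ⟨(mul_pos hω (gstar_pos hω)).ne', hω⟩
    refine lt_of_lt_of_le ?_ (measure_mono this)
    simp
  · filter_upwards [ae_restrict_mem measurableSet_Ioi] with ω hω
    exact (mul_pos hω (gstar_pos hω)).le

theorem Mw_pos {ω : ℝ} (hω : 0 < ω) : 0 < Mw ω := div_pos (mul_pos hω (gstar_pos hω)) wgstar_pos

theorem Mw_le {ω : ℝ} (hω : 0 < ω) : Mw ω ≤ 216 / wgstar * Real.exp (-(ω / 2)) := by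
  unfold Mw
  rw [div_mul_eq_mul_div]
  exact div_le_div_of_nonneg_right (mul_gstar_le hω) wgstar_pos.le

theorem integrableOn_Mw : IntegrableOn Mw (Ioi 0) := integrableOn_mul_gstar.div_const _

theorem two_mul_integral_Mw : 2 * ∫ ω in Ioi (0:ℝ), Mw ω = 1 := by
  have h : ∫ ω in Ioi (0:ℝ), Mw ω = (∫ ω in Ioi (0:ℝ), ω * gstar ω) / wgstar := integral_div _ _
  rw [h, mul_div_assoc', ← wgstar, div_self wgstar_pos.ne']

namespace Fam

variable {T B K m : ℝ} {M : ℝ → ℝ} {J : ℝ → ℝ → ℝ} {w : ℝ → ℝ → ℝ → ℝ → ℝ}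

theorem nonneg_of_prim_mono {v : ℝ → ℝ → ℝ} (hv : SepCont B v) (hT : 0 < T) {x : ℝ}
    (h : ∀ t ∈ Icc 0 T, ∀ τ ≥ 0, 0 ≤ prim v t x - prim v (t - τ) x) : ∀ t ∈ Icc 0 T, 0 ≤ v t x := by
  intro t ht
  have hm : MonotoneOn (fun t => prim v t x) (Icc 0 T) := by
    intro a ha b hb hab
    have := h b hb (b - a) (sub_nonneg.2 hab)
    rw [sub_sub_cancel] at this
    exact sub_nonneg.1 this
  exact (hv.hasDerivAt_prim t x).hasDerivWithinAt.nonneg_of_monotoneOn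
    (uniqueDiffOn_Icc hT t ht).accPt hm

theorem nonneg_of_ne (h : Fam T B K m M J w) {ω t x μ : ℝ} (hω : 0 < ω) (ht : t ∈ Icc 0 T)
    (hx : x ∈ Icc (0:ℝ) 1) (hμ : μ ∈ Icc (-1:ℝ) 1) (h0 : μ ≠ 0) : 0 ≤ w ω t x μ := by
  obtain ⟨η, hf⟩ := h.fsol ω hω
  have hS : ∀ τ ≥ 0, ∀ t ∈ Icc 0 T, ∀ x ∈ Icc (0:ℝ) 1, -0 ≤ M ω * J t x - M ω * J (t - τ) x :=
    fun τ hτ t ht x hx => by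
      have := mul_nonneg (h.pos ω hω).le (h.gain_mono ht hx hτ)
      linarith
  rcases lt_or_gt_of_ne h0 with h1 | h1
  · have hm : -μ ∈ Ioc (0:ℝ) 1 := ⟨by linarith, by linarith [hμ.1]⟩
    have := nonneg_of_prim_mono (hf.sep_left hm) h.T_pos (x := x) (fun t ht τ hτ => by
      simpa using hf.increment_left hm hτ le_rfl (hS τ hτ) t ht x hx) t ht
    simpa using this
  · have hm : μ ∈ Ioc (0:ℝ) 1 := ⟨h1, hμ.2⟩
    exact nonneg_of_prim_mono (hf.right μ hm).sep h.T_pos (x := x) (fun t ht τ hτ => by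
      simpa using hf.increment_right hm hτ le_rfl (hS τ hτ) t ht x hx) t ht

theorem gain_nonneg (h : Fam T B K m M J w) {t x : ℝ} (ht : t ∈ Icc 0 T) (hx : x ∈ Icc (0:ℝ) 1) :
    0 ≤ ∫ ω in Ioi (0:ℝ), ω * vavg (w ω) t x := by
  refine setIntegral_nonneg measurableSet_Ioi fun ω hω => mul_nonneg (le_of_lt hω) ?_
  refine integral_nonneg_of_ae ?_
  filter_upwards [ae_restrict_mem measurableSet_Icc, ae_restrict_of_ae (Measure.ae_ne volume (0:ℝ))] with μ hμ h0
  exact h.nonneg_of_ne hω ht hx hμ h0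

end Fam

/-- Projection of the real line onto `[0, b]`. -/
def clamp (b x : ℝ) : ℝ := max 0 (min b x)

theorem continuous_clamp (b : ℝ) : Continuous (clamp b) := by
  unfold clamp
  fun_prop

theorem clamp_mem {b : ℝ} (hb : 0 ≤ b) (x : ℝ) : clamp b x ∈ Icc 0 b :=
  ⟨le_max_left _ _, max_le hb (min_le_left _ _)⟩

theorem clamp_of_mem {b x : ℝ} (hx : x ∈ Icc 0 b) : clamp b x = x := by
  rw [clamp, min_eq_right hx.2, max_eq_right hx.1]

theorem clamp_of_nonpos {b x : ℝ} (hx : x ≤ 0) : clamp b x = 0 :=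
  max_eq_left ((min_le_right _ _).trans hx)

namespace SepCont

variable {B : ℝ} {H : ℝ → ℝ → ℝ}

theorem of_clamp {f : ℝ → ℝ → ℝ} {T : ℝ} (hT : 0 ≤ T)
    (h1 : ∀ x ∈ Icc (0:ℝ) 1, ContinuousOn (fun t => f t x) (Icc 0 T))
    (h2 : ∀ t ∈ Icc 0 T, ContinuousOn (f t) (Icc 0 1))
    (hb : ∀ t ∈ Icc 0 T, ∀ x ∈ Icc (0:ℝ) 1, |f t x| ≤ B) :
    SepCont B fun t x => f (clamp T t) (clamp 1 x) where
  left x := (h1 _ (clamp_mem zero_le_one x)).comp_continuous (continuous_clamp T) (clamp_mem hT)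
  right t := (h2 _ (clamp_mem hT t)).comp_continuous (continuous_clamp 1) (clamp_mem zero_le_one)
  bound t x := hb _ (clamp_mem hT t) _ (clamp_mem zero_le_one x)

theorem reflect (h : SepCont B H) : SepCont B fun t x => H t (1 - x) where
  left x := h.left (1 - x)
  right t := (h.right t).comp (continuous_const.sub continuous_id)
  bound t x := h.bound t (1 - x)

theorem const_mul (h : SepCont B H) {c : ℝ} (hc : 0 ≤ c) : SepCont (c * B) fun t x => c * H t x where
  left x := continuous_const.mul (h.left x)
  right t := continuous_const.mul (h.right t)
  bound t x := by
    rw [abs_mul, abs_of_nonneg hc]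
    exact mul_le_mul_of_nonneg_left (h.bound t x) hc

end SepCont

theorem SatisfiesPTE.hasDerivWithinAt_time {T : ℝ} {g : ℝ → ℝ → ℝ → ℝ → ℝ} (h : SatisfiesPTE T g)
    {t x μ ω : ℝ} (ht : t ∈ Icc 0 T) (hx : x ∈ Icc (0:ℝ) 1) (hμ : μ ∈ Icc (-1:ℝ) 1) (hω : 0 < ω) :
    HasDerivWithinAt (fun s => g s x μ ω) (deriv (fun s => g s x μ ω) t) (Icc 0 T) t :=
  (h t ht x hx μ hμ ω hω).1.hasDerivAt.hasDerivWithinAt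

theorem SatisfiesPTE.hasDerivWithinAt_space {T : ℝ} {g : ℝ → ℝ → ℝ → ℝ → ℝ} (h : SatisfiesPTE T g)
    {t x μ ω : ℝ} (ht : t ∈ Icc 0 T) (hx : x ∈ Icc (0:ℝ) 1) (hμ : μ ∈ Icc (-1:ℝ) 1) (hω : 0 < ω) :
    HasDerivWithinAt (fun y => g t y μ ω) (deriv (fun y => g t y μ ω) x) (Icc 0 1) x :=
  (h t ht x hx μ hμ ω hω).2.1.hasDerivAt.hasDerivWithinAt

/-- Bounded solutions of the phonon equation with zero initial data, nonnegative inflow at `x = 0`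
and outgoing values at `x = 1` dominating a fraction `η` of the incident ones. -/
structure Supersolution (T B : ℝ) (η : ℝ → ℝ) (g : ℝ → ℝ → ℝ → ℝ → ℝ) : Prop where
  T_pos : 0 < T
  coeff : ∀ ω > 0, η ω ∈ Icc (0:ℝ) 1
  bound : ∀ t x μ ω, |g t x μ ω| ≤ B
  int : BracketIntegrableSol T g
  eqn : SatisfiesPTE T g
  init : ∀ x ∈ Icc (0:ℝ) 1, ∀ μ ∈ Icc (-1:ℝ) 1, ∀ ω > 0, g 0 x μ ω = 0
  inflow : ∀ t ∈ Icc 0 T, ∀ μ ∈ Ioc (0:ℝ) 1, ∀ ω > 0, 0 ≤ g t 0 μ ω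
  refl : ∀ t ∈ Icc 0 T, ∀ μ ∈ Ico (-1:ℝ) 0, ∀ ω > 0, η ω * g t 1 (-μ) ω ≤ g t 1 μ ω

/-- Constant extension of a function on `[0, T] × [0, 1]` to the plane. -/
def clamped (T : ℝ) (g : ℝ → ℝ → ℝ → ℝ → ℝ) (ω t x μ : ℝ) : ℝ := g (clamp T t) (clamp 1 x) μ ω

theorem clamped_of_mem {T : ℝ} {g : ℝ → ℝ → ℝ → ℝ → ℝ} {ω t x μ : ℝ} (ht : t ∈ Icc 0 T)
    (hx : x ∈ Icc (0:ℝ) 1) : clamped T g ω t x μ = g t x μ ω := by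
  rw [clamped, clamp_of_mem ht, clamp_of_mem hx]

/-- The time integral of `⟨ω g⟩`, read off from the solution at `μ = 0`, `ω = 1`. -/
noncomputable def cumulGain (T : ℝ) (g : ℝ → ℝ → ℝ → ℝ → ℝ) (t x : ℝ) : ℝ :=
  (clamped T g 1 t x 0 + prim (fun t x => clamped T g 1 t x 0) (clamp T t) x) / Mw 1

namespace Supersolution

variable {T B : ℝ} {η : ℝ → ℝ} {g : ℝ → ℝ → ℝ → ℝ → ℝ}

theorem sep (h : Supersolution T B η g) {μ ω : ℝ} (hμ : μ ∈ Icc (-1:ℝ) 1) (hω : 0 < ω) :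
    SepCont B fun t x => clamped T g ω t x μ :=
  SepCont.of_clamp (f := fun t x => g t x μ ω) h.T_pos.le
    (fun _ hx _ ht => (h.eqn.hasDerivWithinAt_time ht hx hμ hω).continuousWithinAt)
    (fun _ ht _ hx => (h.eqn.hasDerivWithinAt_space ht hx hμ hω).continuousWithinAt)
    fun t _ x _ => h.bound t x μ ω

theorem clamped_of_nonpos (h : Supersolution T B η g) {μ ω t : ℝ} (hμ : μ ∈ Icc (-1:ℝ) 1)
    (hω : 0 < ω) (ht : t ≤ 0) (x : ℝ) : clamped T g ω t x μ = 0 := by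
  rw [clamped, _root_.clamp_of_nonpos ht]
  exact h.init _ (clamp_mem zero_le_one x) μ hμ ω hω

theorem hasDerivWithinAt_clamped_time (h : Supersolution T B η g) {t x μ ω : ℝ} (ht : t ∈ Icc 0 T)
    (hx : x ∈ Icc (0:ℝ) 1) (hμ : μ ∈ Icc (-1:ℝ) 1) (hω : 0 < ω) :
    HasDerivWithinAt (fun s => clamped T g ω s x μ) (deriv (fun s => g s x μ ω) t) (Icc 0 T) t :=
  (h.eqn.hasDerivWithinAt_time ht hx hμ hω).congr (fun _ hs => clamped_of_mem hs hx)
    (clamped_of_mem ht hx)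

theorem hasDerivWithinAt_clamped_space (h : Supersolution T B η g) {t x μ ω : ℝ} (ht : t ∈ Icc 0 T)
    (hx : x ∈ Icc (0:ℝ) 1) (hμ : μ ∈ Icc (-1:ℝ) 1) (hω : 0 < ω) :
    HasDerivWithinAt (fun y => clamped T g ω t y μ) (deriv (fun y => g t y μ ω) x) (Icc 0 1) x :=
  (h.eqn.hasDerivWithinAt_space ht hx hμ hω).congr (fun _ hy => clamped_of_mem ht hy)
    (clamped_of_mem ht hx)

theorem deriv_zero (h : Supersolution T B η g) {t x ω : ℝ} (ht : t ∈ Icc 0 T)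
    (hx : x ∈ Icc (0:ℝ) 1) (hω : 0 < ω) :
    deriv (fun s => g s x 0 ω) t
      = -(ω * g t x 0 ω) + Mw ω * bracket fun μ' ω' => ω' * g t x μ' ω' := by
  have := (h.eqn t ht x hx 0 (by norm_num) ω hω).2.2
  simpa [coll] using this

theorem hasDerivWithinAt_add_prim (h : Supersolution T B η g) {t x ω : ℝ} (ht : t ∈ Icc 0 T)
    (hx : x ∈ Icc (0:ℝ) 1) (hω : 0 < ω) :
    HasDerivWithinAt
      (fun s => clamped T g ω s x 0 + ω * prim (fun t x => clamped T g ω t x 0) s x)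
      (Mw ω * bracket fun μ' ω' => ω' * g t x μ' ω') (Icc 0 T) t := by
  have h0 : (0:ℝ) ∈ Icc (-1:ℝ) 1 := by norm_num
  have h1 := h.hasDerivWithinAt_clamped_time ht hx h0 hω
  have h2 := (((h.sep h0 hω).hasDerivAt_prim t x).const_mul ω).hasDerivWithinAt (s := Icc 0 T)
  refine (h1.add h2).congr_deriv ?_
  rw [h.deriv_zero ht hx hω, clamped_of_mem ht hx]
  ring

theorem hasDerivWithinAt_cumulGain (h : Supersolution T B η g) {t x : ℝ} (ht : t ∈ Icc 0 T)
    (hx : x ∈ Icc (0:ℝ) 1) :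
    HasDerivWithinAt (fun s => cumulGain T g s x) (bracket fun μ' ω' => ω' * g t x μ' ω')
      (Icc 0 T) t := by
  have h1 := (h.hasDerivWithinAt_add_prim ht hx one_pos).div_const (Mw 1)
  rw [mul_div_cancel_left₀ _ (Mw_pos one_pos).ne'] at h1
  have h2 : ∀ s ∈ Icc 0 T, cumulGain T g s x
      = (clamped T g 1 s x 0 + 1 * prim (fun t x => clamped T g 1 t x 0) s x) / Mw 1 := fun s hs => by
    rw [cumulGain, clamp_of_mem hs, one_mul]
  exact h1.congr h2 (h2 t ht)

theorem cumulGain_of_nonpos (h : Supersolution T B η g) {t : ℝ} (ht : t ≤ 0) (x : ℝ) :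
    cumulGain T g t x = 0 := by
  rw [cumulGain, h.clamped_of_nonpos (by norm_num) one_pos ht, _root_.clamp_of_nonpos ht]
  simp [prim]

theorem sep_cumulGain (h : Supersolution T B η g) :
    SepCont ((B + B * T) / Mw 1) (cumulGain T g) := by
  have hs : SepCont B fun t x => clamped T g 1 t x 0 := h.sep (by norm_num) one_pos
  refine ⟨fun x => ?_, fun t => ?_, fun t x => ?_⟩
  · have hc : Continuous fun t => prim (fun t x => clamped T g 1 t x 0) (clamp T t) x :=
      (continuous_iff_continuousAt.2 fun t => (hs.hasDerivAt_prim t x).continuousAt).comp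
        (continuous_clamp T)
    exact ((hs.left x).add hc).div_const _
  · exact ((hs.right t).add (hs.continuous_prim_right _)).div_const _
  · have hp := Mw_pos one_pos
    have hB : 0 ≤ B := (abs_nonneg _).trans (hs.bound 0 0)
    have hm := clamp_mem h.T_pos.le t
    rw [cumulGain, abs_div, abs_of_pos hp]
    refine div_le_div_of_nonneg_right ((abs_add_le _ _).trans (add_le_add (hs.bound t x) ?_)) hp.le
    refine (hs.abs_prim_le _ x).trans (mul_le_mul_of_nonneg_left ?_ hB)
    rw [abs_of_nonneg hm.1]
    exact hm.2

theorem mul_cumulGain (h : Supersolution T B η g) {t x ω : ℝ} (ht : t ∈ Icc 0 T)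
    (hx : x ∈ Icc (0:ℝ) 1) (hω : 0 < ω) :
    Mw ω * cumulGain T g t x
      = clamped T g ω t x 0 + ω * prim (fun t x => clamped T g ω t x 0) t x := by
  have hd : ∀ s ∈ Icc 0 T, HasDerivWithinAt (fun s => Mw ω * cumulGain T g s x
      - (clamped T g ω s x 0 + ω * prim (fun t x => clamped T g ω t x 0) s x)) 0 (Icc 0 T) s :=
    fun s hs => (((h.hasDerivWithinAt_cumulGain hs hx).const_mul (Mw ω)).sub
      (h.hasDerivWithinAt_add_prim hs hx hω)).congr_deriv (sub_self _)
  have hc := constant_of_derivWithin_zero (fun s hs => (hd s hs).differentiableWithinAt)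
    (fun s hs => (hd s (Ico_subset_Icc_self hs)).derivWithin
      (uniqueDiffOn_Icc h.T_pos s (Ico_subset_Icc_self hs))) t ht
  simp only [h.cumulGain_of_nonpos le_rfl, h.clamped_of_nonpos (by norm_num : (0:ℝ) ∈ Icc (-1:ℝ) 1)
    hω le_rfl] at hc
  simp only [prim, intervalIntegral.integral_same, mul_zero, add_zero, sub_zero] at hc
  exact sub_eq_zero.1 hc

theorem transport_eq (h : Supersolution T B η g) {t x μ ω : ℝ} (ht : t ∈ Icc 0 T)
    (hx : x ∈ Icc (0:ℝ) 1) (hμ : μ ∈ Icc (-1:ℝ) 1) (hω : 0 < ω) :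
    deriv (fun s => g s x μ ω) t + μ * ω * deriv (fun y => g t y μ ω) x + ω * clamped T g ω t x μ
      = deriv (fun s => g s x 0 ω) t + ω * clamped T g ω t x 0 := by
  rw [(h.eqn t ht x hx μ hμ ω hω).2.2, h.deriv_zero ht hx hω, clamped_of_mem ht hx,
    clamped_of_mem ht hx, coll]
  ring

theorem fsol (h : Supersolution T B η g) {ω : ℝ} (hω : 0 < ω) :
    FSol T ω (η ω) B (Mw ω * ((B + B * T) / Mw 1)) (fun t x => Mw ω * cumulGain T g t x)
      (clamped T g ω) := by
  have h0 : (0:ℝ) ∈ Icc (-1:ℝ) 1 := by norm_num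
  have h1 : ∀ μ ∈ Ioc (0:ℝ) 1, μ ∈ Icc (-1:ℝ) 1 := fun μ hμ => ⟨by linarith [hμ.1], hμ.2⟩
  have h2 : ∀ μ ∈ Ioc (0:ℝ) 1, -μ ∈ Icc (-1:ℝ) 1 := fun μ hμ =>
    ⟨by linarith [hμ.2], by linarith [hμ.1]⟩
  have hr : ∀ x ∈ Icc (0:ℝ) 1, 1 - x ∈ Icc (0:ℝ) 1 := fun x hx =>
    ⟨by linarith [hx.2], by linarith [hx.1]⟩
  have hsub : ∀ x : ℝ, HasDerivWithinAt (fun y : ℝ => 1 - y) (-1) (Icc 0 1) x := fun x =>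
    ((hasDerivAt_id x).const_sub 1).hasDerivWithinAt
  have hS := h.sep_cumulGain.const_mul (Mw_pos hω).le
  have hS0 : ∀ t ≤ 0, ∀ x, Mw ω * cumulGain T g t x = 0 := fun t ht x => by
    rw [h.cumulGain_of_nonpos ht, mul_zero]
  refine ⟨h.T_pos, hω, h.coeff ω hω, fun t x μ => h.bound _ _ _ _, fun μ hμ => ?_, fun μ hμ => ?_,
    fun μ hμ t => ?_, fun μ hμ t => ?_, fun t x => ?_⟩
  · exact Tr.of_raw (z := fun t x => clamped T g ω t x 0)
      (wt := fun t x => deriv (fun s => g s x μ ω) t) (wx := fun t x => deriv (fun y => g t y μ ω) x)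
      (zt := fun t x => deriv (fun s => g s x 0 ω) t) (zx := fun t x => deriv (fun y => g t y 0 ω) x)
      hω.le (mul_nonneg hμ.1.le hω.le) (h.sep (h1 μ hμ) hω) (h.sep h0 hω) hS
      (fun t ht x => h.clamped_of_nonpos (h1 μ hμ) hω ht x)
      (fun t ht x => h.clamped_of_nonpos h0 hω ht x) hS0
      (fun t ht x hx => h.mul_cumulGain ht hx hω)
      (fun t ht x hx => h.hasDerivWithinAt_clamped_time ht hx (h1 μ hμ) hω)
      (fun t ht x hx => h.hasDerivWithinAt_clamped_space ht hx (h1 μ hμ) hω)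
      (fun t ht x hx => h.hasDerivWithinAt_clamped_time ht hx h0 hω)
      (fun t ht x hx => h.hasDerivWithinAt_clamped_space ht hx h0 hω)
      (fun t ht x hx => h.transport_eq ht hx (h1 μ hμ) hω)
  · exact Tr.of_raw (z := fun t x => clamped T g ω t (1 - x) 0)
      (wt := fun t x => deriv (fun s => g s (1 - x) (-μ) ω) t)
      (wx := fun t x => deriv (fun y => g t y (-μ) ω) (1 - x) * -1)
      (zt := fun t x => deriv (fun s => g s (1 - x) 0 ω) t)
      (zx := fun t x => deriv (fun y => g t y 0 ω) (1 - x) * -1)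
      hω.le (mul_nonneg hμ.1.le hω.le) (h.sep (h2 μ hμ) hω).reflect (h.sep h0 hω).reflect hS.reflect
      (fun t ht x => h.clamped_of_nonpos (h2 μ hμ) hω ht _)
      (fun t ht x => h.clamped_of_nonpos h0 hω ht _) (fun t ht x => hS0 t ht _)
      (fun t ht x hx => h.mul_cumulGain ht (hr x hx) hω)
      (fun t ht x hx => h.hasDerivWithinAt_clamped_time ht (hr x hx) (h2 μ hμ) hω)
      (fun t ht x hx => (h.hasDerivWithinAt_clamped_space ht (hr x hx) (h2 μ hμ) hω).comp x
        (hsub x) hr)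
      (fun t ht x hx => h.hasDerivWithinAt_clamped_time ht (hr x hx) h0 hω)
      (fun t ht x hx => (h.hasDerivWithinAt_clamped_space ht (hr x hx) h0 hω).comp x (hsub x) hr)
      (fun t ht x hx => by
        have := h.transport_eq ht (hr x hx) (h2 μ hμ) hω
        linear_combination this)
  · rw [clamped, clamp_of_mem (left_mem_Icc.2 zero_le_one)]
    exact h.inflow _ (clamp_mem h.T_pos.le t) μ hμ ω hω
  · rw [clamped, clamped, clamp_of_mem (right_mem_Icc.2 zero_le_one)]
    have := h.refl _ (clamp_mem h.T_pos.le t) (-μ) ⟨by linarith [hμ.2], by linarith [hμ.1]⟩ ω hω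
    rwa [neg_neg] at this
  · have := ((h.int _ (clamp_mem h.T_pos.le t) _ (clamp_mem zero_le_one x)).1 ω hω).const_mul ω⁻¹
    refine this.aestronglyMeasurable.congr (Eventually.of_forall fun μ => ?_)
    exact inv_mul_cancel_left₀ hω.ne' _

theorem fam (h : Supersolution T B η g) :
    Fam T B ((B + B * T) / Mw 1) (216 / wgstar) Mw (cumulGain T g) (clamped T g) where
  fsol ω hω := ⟨η ω, h.fsol hω⟩
  T_pos := h.T_pos
  sep := h.sep_cumulGain
  zero _ ht x := h.cumulGain_of_nonpos ht x
  int t x := by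
    refine (h.int _ (clamp_mem h.T_pos.le t) _ (clamp_mem zero_le_one x)).2.congr
      (Eventually.of_forall fun ω => ?_)
    exact integral_const_mul _ _
  deriv x hx t ht := by
    refine (h.hasDerivWithinAt_cumulGain ht hx).congr_deriv ?_
    refine integral_congr_ae (Eventually.of_forall fun ω => ?_)
    refine (integral_const_mul _ _).trans ?_
    simp only [vavg, clamped_of_mem ht hx]
  pos _ hω := Mw_pos hω
  le _ hω := Mw_le hω
  intM := integrableOn_Mw
  mass := two_mul_integral_Mw

theorem bracket_nonneg (h : Supersolution T B η g) {t x : ℝ} (ht : t ∈ Icc 0 T)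
    (hx : x ∈ Icc (0:ℝ) 1) : 0 ≤ bracket fun μ ω => ω * g t x μ ω := by
  refine (h.fam.gain_nonneg ht hx).trans_eq ?_
  refine (integral_congr_ae (Eventually.of_forall fun ω => ?_)).symm
  refine (integral_const_mul _ _).trans ?_
  simp only [vavg, clamped_of_mem ht hx]

theorem nonneg (h : Supersolution T B η g) {t x μ ω : ℝ} (ht : t ∈ Icc 0 T)
    (hx : x ∈ Icc (0:ℝ) 1) (hμ : μ ∈ Icc (-1:ℝ) 1) (hω : 0 < ω) : 0 ≤ g t x μ ω := by
  rcases eq_or_ne μ 0 with rfl | h0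
  · have hd : ∀ s ∈ Icc 0 T, HasDerivWithinAt (fun s => Real.exp (ω * s) * g s x 0 ω)
        (Real.exp (ω * s) * (Mw ω * bracket fun μ' ω' => ω' * g s x μ' ω')) (Icc 0 T) s := by
      intro s hs
      have h1 : HasDerivWithinAt (fun s : ℝ => Real.exp (ω * s)) (Real.exp (ω * s) * (ω * 1))
          (Icc 0 T) s := (((hasDerivAt_id s).const_mul ω).exp).hasDerivWithinAt
      refine (h1.mul (h.eqn.hasDerivWithinAt_time hs hx hμ hω)).congr_deriv ?_
      rw [h.deriv_zero hs hx hω]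
      ring
    have hm : MonotoneOn (fun s => Real.exp (ω * s) * g s x 0 ω) (Icc 0 T) := by
      refine monotoneOn_of_hasDerivWithinAt_nonneg (convex_Icc 0 T)
        (fun s hs => (hd s hs).continuousWithinAt)
        (fun s hs => (hd s (interior_subset hs)).mono interior_subset) fun s hs => ?_
      exact mul_nonneg (Real.exp_pos _).le
        (mul_nonneg (Mw_pos hω).le (h.bracket_nonneg (interior_subset hs) hx))
    have h2 := hm (left_mem_Icc.2 h.T_pos.le) ht ht.1
    simp only [h.init x hx 0 hμ ω hω, mul_zero] at h2
    exact nonneg_of_mul_nonneg_right h2 (Real.exp_pos _)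
  · have := h.fam.nonneg_of_ne hω ht hx hμ h0
    rwa [clamped_of_mem ht hx] at this

end Supersolution

theorem BracketIntegrable.add_mul {f₁ f₂ : ℝ → ℝ → ℝ} (h₁ : BracketIntegrable f₁)
    (h₂ : BracketIntegrable f₂) (a b : ℝ) :
    BracketIntegrable (fun μ ω => a * f₁ μ ω + b * f₂ μ ω) ∧
      bracket (fun μ ω => a * f₁ μ ω + b * f₂ μ ω) = a * bracket f₁ + b * bracket f₂ := by
  have h : ∀ ω ∈ Ioi (0:ℝ), ∫ μ in Icc (-1:ℝ) 1, (a * f₁ μ ω + b * f₂ μ ω)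
      = a * (∫ μ in Icc (-1:ℝ) 1, f₁ μ ω) + b * ∫ μ in Icc (-1:ℝ) 1, f₂ μ ω := fun ω hω => by
    rw [integral_add ((h₁.1 ω hω).const_mul a) ((h₂.1 ω hω).const_mul b), integral_const_mul,
      integral_const_mul]
  refine ⟨⟨fun ω hω => ((h₁.1 ω hω).const_mul a).add ((h₂.1 ω hω).const_mul b), ?_⟩, ?_⟩
  · exact IntegrableOn.congr_fun ((h₁.2.const_mul a).add (h₂.2.const_mul b))
      (fun ω hω => (h ω hω).symm) measurableSet_Ioi
  · rw [bracket, setIntegral_congr_fun measurableSet_Ioi h,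
      integral_add (h₁.2.const_mul a) (h₂.2.const_mul b), integral_const_mul, integral_const_mul]
    rfl

theorem mul_add_mul_eq (g₁ g₂ : ℝ → ℝ → ℝ → ℝ → ℝ) (a b t x : ℝ) :
    (fun μ ω => ω * (a * g₁ t x μ ω + b * g₂ t x μ ω))
      = fun μ ω => a * (ω * g₁ t x μ ω) + b * (ω * g₂ t x μ ω) := by
  ext μ ω
  ring

theorem BracketIntegrableSol.add_mul {T : ℝ} {g₁ g₂ : ℝ → ℝ → ℝ → ℝ → ℝ}
    (h₁ : BracketIntegrableSol T g₁) (h₂ : BracketIntegrableSol T g₂) (a b : ℝ) :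
    BracketIntegrableSol T fun t x μ ω => a * g₁ t x μ ω + b * g₂ t x μ ω := by
  intro t ht x hx
  rw [mul_add_mul_eq]
  exact ((h₁ t ht x hx).add_mul (h₂ t ht x hx) a b).1

theorem SatisfiesPTE.add_mul {T : ℝ} {g₁ g₂ : ℝ → ℝ → ℝ → ℝ → ℝ}
    (h₁ : SatisfiesPTE T g₁) (h₂ : SatisfiesPTE T g₂) (hi₁ : BracketIntegrableSol T g₁)
    (hi₂ : BracketIntegrableSol T g₂) (a b : ℝ) :
    SatisfiesPTE T fun t x μ ω => a * g₁ t x μ ω + b * g₂ t x μ ω := by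
  intro t ht x hx μ hμ ω hω
  obtain ⟨ht₁, hx₁, he₁⟩ := h₁ t ht x hx μ hμ ω hω
  obtain ⟨ht₂, hx₂, he₂⟩ := h₂ t ht x hx μ hμ ω hω
  have hdt := (ht₁.hasDerivAt.const_mul a).add (ht₂.hasDerivAt.const_mul b)
  have hdx := (hx₁.hasDerivAt.const_mul a).add (hx₂.hasDerivAt.const_mul b)
  refine ⟨hdt.differentiableAt, hdx.differentiableAt, ?_⟩
  have e1 : deriv (fun s => a * g₁ s x μ ω + b * g₂ s x μ ω) t = _ := hdt.deriv
  have e2 : deriv (fun y => a * g₁ t y μ ω + b * g₂ t y μ ω) x = _ := hdx.deriv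
  have e3 := ((hi₁ t ht x hx).add_mul (hi₂ t ht x hx) a b).2
  rw [e1, e2, coll, mul_add_mul_eq, e3]
  simp only [coll] at he₁ he₂
  linear_combination a * he₁ + b * he₂

theorem BoundedFn.add_mul {g₁ g₂ : ℝ → ℝ → ℝ → ℝ → ℝ} (h₁ : BoundedFn g₁) (h₂ : BoundedFn g₂)
    (a b : ℝ) : BoundedFn fun t x μ ω => a * g₁ t x μ ω + b * g₂ t x μ ω := by
  obtain ⟨B₁, h₁⟩ := h₁
  obtain ⟨B₂, h₂⟩ := h₂
  refine ⟨|a| * B₁ + |b| * B₂, fun t x μ ω => (abs_add_le _ _).trans ?_⟩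
  rw [abs_mul, abs_mul]
  exact add_le_add (mul_le_mul_of_nonneg_left (h₁ t x μ ω) (abs_nonneg a))
    (mul_le_mul_of_nonneg_left (h₂ t x μ ω) (abs_nonneg b))

/-- Weak positivity for the phonon equation with absorbing-reflecting boundary. -/
theorem SatisfiesPTE.nonneg {T : ℝ} (hT : 0 < T) {η : ℝ → ℝ} {g : ℝ → ℝ → ℝ → ℝ → ℝ}
    (h : SatisfiesPTE T g) (hb : BoundedFn g) (hi : BracketIntegrableSol T g)
    (hη : ∀ ω > 0, η ω ∈ Icc (0:ℝ) 1)
    (h0 : ∀ x ∈ Icc (0:ℝ) 1, ∀ μ ∈ Icc (-1:ℝ) 1, ∀ ω > 0, g 0 x μ ω = 0)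
    (hin : ∀ t ∈ Icc 0 T, ∀ μ ∈ Ioc (0:ℝ) 1, ∀ ω > 0, 0 ≤ g t 0 μ ω)
    (hr : ∀ t ∈ Icc 0 T, ∀ μ ∈ Ico (-1:ℝ) 0, ∀ ω > 0, η ω * g t 1 (-μ) ω ≤ g t 1 μ ω) :
    ∀ t ∈ Icc 0 T, ∀ x ∈ Icc (0:ℝ) 1, ∀ μ ∈ Icc (-1:ℝ) 1, ∀ ω > 0, 0 ≤ g t x μ ω := by
  obtain ⟨B, hB⟩ := hb
  have hS : Supersolution T B η g := ⟨hT, hη, hB, hi, h, h0, hin, hr⟩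
  exact fun t ht x hx μ hμ ω hω => hS.nonneg ht hx hμ hω

end

/-- Pointwise convex-combination comparison: with `α, β ≥ 0`, `α + β = 1`,
`η₁ ≥ η₂` pointwise and a bounded nonnegative incoming datum `φ`, the bounded
forward solutions `g₁, g₂, g` for reflection coefficients `η₁`, `η₂` and
`α η₁ + β η₂` satisfy `α g₁ + β g₂ ≥ g` at every point of the domain. -/
theorem convex_combination_pointwise (Tmax : ℝ) (hT : 0 < Tmax) (α β : ℝ)
    (hα : 0 ≤ α) (hβ : 0 ≤ β) (hαβ : α + β = 1)
    (η₁ η₂ : ℝ → ℝ) (φ : ℝ → ℝ → ℝ → ℝ) (g₁ g₂ g : ℝ → ℝ → ℝ → ℝ → ℝ)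
    (hη₁ : ∀ ω ∈ Ioi (0:ℝ), η₁ ω ∈ Icc (0:ℝ) 1)
    (hη₂ : ∀ ω ∈ Ioi (0:ℝ), η₂ ω ∈ Icc (0:ℝ) 1)
    (hmono : ∀ ω ∈ Ioi (0:ℝ), η₂ ω ≤ η₁ ω)
    (hφbdd : ∃ Cφ, ∀ t μ ω, |φ t μ ω| ≤ Cφ)
    (hφpos : ∀ t ∈ Icc (0:ℝ) Tmax, ∀ μ ∈ Ioc (0:ℝ) 1, ∀ ω ∈ Ioi (0:ℝ), 0 ≤ φ t μ ω)
    (hb₁ : BoundedFn g₁) (hb₂ : BoundedFn g₂) (hb : BoundedFn g)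
    (hi₁ : BracketIntegrableSol Tmax g₁) (hi₂ : BracketIntegrableSol Tmax g₂)
    (hi : BracketIntegrableSol Tmax g)
    (hs₁ : IsForwardSolution Tmax η₁ φ g₁) (hs₂ : IsForwardSolution Tmax η₂ φ g₂)
    (hs : IsForwardSolution Tmax (fun ω => α * η₁ ω + β * η₂ ω) φ g) :
    ∀ t ∈ Icc (0:ℝ) Tmax, ∀ x ∈ Icc (0:ℝ) 1, ∀ μ ∈ Icc (-1:ℝ) 1, ∀ ω ∈ Ioi (0:ℝ),
      g t x μ ω ≤ α * g₁ t x μ ω + β * g₂ t x μ ω := by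
  obtain ⟨hp₁, hz₁, hl₁, hr₁⟩ := hs₁
  obtain ⟨hp₂, hz₂, hl₂, hr₂⟩ := hs₂
  obtain ⟨hp, hz, hl, hr⟩ := hs
  have h1 : (1:ℝ) ∈ Icc (0:ℝ) 1 := right_mem_Icc.2 zero_le_one
  have hneg : ∀ μ ∈ Ico (-1:ℝ) 0, -μ ∈ Icc (-1:ℝ) 1 := fun μ hμ =>
    ⟨by linarith [hμ.2], by linarith [hμ.1]⟩
  have pos₂ := hp₂.nonneg hT hb₂ hi₂ hη₂ hz₂
    (fun t ht μ hμ ω hω => by rw [hl₂ t ht μ hμ ω hω]; exact hφpos t ht μ hμ ω hω)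
    (fun t ht μ hμ ω hω => (hr₂ t ht μ hμ ω hω).ge)
  have pos₁₂ := (hp₁.add_mul hp₂ hi₁ hi₂ 1 (-1)).nonneg hT (hb₁.add_mul hb₂ 1 (-1))
    (hi₁.add_mul hi₂ 1 (-1)) hη₁
    (fun x hx μ hμ ω hω => by rw [hz₁ x hx μ hμ ω hω, hz₂ x hx μ hμ ω hω]; ring)
    (fun t ht μ hμ ω hω => by rw [hl₁ t ht μ hμ ω hω, hl₂ t ht μ hμ ω hω]; linarith)
    (fun t ht μ hμ ω hω => by
      rw [hr₁ t ht μ hμ ω hω, hr₂ t ht μ hμ ω hω]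
      have := mul_nonneg (sub_nonneg.2 (hmono ω hω)) (pos₂ t ht 1 h1 (-μ) (hneg μ hμ) ω hω)
      linarith)
  have hi₃ := hi₁.add_mul hi₂ α β
  have hη : ∀ ω > 0, α * η₁ ω + β * η₂ ω ∈ Icc (0:ℝ) 1 := fun ω hω =>
    convex_Icc (0:ℝ) 1 (hη₁ ω hω) (hη₂ ω hω) hα hβ hαβ
  have pos := ((hp₁.add_mul hp₂ hi₁ hi₂ α β).add_mul hp hi₃ hi 1 (-1)).nonneg hT
    ((hb₁.add_mul hb₂ α β).add_mul hb 1 (-1)) (hi₃.add_mul hi 1 (-1)) hη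
    (fun x hx μ hμ ω hω => by
      rw [hz₁ x hx μ hμ ω hω, hz₂ x hx μ hμ ω hω, hz x hx μ hμ ω hω]; ring)
    (fun t ht μ hμ ω hω => by
      rw [hl₁ t ht μ hμ ω hω, hl₂ t ht μ hμ ω hω, hl t ht μ hμ ω hω]
      exact le_of_eq (by linear_combination (-φ t μ ω) * hαβ))
    (fun t ht μ hμ ω hω => by
      rw [hr₁ t ht μ hμ ω hω, hr₂ t ht μ hμ ω hω, hr t ht μ hμ ω hω]
      have := mul_nonneg (mul_nonneg (mul_nonneg hα hβ) (sub_nonneg.2 (hmono ω hω)))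
        (pos₁₂ t ht 1 h1 (-μ) (hneg μ hμ) ω hω)
      obtain rfl : β = 1 - α := by linarith
      refine sub_nonneg.1 (this.trans_eq ?_)
      ring)
  intro t ht x hx μ hμ ω hω
  have := pos t ht x hx μ hμ ω hω
  linarith
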